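/- For every positive integer n and every real K ≥ 1 there exists a constant C = C(n, K) ≥ 1 such that the following holds (Hrushovski's theorem). Let A be a finite nonempty subset of SL_n(ℂ) with |A·A| ≤ K·|A|. Then there exist a subset A′ ⊆ A with |A′| ≥ |A|/C and a solvable subgroup H of SL_n(ℂ) such that A′ ⊆ H. -/

import Mathlib

open Pointwise

namespace ApproxLinear

open Module (finrank)

section Covering

variable {G : Type*} [Group G]

/-- `S` is covered by at most `C` left translates of `H`. -/
def Cov (C : ℕ) (S H : Set G) : Prop :=
  ∃ Y : Finset G, Y.card ≤ C ∧ ∀ s ∈ S, ∃ y ∈ Y, y⁻¹ * s ∈ H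

/-- Finite approximate subgroups. -/
structure IsApx (K : ℕ) (A : Set G) : Prop where
  fin : A.Finite
  one : 1 ∈ A
  inv : ∀ x ∈ A, x⁻¹ ∈ A
  cov : Cov K (A * A) A

lemma Cov.mono {C D : ℕ} {S S' H H' : Set G} (h : Cov C S H) (hC : C ≤ D) (hS : S' ⊆ S)
    (hH : H ⊆ H') : Cov D S' H' := by
  obtain ⟨Y, hY, h⟩ := h
  refine ⟨Y, hY.trans hC, fun s hs => ?_⟩
  obtain ⟨y, hy, h'⟩ := h s (hS hs)
  exact ⟨y, hy, hH h'⟩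

lemma Cov.of_subset {S H : Set G} (h : S ⊆ H) : Cov 1 S H :=
  ⟨{1}, by simp, fun s hs => ⟨1, by simp, by simpa using h hs⟩⟩

/-- A colouring whose colour classes lie in single left cosets gives a covering. -/
lemma Cov.of_color {κ : Type*} (Y : Finset κ) {S : Set G} {H : Subgroup G}
    (R : G → κ → Prop) (h : ∀ s ∈ S, ∃ y ∈ Y, R s y)
    (h2 : ∀ y, ∀ s ∈ S, ∀ t ∈ S, R s y → R t y → s⁻¹ * t ∈ H) : Cov Y.card S H := by
  classical
  rcases isEmpty_or_nonempty κ with hκ | hκ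
  · exact ⟨∅, by simp, fun s hs => (hκ.false (h s hs).choose).elim⟩
  choose! f hfY hf using h
  let g : κ → G := fun y => if hy : ∃ s ∈ S, R s y then hy.choose else 1
  refine ⟨Y.image g, Finset.card_image_le, fun s hs => ⟨g (f s), ?_, ?_⟩⟩
  · exact Finset.mem_image_of_mem _ (hfY s hs)
  · have hy : ∃ t ∈ S, R t (f s) := ⟨s, hs, hf s hs⟩
    have : g (f s) = hy.choose := by simp only [g]; rw [dif_pos hy]
    rw [this]
    exact h2 _ _ hy.choose_spec.1 _ hs hy.choose_spec.2 (hf s hs)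

lemma Cov.exists_subset {C : ℕ} {S : Set G} {H : Subgroup G} (h : Cov C S H) :
    ∃ Y : Finset G, Y.card ≤ C ∧ (Y : Set G) ⊆ S ∧ ∀ s ∈ S, ∃ y ∈ Y, y⁻¹ * s ∈ H := by
  classical
  obtain ⟨Y, hY, h⟩ := h
  let g : G → G := fun y => if hy : ∃ s ∈ S, y⁻¹ * s ∈ H then hy.choose else 1
  refine ⟨(Y.filter (fun y => ∃ s ∈ S, y⁻¹ * s ∈ H)).image g,
    (Finset.card_image_le.trans (Finset.card_filter_le _ _)).trans hY, ?_, ?_⟩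
  · intro x hx
    simp only [Finset.coe_image, Finset.coe_filter, Set.mem_image, Set.mem_ofPred_eq] at hx
    obtain ⟨y, ⟨_, hy⟩, rfl⟩ := hx
    have : g y = hy.choose := by simp only [g]; rw [dif_pos hy]
    rw [this]
    exact hy.choose_spec.1
  · intro s hs
    obtain ⟨y, hyY, hy'⟩ := h s hs
    have hy : ∃ t ∈ S, y⁻¹ * t ∈ H := ⟨s, hs, hy'⟩
    refine ⟨g y, Finset.mem_image_of_mem _ (Finset.mem_filter.2 ⟨hyY, hy⟩), ?_⟩
    have : g y = hy.choose := by simp only [g]; rw [dif_pos hy]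
    rw [this]
    have := H.mul_mem (H.inv_mem hy.choose_spec.2) hy'
    simpa [mul_assoc] using this

lemma Cov.inter {C D : ℕ} {S : Set G} {H L : Subgroup G} (h : Cov C S H) (h' : Cov D S L) :
    Cov (C * D) S (H ⊓ L : Subgroup G) := by
  classical
  obtain ⟨Y, hY, h⟩ := h
  obtain ⟨Z, hZ, h'⟩ := h'
  refine Cov.mono (Cov.of_color (Y ×ˢ Z)
    (fun s (p : G × G) => p.1⁻¹ * s ∈ H ∧ p.2⁻¹ * s ∈ L) ?_ ?_)
    (by rw [Finset.card_product]; exact Nat.mul_le_mul hY hZ) subset_rfl subset_rfl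
  · intro s hs
    obtain ⟨y, hy, hy'⟩ := h s hs
    obtain ⟨z, hz, hz'⟩ := h' s hs
    exact ⟨(y, z), by simp [hy, hz], hy', hz'⟩
  · rintro p s _ t _ ⟨h1, h2⟩ ⟨h3, h4⟩
    refine ⟨?_, ?_⟩
    · simpa [mul_assoc] using H.mul_mem (H.inv_mem h1) h3
    · simpa [mul_assoc] using L.mul_mem (L.inv_mem h2) h4

lemma Cov.trans {C D : ℕ} {S : Set G} {H : Subgroup G} {L : Set G} (h : Cov C S H)
    (h' : Cov D (S⁻¹ * S ∩ H) L) : Cov (C * D) S L := by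
  classical
  obtain ⟨Y, hY, hYS, h⟩ := h.exists_subset
  obtain ⟨Z, hZ, h'⟩ := h'
  refine ⟨Finset.image₂ (· * ·) Y Z, (Finset.card_image₂_le _ _ _).trans
    (Nat.mul_le_mul hY hZ), fun s hs => ?_⟩
  obtain ⟨y, hy, hys⟩ := h s hs
  obtain ⟨z, hz, hzs⟩ := h' (y⁻¹ * s)
    ⟨Set.mul_mem_mul (Set.inv_mem_inv.2 (hYS hy)) hs, hys⟩
  exact ⟨y * z, Finset.mem_image₂_of_mem hy hz, by simpa [mul_assoc] using hzs⟩

lemma Cov.card_le {C : ℕ} {S : Set G} {H : Subgroup G} (hS : S.Finite) (h : Cov C S H) :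
    S.ncard ≤ C * (S⁻¹ * S ∩ H : Set G).ncard := by
  classical
  obtain ⟨Y, hY, hYS, h⟩ := h.exists_subset
  have hfin : (S⁻¹ * S ∩ H : Set G).Finite := (hS.inv.mul hS).subset Set.inter_subset_left
  have : S ⊆ (Finset.image₂ (· * ·) Y hfin.toFinset : Finset G) := by
    intro s hs
    obtain ⟨y, hy, hys⟩ := h s hs
    rw [Finset.mem_coe, Finset.mem_image₂]
    exact ⟨y, hy, y⁻¹ * s, by simpa using
      ⟨Set.mul_mem_mul (Set.inv_mem_inv.2 (hYS hy)) hs, hys⟩, by simp⟩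
  calc S.ncard ≤ ((Finset.image₂ (· * ·) Y hfin.toFinset : Finset G) : Set G).ncard :=
        Set.ncard_le_ncard this (Finset.finite_toSet _)
    _ ≤ Y.card * hfin.toFinset.card := by
        rw [Set.ncard_coe_finset]; exact Finset.card_image₂_le _ _ _
    _ ≤ _ := by
        rw [Set.ncard_eq_toFinset_card _ hfin]
        exact Nat.mul_le_mul_right _ hY

/-- Orbit covering. -/
lemma Cov.of_finite_image {X : Type*} (f : G → X) {S : Set G} {H : Subgroup G} {T : Set X}
    (hT : T.Finite) {N : ℕ} (hN : T.ncard ≤ N) (hf : ∀ s ∈ S, f s ∈ T)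
    (h : ∀ s ∈ S, ∀ t ∈ S, f s = f t → s⁻¹ * t ∈ H) : Cov N S H := by
  refine Cov.mono (Cov.of_color hT.toFinset (fun s y => f s = y) ?_ ?_)
    (by rw [← Set.ncard_eq_toFinset_card _ hT]; exact hN) subset_rfl subset_rfl
  · intro s hs; exact ⟨f s, by simpa using hf s hs, rfl⟩
  · rintro y s hs t ht h1 h2; exact h s hs t ht (h1.trans h2.symm)

namespace IsApx

variable {K : ℕ} {A : Set G}

lemma inv_eq (h : IsApx K A) : A⁻¹ = A := by
  ext x
  exact ⟨fun hx => by simpa using h.inv _ hx, fun hx => h.inv _ hx⟩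

lemma pow_mono (h : IsApx K A) {m k : ℕ} (hmk : m ≤ k) : A ^ m ⊆ A ^ k :=
  Set.pow_subset_pow_right h.one hmk

lemma subset_pow (h : IsApx K A) {m : ℕ} (hm : m ≠ 0) : A ⊆ A ^ m := by
  simpa using h.pow_mono (Nat.one_le_iff_ne_zero.2 hm)

lemma fin_pow (h : IsApx K A) (m : ℕ) : (A ^ m).Finite := by
  induction m with
  | zero => simp
  | succ m ih => rw [pow_succ]; exact ih.mul h.fin

lemma inv_pow (h : IsApx K A) {m : ℕ} {x : G} (hx : x ∈ A ^ m) : x⁻¹ ∈ A ^ m := by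
  have : x⁻¹ ∈ (A ^ m)⁻¹ := Set.inv_mem_inv.2 hx
  rwa [← _root_.inv_pow, h.inv_eq] at this

lemma mul_pow (_ : IsApx K A) {m k : ℕ} {x y : G} (hx : x ∈ A ^ m) (hy : y ∈ A ^ k) :
    x * y ∈ A ^ (m + k) := by
  rw [pow_add]; exact Set.mul_mem_mul hx hy

lemma cov_pow (h : IsApx K A) (m : ℕ) : Cov (K ^ m) (A ^ (m + 1)) A := by
  classical
  induction m with
  | zero => exact Cov.of_subset (by simp)
  | succ m ih =>
    obtain ⟨Y, hY, ih⟩ := ih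
    obtain ⟨X, hX, hc⟩ := h.cov
    refine ⟨Finset.image₂ (· * ·) Y X, (Finset.card_image₂_le _ _ _).trans
      (by rw [pow_succ]; exact Nat.mul_le_mul hY hX), fun s hs => ?_⟩
    rw [pow_succ] at hs
    obtain ⟨u, hu, a, ha, rfl⟩ := hs
    obtain ⟨y, hy, hyu⟩ := ih u hu
    obtain ⟨x, hx, hxs⟩ := hc _ (Set.mul_mem_mul hyu ha)
    exact ⟨y * x, Finset.mem_image₂_of_mem hy hx, by simpa [mul_assoc] using hxs⟩

lemma one_le (h : IsApx K A) : 1 ≤ K := by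
  obtain ⟨X, hX, hc⟩ := h.cov
  obtain ⟨x, hx, -⟩ := hc 1 ⟨1, h.one, 1, h.one, by simp⟩
  exact (Finset.card_pos.2 ⟨x, hx⟩).trans_le hX

lemma ncard_pow (h : IsApx K A) (m : ℕ) : (A ^ (m + 1)).ncard ≤ K ^ m * A.ncard := by
  classical
  obtain ⟨Y, hY, hc⟩ := h.cov_pow m
  calc (A ^ (m + 1)).ncard
      ≤ ((Finset.image₂ (· * ·) Y h.fin.toFinset : Finset G) : Set G).ncard := by
        refine Set.ncard_le_ncard ?_ (Finset.finite_toSet _)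
        intro s hs
        obtain ⟨y, hy, hys⟩ := hc s hs
        rw [Finset.mem_coe, Finset.mem_image₂]
        exact ⟨y, hy, y⁻¹ * s, by simpa using hys, by simp⟩
    _ ≤ Y.card * h.fin.toFinset.card := by
        rw [Set.ncard_coe_finset]; exact Finset.card_image₂_le _ _ _
    _ ≤ _ := by
        rw [Set.ncard_eq_toFinset_card _ h.fin]
        exact Nat.mul_le_mul_right _ hY

lemma ncard_pos (h : IsApx K A) : 0 < A.ncard := (Set.ncard_pos h.fin).2 ⟨1, h.one⟩

/-- Powers of `A` intersected with a subgroup are controlled by `A ^ 2`. -/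
lemma pow_inter (h : IsApx K A) (m : ℕ) (H : Subgroup G) :
    Cov (K ^ m) (A ^ (m + 1) ∩ H) (A ^ 2 ∩ H) := by
  classical
  obtain ⟨Y, hY, hc⟩ := h.cov_pow m
  let g : G → G := fun y => if hy : ∃ s ∈ H, y⁻¹ * s ∈ A then hy.choose else 1
  refine ⟨Y.image g, Finset.card_image_le.trans hY, ?_⟩
  rintro s ⟨hs, hsH⟩
  obtain ⟨y, hyY, hys⟩ := hc s hs
  have hy : ∃ s ∈ H, y⁻¹ * s ∈ A := ⟨s, hsH, hys⟩
  refine ⟨g y, Finset.mem_image_of_mem _ hyY, ?_⟩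
  have : g y = hy.choose := by simp only [g]; rw [dif_pos hy]
  rw [this]
  refine ⟨?_, H.mul_mem (H.inv_mem hy.choose_spec.1) hsH⟩
  rw [pow_two]
  have := Set.mul_mem_mul (h.inv _ hy.choose_spec.2) hys
  simpa [mul_assoc] using this

lemma cov_pow_inter (h : IsApx K A) (m : ℕ) {H : Subgroup G} {C : ℕ} {L : Set G}
    (hc : Cov C (A ^ 2 ∩ H) L) : Cov (K ^ m * C) (A ^ (m + 1) ∩ H) L := by
  classical
  obtain ⟨Y, hY, h1⟩ := h.pow_inter m H
  obtain ⟨Z, hZ, h2⟩ := hc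
  refine ⟨Finset.image₂ (· * ·) Y Z, (Finset.card_image₂_le _ _ _).trans
    (Nat.mul_le_mul hY hZ), fun s hs => ?_⟩
  obtain ⟨y, hy, hys⟩ := h1 s hs
  obtain ⟨z, hz, hzs⟩ := h2 _ hys
  exact ⟨y * z, Finset.mem_image₂_of_mem hy hz, by simpa [mul_assoc] using hzs⟩

lemma inter (h : IsApx K A) (H : Subgroup G) : IsApx (K ^ 3) (A ^ 2 ∩ H) where
  fin := (h.fin_pow 2).subset Set.inter_subset_left
  one := ⟨Set.one_mem_pow h.one, H.one_mem⟩
  inv := fun _ hx => ⟨h.inv_pow hx.1, H.inv_mem hx.2⟩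
  cov := by
    refine (h.pow_inter 3 H).mono le_rfl ?_ subset_rfl
    rintro _ ⟨a, ha, b, hb, rfl⟩
    exact ⟨h.mul_pow (m := 2) (k := 2) ha.1 hb.1, H.mul_mem ha.2 hb.2⟩

/-- Transitivity of coverings relative to an approximate subgroup. -/
lemma cov_trans (h : IsApx K A) {C D : ℕ} {H L : Subgroup G} {M : Set G}
    (h1 : Cov C (A ^ 2 ∩ H) L) (h2 : Cov D (A ^ 2 ∩ L) M) :
    Cov (C * (K ^ 3 * D)) (A ^ 2 ∩ H) M := by
  refine h1.trans ((h.cov_pow_inter 3 h2).mono le_rfl ?_ subset_rfl)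
  rintro _ ⟨⟨a, ha, b, hb, rfl⟩, hx⟩
  refine ⟨h.mul_pow (m := 2) (k := 2) ?_ hb.1, hx⟩
  simpa using h.inv_pow (Set.mem_inv.1 ha).1

lemma cov_trans' (h : IsApx K A) {C D : ℕ} {L : Subgroup G} {M : Set G}
    (h1 : Cov C A L) (h2 : Cov D (A ^ 2 ∩ L) M) : Cov (C * D) A M := by
  refine h1.trans (h2.mono le_rfl ?_ subset_rfl)
  rintro _ ⟨⟨a, ha, b, hb, rfl⟩, hx⟩
  refine ⟨?_, hx⟩
  rw [pow_two]
  exact Set.mul_mem_mul (by simpa using h.inv _ ha) hb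

variable {G₁ : Type*} [Group G₁]

/-- The image of a set under a relation. -/
def relImage (R : Subgroup (G × G₁)) (D : Set G) : Set G₁ := {s | ∃ g ∈ D, (g, s) ∈ R}

lemma relImage_isApx (h : IsApx K A) {R : Subgroup (G × G₁)}
    (hD : ∀ g ∈ A, ∃ s, (g, s) ∈ R) (hR : {s : G₁ | ((1 : G), s) ∈ R}.Finite) : IsApx K (relImage R A) where
  fin := by
    have : relImage R A ⊆ ⋃ g ∈ A, {s | (g, s) ∈ R} := by
      rintro s ⟨g, hg, hs⟩
      simp only [Set.mem_iUnion]
      exact ⟨g, hg, hs⟩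
    refine (h.fin.biUnion fun g _ => ?_).subset this
    by_cases hne : ∃ s, (g, s) ∈ R
    · obtain ⟨s, hs⟩ := hne
      refine (hR.image (fun t => s * t)).subset ?_
      intro t ht
      refine ⟨s⁻¹ * t, ?_, by simp⟩
      have := R.mul_mem (R.inv_mem hs) ht
      simpa using this
    · convert Set.finite_empty
      ext s
      simpa using fun hs => hne ⟨s, hs⟩
  one := ⟨1, h.one, R.one_mem⟩
  inv := by
    rintro s ⟨g, hg, hs⟩
    exact ⟨g⁻¹, h.inv _ hg, R.inv_mem hs⟩
  cov := by
    classical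
    obtain ⟨X, hX, hc⟩ := h.cov
    let f : G → G₁ := fun x => if hx : ∃ s, (x, s) ∈ R then hx.choose else 1
    refine ⟨X.image f, Finset.card_image_le.trans hX, ?_⟩
    rintro _ ⟨s, ⟨g, hg, hs⟩, t, ⟨k, hk, ht⟩, rfl⟩
    obtain ⟨x, hx, hxg⟩ := hc _ (Set.mul_mem_mul hg hk)
    have hex : ∃ s, (x, s) ∈ R := by
      obtain ⟨u, hu⟩ := hD _ hxg
      exact ⟨s * t * u⁻¹, by simpa [mul_assoc] using R.mul_mem (R.mul_mem hs ht) (R.inv_mem hu)⟩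
    refine ⟨f x, Finset.mem_image_of_mem _ hx, x⁻¹ * (g * k), hxg, ?_⟩
    have : f x = hex.choose := by simp only [f]; rw [dif_pos hex]
    rw [this]
    exact R.mul_mem (R.inv_mem hex.choose_spec) (R.mul_mem hs ht)

lemma relImage_cov {C : ℕ} {D : Set G} {R : Subgroup (G × G₁)} (hD : ∀ g ∈ D, ∃ s, (g, s) ∈ R)
    {H : Subgroup G₁} (h : Cov C (relImage R D) H) :
    Cov C D {g | ∃ s ∈ H, (g, s) ∈ R} := by
  classical
  obtain ⟨Y, hY, hYD, h⟩ := h.exists_subset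
  let f : G₁ → G := fun y => if hy : ∃ g, (g, y) ∈ R then hy.choose else 1
  refine ⟨Y.image f, Finset.card_image_le.trans hY, fun g hg => ?_⟩
  obtain ⟨s, hs⟩ := hD g hg
  obtain ⟨y, hy, hys⟩ := h s ⟨g, hg, hs⟩
  obtain ⟨k, hk, hky⟩ := hYD hy
  have hex : ∃ g, (g, y) ∈ R := ⟨k, hky⟩
  refine ⟨f y, Finset.mem_image_of_mem _ hy, y⁻¹ * s, hys, ?_⟩
  have : f y = hex.choose := by simp only [f]; rw [dif_pos hex]
  rw [this]
  exact R.mul_mem (R.inv_mem hex.choose_spec) hs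

end IsApx

end Covering

section Algebras

variable {V : Type} [AddCommGroup V] [Module ℂ V]

/-- The group of units contained, together with their inverse, in a subalgebra. -/
def U (E : Subalgebra ℂ (Module.End ℂ V)) : Subgroup (Module.End ℂ V)ˣ where
  carrier := {g | (g : Module.End ℂ V) ∈ E ∧ ((g⁻¹ : (Module.End ℂ V)ˣ) : Module.End ℂ V) ∈ E}
  mul_mem' := by
    rintro a b ⟨h1, h2⟩ ⟨h3, h4⟩
    exact ⟨by simpa using E.mul_mem h1 h3, by simpa using E.mul_mem h4 h2⟩
  one_mem' := by simp
  inv_mem' := by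
    rintro a ⟨h1, h2⟩
    exact ⟨h2, by simpa using h1⟩

lemma mem_U {E : Subalgebra ℂ (Module.End ℂ V)} {g : (Module.End ℂ V)ˣ} :
    g ∈ U E ↔ (g : Module.End ℂ V) ∈ E ∧ ((g⁻¹ : (Module.End ℂ V)ˣ) : Module.End ℂ V) ∈ E :=
  Iff.rfl

lemma U_mono {E F : Subalgebra ℂ (Module.End ℂ V)} (h : E ≤ F) : U E ≤ U F :=
  fun _ hg => ⟨h hg.1, h hg.2⟩

lemma U_inf (E F : Subalgebra ℂ (Module.End ℂ V)) : U (E ⊓ F) = U E ⊓ U F := by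
  ext g
  simp only [mem_U, Subgroup.mem_inf, Algebra.mem_inf]
  tauto

lemma U_top : U (⊤ : Subalgebra ℂ (Module.End ℂ V)) = ⊤ := by
  ext g; simp [mem_U]

/-- Conjugation by `g⁻¹`. -/
def conjHom (g : (Module.End ℂ V)ˣ) : Module.End ℂ V →ₐ[ℂ] Module.End ℂ V where
  toFun x := (g⁻¹ : (Module.End ℂ V)ˣ) * x * g
  map_one' := by simp
  map_mul' x y := by simp [mul_assoc]
  map_zero' := by simp
  map_add' x y := by simp [mul_add, add_mul]
  commutes' c := by
    rw [mul_assoc, Algebra.commutes, ← mul_assoc]; simp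

lemma conjHom_apply (g : (Module.End ℂ V)ˣ) (x : Module.End ℂ V) :
    conjHom g x = ((g⁻¹ : (Module.End ℂ V)ˣ) : Module.End ℂ V) * x * (g : Module.End ℂ V) := rfl

/-- The conjugate `g E g⁻¹`. -/
def cj (g : (Module.End ℂ V)ˣ) (E : Subalgebra ℂ (Module.End ℂ V)) :
    Subalgebra ℂ (Module.End ℂ V) := E.comap (conjHom g)

lemma mem_cj {g : (Module.End ℂ V)ˣ} {E : Subalgebra ℂ (Module.End ℂ V)} {x : Module.End ℂ V} :
    x ∈ cj g E ↔ ((g⁻¹ : (Module.End ℂ V)ˣ) : Module.End ℂ V) * x * (g : Module.End ℂ V) ∈ E :=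
  Iff.rfl

lemma conj_mem_cj {g : (Module.End ℂ V)ˣ} {E : Subalgebra ℂ (Module.End ℂ V)}
    {x : Module.End ℂ V} : (g : Module.End ℂ V) * x * ((g⁻¹ : (Module.End ℂ V)ˣ)) ∈ cj g E ↔
      x ∈ E := by
  rw [mem_cj]; simp [mul_assoc]

lemma cj_one (E : Subalgebra ℂ (Module.End ℂ V)) : cj 1 E = E := by
  ext x; simp [mem_cj]

lemma cj_mul (g h : (Module.End ℂ V)ˣ) (E : Subalgebra ℂ (Module.End ℂ V)) :
    cj (g * h) E = cj g (cj h E) := by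
  ext x; simp [mem_cj, mul_assoc]

lemma cj_mono (g : (Module.End ℂ V)ˣ) {E F : Subalgebra ℂ (Module.End ℂ V)} (h : E ≤ F) :
    cj g E ≤ cj g F := fun _ hx => h hx

lemma cj_inv_cj (g : (Module.End ℂ V)ˣ) (E : Subalgebra ℂ (Module.End ℂ V)) :
    cj g⁻¹ (cj g E) = E := by rw [← cj_mul]; simp [cj_one]

lemma cj_cj_inv (g : (Module.End ℂ V)ˣ) (E : Subalgebra ℂ (Module.End ℂ V)) :
    cj g (cj g⁻¹ E) = E := by rw [← cj_mul]; simp [cj_one]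

lemma cj_le_iff (g : (Module.End ℂ V)ˣ) {E F : Subalgebra ℂ (Module.End ℂ V)} :
    cj g E ≤ F ↔ E ≤ cj g⁻¹ F :=
  ⟨fun h => by simpa [cj_inv_cj] using cj_mono g⁻¹ h,
    fun h => by simpa [cj_cj_inv] using cj_mono g h⟩

lemma cj_top (g : (Module.End ℂ V)ˣ) : cj g (⊤ : Subalgebra ℂ (Module.End ℂ V)) = ⊤ := rfl

lemma cj_bot (g : (Module.End ℂ V)ˣ) : cj g (⊥ : Subalgebra ℂ (Module.End ℂ V)) = ⊥ := by
  refine le_antisymm ?_ bot_le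
  rw [cj_le_iff]; exact bot_le

lemma cj_eq_iff (g : (Module.End ℂ V)ˣ) {E F : Subalgebra ℂ (Module.End ℂ V)} :
    cj g E = F ↔ E = cj g⁻¹ F :=
  ⟨fun h => by rw [← h, cj_inv_cj], fun h => by rw [h, cj_cj_inv]⟩

lemma mem_U_cj {g x : (Module.End ℂ V)ˣ} {E : Subalgebra ℂ (Module.End ℂ V)} :
    x ∈ U (cj g E) ↔ g⁻¹ * x * g ∈ U E := by
  simp [mem_U, mem_cj, mul_assoc]

/-- The normalizer of a subalgebra. -/
def nz (E : Subalgebra ℂ (Module.End ℂ V)) : Subgroup (Module.End ℂ V)ˣ where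
  carrier := {g | cj g E = E}
  mul_mem' := by
    intro a b (ha : cj a E = E) (hb : cj b E = E)
    change cj (a * b) E = E
    rw [cj_mul, hb, ha]
  one_mem' := cj_one E
  inv_mem' := by
    intro a (ha : cj a E = E)
    change cj a⁻¹ E = E
    exact ((cj_eq_iff a).1 ha).symm

lemma mem_nz {E : Subalgebra ℂ (Module.End ℂ V)} {g : (Module.End ℂ V)ˣ} :
    g ∈ nz E ↔ cj g E = E := Iff.rfl

lemma U_le_nz (E : Subalgebra ℂ (Module.End ℂ V)) : U E ≤ nz E := by
  intro g hg
  have key : ∀ g ∈ U E, E ≤ cj g E := fun g hg x hx =>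
    E.mul_mem (E.mul_mem hg.2 hx) hg.1
  refine le_antisymm ?_ (key g hg)
  rw [cj_le_iff]
  exact key _ ((U E).inv_mem hg)

/-- The algebra stabilizing a subspace. -/
def algStab (W : Submodule ℂ V) : Subalgebra ℂ (Module.End ℂ V) where
  carrier := {x | ∀ w ∈ W, x w ∈ W}
  mul_mem' := fun ha hb w hw => ha _ (hb w hw)
  one_mem' := fun w hw => hw
  add_mem' := fun ha hb w hw => W.add_mem (ha w hw) (hb w hw)
  zero_mem' := fun w _ => by simp
  algebraMap_mem' := fun c w hw => W.smul_mem c hw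

lemma mem_algStab {W : Submodule ℂ V} {x : Module.End ℂ V} :
    x ∈ algStab W ↔ ∀ w ∈ W, x w ∈ W := Iff.rfl

/-- The centralizer algebra. -/
def centr (z : Module.End ℂ V) : Subalgebra ℂ (Module.End ℂ V) := Subalgebra.centralizer ℂ {z}

lemma mem_centr {z x : Module.End ℂ V} : x ∈ centr z ↔ z * x = x * z := by
  simp [centr, Subalgebra.mem_centralizer_iff]

lemma self_mem_centr (z : Module.End ℂ V) : z ∈ centr z := by rw [mem_centr]

lemma mem_U_centr {z g : (Module.End ℂ V)ˣ} :
    g ∈ U (centr (z : Module.End ℂ V)) ↔ z * g = g * z := by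
  rw [mem_U, mem_centr, mem_centr]
  norm_cast
  refine ⟨fun h => h.1, fun h => ⟨h, ?_⟩⟩
  rw [mul_inv_eq_iff_eq_mul, mul_assoc, h, inv_mul_cancel_left]

lemma cj_centr (g z : (Module.End ℂ V)ˣ) :
    cj g (centr (z : Module.End ℂ V)) = centr ((g * z * g⁻¹ : (Module.End ℂ V)ˣ)) := by
  ext x
  rw [mem_cj, mem_centr, mem_centr]
  constructor
  · intro h
    have := congrArg (fun y => (g : Module.End ℂ V) * y * ((g⁻¹ : (Module.End ℂ V)ˣ))) h
    simpa [mul_assoc] using this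
  · intro h
    have := congrArg (fun y => ((g⁻¹ : (Module.End ℂ V)ˣ) : Module.End ℂ V) * y * g) h
    simpa [mul_assoc] using this

lemma centr_eq_top {z : Module.End ℂ V} (h : centr z = ⊤) : z ∈ (⊥ : Subalgebra ℂ (Module.End ℂ V)) := by
  have : z ∈ Subalgebra.center ℂ (Module.End ℂ V) := by
    rw [Subalgebra.mem_center_iff]
    intro x
    have : x ∈ centr z := by rw [h]; trivial
    exact (mem_centr.1 this).symm
  rwa [Algebra.IsCentral.center_eq_bot] at this

lemma mem_bot {x : Module.End ℂ V} : x ∈ (⊥ : Subalgebra ℂ (Module.End ℂ V)) ↔ ∃ c : ℂ, x = c • 1 := by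
  rw [Algebra.mem_bot]
  simp [Algebra.algebraMap_eq_smul_one, eq_comm]

variable [FiniteDimensional ℂ V]

lemma subalg_eq_of_finrank {E F : Subalgebra ℂ (Module.End ℂ V)} (h : E ≤ F)
    (hf : finrank ℂ F ≤ finrank ℂ E) : E = F := by
  have : Subalgebra.toSubmodule E = Subalgebra.toSubmodule F :=
    Submodule.eq_of_le_of_finrank_le h hf
  exact Subalgebra.toSubmodule_injective this

lemma finrank_subalg_mono {E F : Subalgebra ℂ (Module.End ℂ V)} (h : E ≤ F) :
    finrank ℂ E ≤ finrank ℂ F :=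
  Submodule.finrank_mono (s := Subalgebra.toSubmodule E) (t := Subalgebra.toSubmodule F) h

lemma finrank_cj_le (g : (Module.End ℂ V)ˣ) (E : Subalgebra ℂ (Module.End ℂ V)) :
    finrank ℂ (cj g E) ≤ finrank ℂ E := by
  let f : cj g E →ₗ[ℂ] E := ((conjHom g).toLinearMap.restrict (p := Subalgebra.toSubmodule (cj g E))
    (q := Subalgebra.toSubmodule E) (fun x hx => hx))
  refine LinearMap.finrank_le_finrank_of_injective (f := f) ?_
  rintro ⟨x, hx⟩ ⟨y, hy⟩ h
  have h' : conjHom g x = conjHom g y := congrArg Subtype.val h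
  have := congrArg (fun y => (g : Module.End ℂ V) * y * ((g⁻¹ : (Module.End ℂ V)ˣ))) h'
  simpa [conjHom_apply, mul_assoc] using this

lemma cj_eq_of_le {g : (Module.End ℂ V)ˣ} {E : Subalgebra ℂ (Module.End ℂ V)} (h : E ≤ cj g E) :
    cj g E = E := (subalg_eq_of_finrank h (finrank_cj_le g E)).symm

end Algebras

section Triangular

variable {V : Type} [AddCommGroup V] [Module ℂ V] {n : ℕ} (b : Module.Basis (Fin n) ℂ V)

/-- Matrix entries. -/
noncomputable def ent (x : Module.End ℂ V) (i j : Fin n) : ℂ := LinearMap.toMatrix b b x i j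

lemma ent_apply (x : Module.End ℂ V) (i j : Fin n) : ent b x i j = b.repr (x (b j)) i :=
  LinearMap.toMatrix_apply _ _ _ _ _

lemma ent_mul (x y : Module.End ℂ V) (i j : Fin n) :
    ent b (x * y) i j = ∑ k, ent b x i k * ent b y k j := by
  simp only [ent, LinearMap.toMatrix_mul, Matrix.mul_apply]

lemma ent_one (i j : Fin n) : ent b (1 : Module.End ℂ V) i j = if i = j then 1 else 0 := by
  simp only [ent, LinearMap.toMatrix_one, Matrix.one_apply]

lemma ent_add (x y : Module.End ℂ V) (i j : Fin n) :
    ent b (x + y) i j = ent b x i j + ent b y i j := by simp [ent]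

lemma ent_sub (x y : Module.End ℂ V) (i j : Fin n) :
    ent b (x - y) i j = ent b x i j - ent b y i j := by simp [ent]

lemma ent_smul (c : ℂ) (x : Module.End ℂ V) (i j : Fin n) :
    ent b (c • x) i j = c * ent b x i j := by simp [ent]

lemma ent_ext {x y : Module.End ℂ V} (h : ∀ i j, ent b x i j = ent b y i j) : x = y :=
  (LinearMap.toMatrix b b).injective (Matrix.ext h)

/-- The filtration of endomorphisms by superdiagonals. -/
def Fil (e : ℕ) : Submodule ℂ (Module.End ℂ V) where
  carrier := {x | ∀ i j : Fin n, (j : ℕ) < i + e → ent b x i j = 0}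
  add_mem' := fun ha hb i j h => by rw [ent_add, ha i j h, hb i j h, add_zero]
  zero_mem' := fun i j _ => by simp [ent]
  smul_mem' := fun c x hx i j h => by rw [ent_smul, hx i j h, mul_zero]

variable {b}

lemma mem_Fil {e : ℕ} {x : Module.End ℂ V} :
    x ∈ Fil b e ↔ ∀ i j : Fin n, (j : ℕ) < i + e → ent b x i j = 0 := Iff.rfl

lemma Fil_mul {e f : ℕ} {x y : Module.End ℂ V} (hx : x ∈ Fil b e) (hy : y ∈ Fil b f) :
    x * y ∈ Fil b (e + f) := by
  intro i j hij
  rw [ent_mul]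
  refine Finset.sum_eq_zero fun k _ => ?_
  by_cases hk : (k : ℕ) < i + e
  · rw [hx i k hk, zero_mul]
  · rw [hy k j (by omega), mul_zero]

lemma ent_mul_left {e : ℕ} {x y : Module.End ℂ V} (hx : x ∈ Fil b 0) (hy : y ∈ Fil b e)
    {i j : Fin n} (hij : (j : ℕ) = i + e) : ent b (x * y) i j = ent b x i i * ent b y i j := by
  rw [ent_mul]
  refine Finset.sum_eq_single i (fun k _ hk => ?_) (by simp)
  by_cases hk' : (k : ℕ) < i
  · rw [hx i k (by omega), zero_mul]
  · have : (k : ℕ) ≠ i := fun h => hk (Fin.ext h)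
    rw [hy k j (by omega), mul_zero]

lemma ent_mul_right {e : ℕ} {x y : Module.End ℂ V} (hx : x ∈ Fil b e) (hy : y ∈ Fil b 0)
    {i j : Fin n} (hij : (j : ℕ) = i + e) : ent b (x * y) i j = ent b x i j * ent b y j j := by
  rw [ent_mul]
  refine Finset.sum_eq_single j (fun k _ hk => ?_) (by simp)
  by_cases hk' : (k : ℕ) < j
  · rw [hx i k (by omega), zero_mul]
  · have : (k : ℕ) ≠ j := fun h => hk (Fin.ext h)
    rw [hy k j (by omega), mul_zero]

lemma Fil_eq_zero {x : Module.End ℂ V} (hx : x ∈ Fil b n) : x = 0 := by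
  refine ent_ext b fun i j => ?_
  rw [hx i j (by omega)]; simp [ent]

lemma one_mem_Fil : (1 : Module.End ℂ V) ∈ Fil b 0 := by
  intro i j hij
  rw [ent_one, if_neg]
  rintro rfl; omega

variable (b) in
/-- The upper triangular endomorphisms. -/
def tri : Subalgebra ℂ (Module.End ℂ V) where
  carrier := Fil b 0
  mul_mem' := fun ha hb => Fil_mul ha hb
  one_mem' := one_mem_Fil
  add_mem' := fun ha hb => (Fil b 0).add_mem ha hb
  zero_mem' := (Fil b 0).zero_mem
  algebraMap_mem' := fun c => by
    rw [Algebra.algebraMap_eq_smul_one]; exact (Fil b 0).smul_mem c one_mem_Fil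

lemma mem_tri {x : Module.End ℂ V} : x ∈ tri b ↔ x ∈ Fil b 0 := Iff.rfl

variable (b) in
/-- The descending filtration of the upper triangular group. -/
def NN (e : ℕ) : Subgroup (Module.End ℂ V)ˣ where
  carrier := {g | g ∈ U (tri b) ∧ (g : Module.End ℂ V) - 1 ∈ Fil b e}
  mul_mem' := by
    rintro g h ⟨hg, hg'⟩ ⟨hh, hh'⟩
    refine ⟨(U (tri b)).mul_mem hg hh, ?_⟩
    have : ((g * h : (Module.End ℂ V)ˣ) : Module.End ℂ V) - 1
        = ((g : Module.End ℂ V) - 1) + g * ((h : Module.End ℂ V) - 1) := by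
      push_cast; noncomm_ring
    rw [this]
    refine (Fil b e).add_mem hg' ?_
    simpa using Fil_mul (mem_tri.1 hg.1) hh'
  one_mem' := ⟨(U (tri b)).one_mem, by simp⟩
  inv_mem' := by
    rintro g ⟨hg, hg'⟩
    refine ⟨(U (tri b)).inv_mem hg, ?_⟩
    have : ((g⁻¹ : (Module.End ℂ V)ˣ) : Module.End ℂ V) - 1
        = - (((g⁻¹ : (Module.End ℂ V)ˣ) : Module.End ℂ V) * ((g : Module.End ℂ V) - 1)) := by
      rw [mul_sub]; simp
    rw [this]
    refine (Fil b e).neg_mem ?_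
    simpa using Fil_mul (mem_tri.1 hg.2) hg'

lemma mem_NN {e : ℕ} {g : (Module.End ℂ V)ˣ} :
    g ∈ NN b e ↔ g ∈ U (tri b) ∧ (g : Module.End ℂ V) - 1 ∈ Fil b e := Iff.rfl

lemma NN_zero : NN b 0 = U (tri b) := by
  ext g
  rw [mem_NN]
  refine ⟨fun h => h.1, fun h => ⟨h, (Fil b 0).sub_mem h.1 one_mem_Fil⟩⟩

lemma NN_top {g : (Module.End ℂ V)ˣ} (hg : g ∈ NN b n) : g = 1 := by
  have := Fil_eq_zero hg.2
  exact Units.ext (sub_eq_zero.1 this)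

lemma NN_le_tri (e : ℕ) : NN b e ≤ U (tri b) := fun _ hg => hg.1

lemma NN_conj {e : ℕ} {x y : (Module.End ℂ V)ˣ} (hx : x ∈ U (tri b)) (hy : y ∈ NN b e) :
    x * y * x⁻¹ ∈ NN b e := by
  refine ⟨(U (tri b)).mul_mem ((U (tri b)).mul_mem hx hy.1) ((U (tri b)).inv_mem hx), ?_⟩
  have : ((x * y * x⁻¹ : (Module.End ℂ V)ˣ) : Module.End ℂ V) - 1
      = x * ((y : Module.End ℂ V) - 1) * ((x⁻¹ : (Module.End ℂ V)ˣ) : Module.End ℂ V) := by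
    rw [mul_sub, sub_mul]; simp
  rw [this]
  simpa using Fil_mul (Fil_mul (mem_tri.1 hx.1) hy.2) (mem_tri.1 hx.2)

/-- Commutators move down the filtration once the leading entries cancel. -/
lemma NN_comm {e : ℕ} {x y : (Module.End ℂ V)ˣ} (hx : x ∈ U (tri b)) (hy : y ∈ NN b e)
    (h : ∀ i j : Fin n, (j : ℕ) = i + e →
      ent b ((y : Module.End ℂ V) - 1) i j = 0 ∨ ent b (x : Module.End ℂ V) i i = ent b (x : Module.End ℂ V) j j) :
    y * x * y⁻¹ * x⁻¹ ∈ NN b (e + 1) := by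
  refine ⟨?_, ?_⟩
  · exact (U (tri b)).mul_mem ((U (tri b)).mul_mem ((U (tri b)).mul_mem hy.1 hx)
      ((U (tri b)).inv_mem hy.1)) ((U (tri b)).inv_mem hx)
  · set f : Module.End ℂ V := (y : Module.End ℂ V) - 1 with hf
    have key : f * x - x * f ∈ Fil b (e + 1) := by
      intro i j hij
      have h1 : f * x ∈ Fil b e := by simpa using Fil_mul hy.2 (mem_tri.1 hx.1)
      have h2 : (x : Module.End ℂ V) * f ∈ Fil b e := by
        simpa using Fil_mul (mem_tri.1 hx.1) hy.2
      by_cases hlt : (j : ℕ) < i + e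
      · rw [ent_sub, h1 i j hlt, h2 i j hlt, sub_zero]
      · have heq : (j : ℕ) = i + e := by omega
        rw [ent_sub, ent_mul_right hy.2 (mem_tri.1 hx.1) heq,
          ent_mul_left (mem_tri.1 hx.1) hy.2 heq]
        rcases h i j heq with h | h
        · rw [h]; ring
        · rw [h]; ring
    have : ((y * x * y⁻¹ * x⁻¹ : (Module.End ℂ V)ˣ) : Module.End ℂ V) - 1
        = (f * x - x * f) * (((y⁻¹ : (Module.End ℂ V)ˣ) : Module.End ℂ V)
          * ((x⁻¹ : (Module.End ℂ V)ˣ) : Module.End ℂ V)) := by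
      have e1 : f * x - x * f = y * x - x * y := by rw [hf]; noncomm_ring
      rw [e1, sub_mul]
      have e2 : (x : Module.End ℂ V) * y * (((y⁻¹ : (Module.End ℂ V)ˣ) : Module.End ℂ V)
          * ((x⁻¹ : (Module.End ℂ V)ˣ) : Module.End ℂ V)) = 1 := by
        norm_cast; simp [mul_assoc]
      rw [e2]; push_cast; simp only [mul_assoc]
    rw [this]
    simpa using Fil_mul key (Fil_mul (mem_tri.1 hy.1.2) (mem_tri.1 hx.2))

/-- On `NN b e` with `e ≥ 1` the leading entries are additive. -/
lemma ent_NN_mul {e : ℕ} (he : 1 ≤ e) {x y : (Module.End ℂ V)ˣ} (hx : x ∈ NN b e)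
    (hy : y ∈ NN b e) {i j : Fin n} (hij : (j : ℕ) = i + e) :
    ent b ((x * y : (Module.End ℂ V)ˣ) : Module.End ℂ V) i j
      = ent b (x : Module.End ℂ V) i j + ent b (y : Module.End ℂ V) i j := by
  have hne : i ≠ j := by rintro rfl; omega
  have h0 := Fil_mul hx.2 hy.2 i j (by omega)
  have : ((x * y : (Module.End ℂ V)ˣ) : Module.End ℂ V) = ((x : Module.End ℂ V) - 1)
    * ((y : Module.End ℂ V) - 1) + x + y - 1 := by push_cast; noncomm_ring
  rw [this, ent_sub, ent_add, ent_add, h0, ent_one, if_neg hne]; ring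

lemma ent_mul_diag {x y : Module.End ℂ V} (hx : x ∈ tri b) (hy : y ∈ tri b) (i : Fin n) :
    ent b (x * y) i i = ent b x i i * ent b y i i :=
  ent_mul_left (e := 0) hx hy rfl

lemma ent_diag_ne_zero {x : (Module.End ℂ V)ˣ} (hx : x ∈ U (tri b)) (i : Fin n) :
    ent b (x : Module.End ℂ V) i i ≠ 0 := by
  intro h
  have := ent_mul_diag hx.1 hx.2 i
  rw [h, zero_mul] at this
  norm_cast at this
  simp [ent_one] at this

lemma ent_diag_inv {x : (Module.End ℂ V)ˣ} (hx : x ∈ U (tri b)) (i : Fin n) :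
    ent b ((x⁻¹ : (Module.End ℂ V)ˣ) : Module.End ℂ V) i i = (ent b (x : Module.End ℂ V) i i)⁻¹ := by
  have := ent_mul_diag hx.1 hx.2 i
  norm_cast at this
  simp only [mul_inv_cancel, Units.val_one, ent_one, if_true] at this
  exact eq_inv_of_mul_eq_one_right this.symm

/-- Scaling of the leading entries under conjugation. -/
lemma ent_conj {e : ℕ} (he : 1 ≤ e) {x y : (Module.End ℂ V)ˣ} (hx : x ∈ U (tri b))
    (hy : y ∈ NN b e) {i j : Fin n} (hij : (j : ℕ) = i + e) :
    ent b ((x * y * x⁻¹ : (Module.End ℂ V)ˣ) : Module.End ℂ V) i j =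
      ent b (x : Module.End ℂ V) i i * (ent b (x : Module.End ℂ V) j j)⁻¹
        * ent b (y : Module.End ℂ V) i j := by
  have hne : i ≠ j := by rintro rfl; omega
  have e1 : ∀ y : Module.End ℂ V, ent b y i j = ent b (y - 1) i j := by
    intro y; rw [ent_sub, ent_one, if_neg hne, sub_zero]
  have : ((x * y * x⁻¹ : (Module.End ℂ V)ˣ) : Module.End ℂ V) - 1
      = x * ((y : Module.End ℂ V) - 1) * ((x⁻¹ : (Module.End ℂ V)ˣ) : Module.End ℂ V) := by
    rw [mul_sub, sub_mul]; simp
  rw [e1, this, e1 (y : Module.End ℂ V)]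
  have hxf : (x : Module.End ℂ V) * ((y : Module.End ℂ V) - 1) ∈ Fil b e := by
    simpa using Fil_mul (mem_tri.1 hx.1) hy.2
  rw [ent_mul_right hxf (mem_tri.1 hx.2) hij, ent_mul_left (mem_tri.1 hx.1) hy.2 hij,
    ent_diag_inv hx]
  ring

variable (b) in
/-- Upper triangular endomorphisms with equal diagonal entries at `i` and `j`. -/
def triEq (i j : Fin n) : Subalgebra ℂ (Module.End ℂ V) where
  carrier := {x | x ∈ tri b ∧ ent b x i i = ent b x j j}
  mul_mem' := by
    rintro x y ⟨hx, hx'⟩ ⟨hy, hy'⟩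
    exact ⟨(tri b).mul_mem hx hy, by rw [ent_mul_diag hx hy, ent_mul_diag hx hy, hx', hy']⟩
  add_mem' := by
    rintro x y ⟨hx, hx'⟩ ⟨hy, hy'⟩
    exact ⟨(tri b).add_mem hx hy, by rw [ent_add, ent_add, hx', hy']⟩
  algebraMap_mem' := fun c => ⟨(tri b).algebraMap_mem c, by
    rw [Algebra.algebraMap_eq_smul_one, ent_smul, ent_smul, ent_one, ent_one]; simp⟩

lemma mem_triEq {i j : Fin n} {x : Module.End ℂ V} :
    x ∈ triEq b i j ↔ x ∈ tri b ∧ ent b x i i = ent b x j j := Iff.rfl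

/-- A unipotent upper triangular scalar is trivial. -/
lemma NN_bot {e : ℕ} (he : 1 ≤ e) {g : (Module.End ℂ V)ˣ} (hg : g ∈ NN b e)
    (hg' : g ∈ U (⊥ : Subalgebra ℂ (Module.End ℂ V))) : g = 1 := by
  obtain ⟨c, hc⟩ := mem_bot.1 hg'.1
  have h2 := hg.2
  refine Units.ext (ent_ext b fun i j => ?_)
  have h3 := h2 i i (by omega)
  rw [hc, ent_sub, ent_smul, ent_one, if_pos rfl, mul_one, sub_eq_zero] at h3
  rw [hc, h3, one_smul]; rfl

lemma tri_ne_top (hn : 2 ≤ n) : tri b ≠ ⊤ := by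
  intro h
  have : ∀ x : Module.End ℂ V, x ∈ Fil b 0 := fun x => by
    rw [← mem_tri, h]; trivial
  have h2 := this (Matrix.toLin b b (Matrix.single (⟨1, by omega⟩ : Fin n) (⟨0, by omega⟩ : Fin n) 1))
    ⟨1, by omega⟩ ⟨0, by omega⟩ (by simp)
  simp [ent] at h2

lemma tri_basis_zero {x : Module.End ℂ V} (hx : x ∈ tri b) (hn : 0 < n) :
    x (b ⟨0, hn⟩) = ent b x ⟨0, hn⟩ ⟨0, hn⟩ • b ⟨0, hn⟩ := by
  refine b.ext_elem fun i => ?_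
  rw [← ent_apply]
  by_cases hi : i = ⟨0, hn⟩
  · subst hi; simp
  · rw [hx i ⟨0, hn⟩ (by
      have : (i : ℕ) ≠ 0 := fun h => hi (Fin.ext h)
      simp only [add_zero]; omega)]
    simp [Ne.symm hi]

end Triangular

section Reduction

/-- `A` is covered by few cosets of a triangular group. -/
def TriCov {V : Type} [AddCommGroup V] [Module ℂ V] (C : ℕ) (A : Set (Module.End ℂ V)ˣ) : Prop :=
  ∃ b : Module.Basis (Fin (finrank ℂ V)) ℂ V, Cov C A (U (tri b))

/-- Triangularization of approximate groups in dimension less than `n`. -/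
def TBelow (n : ℕ) : Prop := ∀ K : ℕ, ∃ C : ℕ, ∀ (V : Type) [AddCommGroup V] [Module ℂ V]
  [FiniteDimensional ℂ V], finrank ℂ V < n → ∀ A : Set (Module.End ℂ V)ˣ, IsApx K A → TriCov C A

variable {V : Type} [AddCommGroup V] [Module ℂ V]

lemma TriCov.mono {C D : ℕ} {A : Set (Module.End ℂ V)ˣ} (h : TriCov C A) (hCD : C ≤ D) :
    TriCov D A := by
  obtain ⟨b, hb⟩ := h
  exact ⟨b, hb.mono hCD subset_rfl subset_rfl⟩

lemma TriCov.of_bot [FiniteDimensional ℂ V] {C : ℕ} {A : Set (Module.End ℂ V)ˣ}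
    (h : Cov C A (U (⊥ : Subalgebra ℂ (Module.End ℂ V)))) : TriCov C A :=
  ⟨Module.finBasis ℂ V, h.mono le_rfl subset_rfl (U_mono bot_le)⟩

/-- Restriction to a subspace, as a relation. -/
def relSub (W : Submodule ℂ V) : Subgroup ((Module.End ℂ V)ˣ × (Module.End ℂ W)ˣ) where
  carrier := {p | ∀ w : W, (p.1 : Module.End ℂ V) w = (p.2 : Module.End ℂ W) w}
  mul_mem' := by
    intro p q hp hq w
    simp only [Prod.fst_mul, Prod.snd_mul, Units.val_mul, Module.End.mul_apply]
    rw [hq w, hp]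
  one_mem' := fun w => rfl
  inv_mem' := by
    intro p hp w
    simp only [Prod.fst_inv, Prod.snd_inv]
    have h := hp (((p.2⁻¹ : (Module.End ℂ W)ˣ) : Module.End ℂ W) w)
    rw [← Module.End.mul_apply (p.2 : Module.End ℂ W), Units.mul_inv, Module.End.one_apply] at h
    rw [← h, ← Module.End.mul_apply, Units.inv_mul, Module.End.one_apply]

/-- Passage to a quotient space, as a relation. -/
def relQuot (W : Submodule ℂ V) : Subgroup ((Module.End ℂ V)ˣ × (Module.End ℂ (V ⧸ W))ˣ) where
  carrier := {p | ∀ v : V, W.mkQ ((p.1 : Module.End ℂ V) v) = (p.2 : Module.End ℂ (V ⧸ W)) (W.mkQ v)}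
  mul_mem' := by
    intro p q hp hq v
    simp only [Prod.fst_mul, Prod.snd_mul, Units.val_mul, Module.End.mul_apply]
    rw [hp, hq]
  one_mem' := fun w => rfl
  inv_mem' := by
    intro p hp v
    simp only [Prod.fst_inv, Prod.snd_inv]
    have h := hp (((p.1⁻¹ : (Module.End ℂ V)ˣ) : Module.End ℂ V) v)
    rw [← Module.End.mul_apply (p.1 : Module.End ℂ V), Units.mul_inv, Module.End.one_apply] at h
    rw [h, ← Module.End.mul_apply, Units.inv_mul, Module.End.one_apply]

lemma units_apply_inv (g : (Module.End ℂ V)ˣ) (v : V) :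
    (g : Module.End ℂ V) (((g⁻¹ : (Module.End ℂ V)ˣ) : Module.End ℂ V) v) = v := by
  rw [← Module.End.mul_apply, Units.mul_inv, Module.End.one_apply]

lemma units_inv_apply (g : (Module.End ℂ V)ˣ) (v : V) :
    ((g⁻¹ : (Module.End ℂ V)ˣ) : Module.End ℂ V) ((g : Module.End ℂ V) v) = v := by
  rw [← Module.End.mul_apply, Units.inv_mul, Module.End.one_apply]

lemma relSub_lift {W : Submodule ℂ V} {g : (Module.End ℂ V)ˣ} (hg : g ∈ U (algStab W)) :
    ∃ s, (g, s) ∈ relSub W := by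
  have h1 := mem_algStab.1 (mem_U.1 hg).1
  have h2 := mem_algStab.1 (mem_U.1 hg).2
  refine ⟨⟨(g : Module.End ℂ V).restrict h1,
    ((g⁻¹ : (Module.End ℂ V)ˣ) : Module.End ℂ V).restrict h2, ?_, ?_⟩, fun w => rfl⟩
  · exact LinearMap.ext fun w => Subtype.ext (units_apply_inv g w)
  · exact LinearMap.ext fun w => Subtype.ext (units_inv_apply g w)

lemma relQuot_lift {W : Submodule ℂ V} {g : (Module.End ℂ V)ˣ} (hg : g ∈ U (algStab W)) :
    ∃ s, (g, s) ∈ relQuot W := by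
  have h1 := mem_algStab.1 (mem_U.1 hg).1
  have h2 := mem_algStab.1 (mem_U.1 hg).2
  refine ⟨⟨W.mapQ W (g : Module.End ℂ V) h1,
    W.mapQ W ((g⁻¹ : (Module.End ℂ V)ˣ) : Module.End ℂ V) h2, ?_, ?_⟩, fun w => rfl⟩
  · refine LinearMap.ext fun w => ?_
    obtain ⟨v, rfl⟩ := W.mkQ_surjective w
    exact congrArg W.mkQ (units_apply_inv g v)
  · refine LinearMap.ext fun w => ?_
    obtain ⟨v, rfl⟩ := W.mkQ_surjective w
    exact congrArg W.mkQ (units_inv_apply g v)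

lemma relSub_fin (W : Submodule ℂ V) : {s | ((1 : (Module.End ℂ V)ˣ), s) ∈ relSub W}.Finite := by
  refine (Set.finite_singleton 1).subset ?_
  intro s hs
  refine Units.ext (LinearMap.ext fun w => Subtype.ext (hs w).symm)

lemma relQuot_fin (W : Submodule ℂ V) : {s | ((1 : (Module.End ℂ V)ˣ), s) ∈ relQuot W}.Finite := by
  refine (Set.finite_singleton 1).subset ?_
  intro s hs
  refine Units.ext (LinearMap.ext fun w => ?_)
  obtain ⟨v, rfl⟩ := W.mkQ_surjective w
  exact (hs v).symm

lemma rel_tri {W : Submodule ℂ V} {m k n : ℕ} (b₁ : Module.Basis (Fin m) ℂ W)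
    (b₂ : Module.Basis (Fin k) ℂ (V ⧸ W)) (hn : m + k = n) :
    ∃ b : Module.Basis (Fin n) ℂ V, ∀ g : (Module.End ℂ V)ˣ,
      (∃ s ∈ U (tri b₁), (g, s) ∈ relSub W) → (∃ s ∈ U (tri b₂), (g, s) ∈ relQuot W) →
      g ∈ U (tri b) := by
  subst hn
  let b := (b₁.sumQuot b₂).reindex finSumFinEquiv
  have key : ∀ g : (Module.End ℂ V)ˣ,
      (∃ s ∈ U (tri b₁), (g, s) ∈ relSub W) → (∃ s ∈ U (tri b₂), (g, s) ∈ relQuot W) →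
      (g : Module.End ℂ V) ∈ tri b := by
    rintro g ⟨s, hs, hgs⟩ ⟨t, ht, hgt⟩ i j hij
    rw [ent_apply]
    simp only [b, Module.Basis.repr_reindex, Module.Basis.reindex_apply, Finsupp.mapDomain_equiv_apply]
    obtain ⟨j, rfl⟩ := finSumFinEquiv.surjective j
    obtain ⟨i, rfl⟩ := finSumFinEquiv.surjective i
    simp only [Equiv.symm_apply_apply]
    have hgs' : ∀ w : W, (g : Module.End ℂ V) w = (s : Module.End ℂ W) w := hgs
    have hgt' : ∀ v : V, W.mkQ ((g : Module.End ℂ V) v) = (t : Module.End ℂ (V ⧸ W)) (W.mkQ v) :=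
      hgt
    rcases j with j | j <;> rcases i with i | i <;> simp at hij
    · rw [Module.Basis.sumQuot_inl, hgs', Module.Basis.sumQuot_repr_inl, ← ent_apply]
      exact hs.1 i j (by simpa using hij)
    · rw [Module.Basis.sumQuot_inl, hgs', Module.Basis.sumQuot_repr_inr_of_mem _ _ _ (Subtype.prop _)]
    · omega
    · rw [Module.Basis.sumQuot_repr_inr, hgt', Submodule.mkQ_apply,
        Module.Basis.sumQuot_inr, ← ent_apply]
      exact ht.1 i j (by simpa using hij)
  refine ⟨b, fun g h1 h2 => ⟨key g h1 h2, key g⁻¹ ?_ ?_⟩⟩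
  · obtain ⟨s, hs, hgs⟩ := h1
    exact ⟨s⁻¹, (U _).inv_mem hs, (relSub W).inv_mem hgs⟩
  · obtain ⟨s, hs, hgs⟩ := h2
    exact ⟨s⁻¹, (U _).inv_mem hs, (relQuot W).inv_mem hgs⟩

/-- Approximate groups stabilizing a proper subspace. -/
lemma triCov_of_stab {n : ℕ} (hT : TBelow n) (K : ℕ) : ∃ C : ℕ, ∀ (V : Type) [AddCommGroup V]
    [Module ℂ V] [FiniteDimensional ℂ V], finrank ℂ V = n → ∀ A : Set (Module.End ℂ V)ˣ,
    IsApx K A → ∀ W : Submodule ℂ V, W ≠ ⊥ → W ≠ ⊤ → A ⊆ U (algStab W) → TriCov C A := by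
  obtain ⟨C, hC⟩ := hT K
  refine ⟨C * C, ?_⟩
  intro V _ _ _ hV A hA W hW hW' hAW
  have hsum : finrank ℂ W + finrank ℂ (V ⧸ W) = finrank ℂ V := by
    rw [add_comm]; exact W.finrank_quotient_add_finrank
  have h1 : 0 < finrank ℂ W := by
    rw [Module.finrank_pos_iff]; exact Submodule.nontrivial_iff_ne_bot.2 hW
  have h2 : finrank ℂ W < finrank ℂ V := Submodule.finrank_lt hW'
  have d1 : ∀ g ∈ A, ∃ s, (g, s) ∈ relSub W := fun g hg => relSub_lift (hAW hg)
  have d2 : ∀ g ∈ A, ∃ s, (g, s) ∈ relQuot W := fun g hg => relQuot_lift (hAW hg)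
  obtain ⟨b₁, hb₁⟩ := hC W (by omega) _ (hA.relImage_isApx d1 (relSub_fin W))
  obtain ⟨b₂, hb₂⟩ := hC (V ⧸ W) (by omega) _ (hA.relImage_isApx d2 (relQuot_fin W))
  obtain ⟨b, hb⟩ := rel_tri b₁ b₂ hsum
  have c1 := IsApx.relImage_cov d1 hb₁
  have c2 := IsApx.relImage_cov d2 hb₂
  let H1 : Subgroup (Module.End ℂ V)ˣ :=
    { carrier := {g | ∃ s ∈ U (tri b₁), (g, s) ∈ relSub W}
      mul_mem' := by
        rintro x y ⟨s, hs, h⟩ ⟨t, ht, h'⟩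
        exact ⟨s * t, mul_mem hs ht, mul_mem h h'⟩
      one_mem' := ⟨1, one_mem _, one_mem (relSub W)⟩
      inv_mem' := by
        rintro x ⟨s, hs, h⟩
        exact ⟨s⁻¹, inv_mem hs, inv_mem h⟩ }
  let H2 : Subgroup (Module.End ℂ V)ˣ :=
    { carrier := {g | ∃ s ∈ U (tri b₂), (g, s) ∈ relQuot W}
      mul_mem' := by
        rintro x y ⟨s, hs, h⟩ ⟨t, ht, h'⟩
        exact ⟨s * t, mul_mem hs ht, mul_mem h h'⟩
      one_mem' := ⟨1, one_mem _, one_mem (relQuot W)⟩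
      inv_mem' := by
        rintro x ⟨s, hs, h⟩
        exact ⟨s⁻¹, inv_mem hs, inv_mem h⟩ }
  have c1' : Cov C A H1 := c1
  have c2' : Cov C A H2 := c2
  exact ⟨b, (c1'.inter c2').mono le_rfl subset_rfl (fun g hg => hb g hg.1 hg.2)⟩

end Reduction

section Transfer

variable {V : Type} [AddCommGroup V] [Module ℂ V] {K : ℕ} {A : Set (Module.End ℂ V)ˣ}

lemma TriCov.of_cov (hA : IsApx K A) {c C : ℕ} {H : Subgroup (Module.End ℂ V)ˣ} (h : Cov c A H)
    (h' : TriCov C (A ^ 2 ∩ H)) : TriCov (c * C) A := by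
  obtain ⟨b, hb⟩ := h'
  exact ⟨b, hA.cov_trans' h hb⟩

/-- Approximate groups mostly stabilizing a proper subspace. -/
lemma triCov_of_cov_stab {n : ℕ} (hT : TBelow n) (K c : ℕ) : ∃ C : ℕ, ∀ (V : Type) [AddCommGroup V]
    [Module ℂ V] [FiniteDimensional ℂ V], finrank ℂ V = n → ∀ A : Set (Module.End ℂ V)ˣ,
    IsApx K A → ∀ W : Submodule ℂ V, W ≠ ⊥ → W ≠ ⊤ → Cov c A (U (algStab W)) → TriCov C A := by
  obtain ⟨C, hC⟩ := triCov_of_stab hT (K ^ 3)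
  refine ⟨c * C, ?_⟩
  intro V _ _ _ hV A hA W hW hW' hAW
  exact TriCov.of_cov hA hAW (hC V hV _ (hA.inter _) W hW hW' Set.inter_subset_right)

/-- The image of a subspace under a unit. -/
def gm (g : (Module.End ℂ V)ˣ) (W : Submodule ℂ V) : Submodule ℂ V := W.map (g : Module.End ℂ V)

lemma mem_gm {g : (Module.End ℂ V)ˣ} {W : Submodule ℂ V} {v : V} :
    v ∈ gm g W ↔ ((g⁻¹ : (Module.End ℂ V)ˣ) : Module.End ℂ V) v ∈ W := by
  constructor
  · rintro ⟨w, hw, rfl⟩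
    rw [units_inv_apply]; exact hw
  · intro h
    exact ⟨_, h, units_apply_inv g v⟩

lemma gm_mul (g h : (Module.End ℂ V)ˣ) (W : Submodule ℂ V) : gm (g * h) W = gm g (gm h W) := by
  ext v; simp [mem_gm]

lemma gm_one (W : Submodule ℂ V) : gm 1 W = W := by ext v; simp [mem_gm]

lemma gm_eq_bot {g : (Module.End ℂ V)ˣ} {W : Submodule ℂ V} (h : gm g W = ⊥) : W = ⊥ := by
  have : gm g⁻¹ (gm g W) = ⊥ := by rw [h]; exact Submodule.map_bot _
  rwa [← gm_mul, inv_mul_cancel, gm_one] at this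

lemma mem_stab_iff {g : (Module.End ℂ V)ˣ} {W : Submodule ℂ V} :
    g ∈ U (algStab W) ↔ gm g W = W := by
  constructor
  · intro h
    ext v
    rw [mem_gm]
    refine ⟨fun hv => ?_, fun hv => h.2 _ hv⟩
    have := h.1 _ hv
    rwa [units_apply_inv] at this
  · intro h
    refine ⟨fun w hw => ?_, fun w hw => ?_⟩
    · rw [← h, mem_gm, units_inv_apply]; exact hw
    · rw [← h] at hw; exact mem_gm.1 hw

lemma inv_mul_mem_stab {g h : (Module.End ℂ V)ˣ} {W : Submodule ℂ V} (hgh : gm g W = gm h W) :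
    g⁻¹ * h ∈ U (algStab W) := by
  rw [mem_stab_iff, gm_mul, ← hgh, ← gm_mul, inv_mul_cancel, gm_one]

/-- Weight spaces of a subalgebra. -/
def IsWt (M : Subalgebra ℂ (Module.End ℂ V)) (W : Submodule ℂ V) : Prop :=
  W ≠ ⊥ ∧ ∃ χ : Module.End ℂ V → ℂ, ∀ w, w ∈ W ↔ ∀ x ∈ M, x w = χ x • w

lemma exists_isWt {M : Subalgebra ℂ (Module.End ℂ V)} {v : V} (hv : v ≠ 0)
    (h : ∀ x ∈ M, ∃ c : ℂ, x v = c • v) : ∃ W, IsWt M W := by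
  choose! χ hχ using h
  refine ⟨{ carrier := {w | ∀ x ∈ M, x w = χ x • w}
            add_mem' := ?_
            zero_mem' := ?_
            smul_mem' := ?_ }, ?_, χ, fun w => Iff.rfl⟩
  · intro a b ha hb x hx
    rw [map_add, ha x hx, hb x hx, smul_add]
  · intro x hx; simp
  · intro c w hw x hx
    rw [map_smul, hw x hx, smul_comm]
  · rw [Submodule.ne_bot_iff]
    exact ⟨v, hχ, hv⟩

lemma IsWt.gm {M : Subalgebra ℂ (Module.End ℂ V)} {W : Submodule ℂ V} (h : IsWt M W)
    (g : (Module.End ℂ V)ˣ) : IsWt (cj g M) (gm g W) := by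
  obtain ⟨h0, χ, hχ⟩ := h
  refine ⟨fun h' => h0 (gm_eq_bot h'), fun x => χ (conjHom g x), fun w => ?_⟩
  rw [mem_gm, hχ]
  constructor
  · intro h x hx
    have := congrArg (g : Module.End ℂ V) (h _ hx)
    simpa [units_apply_inv, map_smul, conjHom_apply] using this
  · intro h x hx
    have := congrArg ((g⁻¹ : (Module.End ℂ V)ˣ) : Module.End ℂ V)
      (h _ (conj_mem_cj (g := g).2 hx))
    simpa [units_inv_apply, map_smul, conjHom_apply, mul_assoc] using this

lemma IsWt.ne_top {M : Subalgebra ℂ (Module.End ℂ V)} {W : Submodule ℂ V} (h : IsWt M W)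
    (hM : M ≠ ⊥) : W ≠ ⊤ := by
  obtain ⟨-, χ, hχ⟩ := h
  rintro rfl
  apply hM
  rw [eq_bot_iff]
  intro x hx
  rw [mem_bot]
  exact ⟨χ x, LinearMap.ext fun w => (hχ w).1 trivial x hx⟩

variable [FiniteDimensional ℂ V]

lemma isWt_finite (M : Subalgebra ℂ (Module.End ℂ V)) :
    {W | IsWt M W}.Finite ∧ {W | IsWt M W}.ncard ≤ finrank ℂ V * finrank ℂ V := by
  have key : ∀ W : {W | IsWt M W}, ∃ f : M →ₐ[ℂ] ℂ, ∀ w, w ∈ W.1 ↔ ∀ x : M, x.1 w = f x • w := by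
    rintro ⟨W, h0, χ, hχ⟩
    obtain ⟨v, hv, hv0⟩ := (Submodule.ne_bot_iff W).1 h0
    have hχv := (hχ v).1 hv
    have inj : ∀ a b : ℂ, a • v = b • v → a = b := fun a b hab => smul_left_injective ℂ hv0 hab
    refine ⟨{ toFun := fun x => χ x.1, map_one' := ?_, map_mul' := ?_, map_zero' := ?_,
              map_add' := ?_, commutes' := ?_ }, fun w => ?_⟩
    · apply inj; rw [← hχv _ (1 : M).2]; simp
    · intro x y; apply inj
      rw [← hχv _ (x * y).2, mul_smul, ← hχv _ y.2, ← map_smul, ← hχv _ x.2]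
      simp [hχv _ y.2, hχv _ x.2, smul_comm (χ x.1)]
    · apply inj; rw [← hχv _ (0 : M).2]; simp
    · intro x y; apply inj
      rw [← hχv _ (x + y).2, add_smul, ← hχv _ y.2, ← hχv _ x.2]; simp
    · intro c; apply inj
      rw [← hχv _ (algebraMap ℂ M c).2]; simp
    · simp [hχ]
  choose f hf using key
  have inj : Function.Injective f := by
    intro W W' h
    ext w
    rw [hf, hf, h]
  have hfin : Finite {W | IsWt M W} := Finite.of_injective f inj
  refine ⟨hfin, ?_⟩
  calc {W | IsWt M W}.ncard ≤ Nat.card (M →ₐ[ℂ] ℂ) := Nat.card_le_card_of_injective f inj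
    _ ≤ finrank ℂ M := card_algHom_le_finrank ℂ M ℂ
    _ ≤ finrank ℂ (Module.End ℂ V) := Submodule.finrank_le (Subalgebra.toSubmodule M)
    _ = _ := by rw [Module.finrank_linearMap]

lemma isWt_cov {M : Subalgebra ℂ (Module.End ℂ V)} {W : Submodule ℂ V} (h : IsWt M W)
    (hA : A ⊆ nz M) : Cov (finrank ℂ V * finrank ℂ V) A (U (algStab W)) := by
  refine Cov.of_finite_image (fun g => gm g W) (isWt_finite M).1 (isWt_finite M).2 ?_ ?_
  · intro g hg
    have := h.gm g
    rwa [mem_nz.1 (hA hg)] at this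
  · intro s _ t _ hst
    exact inv_mul_mem_stab hst

end Transfer

section Socle

variable {V : Type} [AddCommGroup V] [Module ℂ V]

/-- Minimal nonzero invariant subspaces. -/
structure IsMinInv (B : Subalgebra ℂ (Module.End ℂ V)) (W : Submodule ℂ V) : Prop where
  ne_bot : W ≠ ⊥
  inv : ∀ x ∈ B, ∀ w ∈ W, x w ∈ W
  min : ∀ W' ≤ W, W' ≠ ⊥ → (∀ x ∈ B, ∀ w ∈ W', x w ∈ W') → W ≤ W'

lemma IsMinInv.gm {B : Subalgebra ℂ (Module.End ℂ V)} {W : Submodule ℂ V} (h : IsMinInv B W)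
    {g : (Module.End ℂ V)ˣ} (hg : g ∈ nz B) : IsMinInv B (gm g W) where
  ne_bot h' := h.ne_bot (gm_eq_bot h')
  inv x hx w hw := by
    rw [mem_gm] at hw ⊢
    have hx' : conjHom g x ∈ B := by
      rw [← mem_nz.1 hg] at hx; exact hx
    have := h.inv _ hx' _ hw
    simpa [conjHom_apply, units_apply_inv] using this
  min W' hW' h0 hinv := by
    have key : W ≤ ApproxLinear.gm g⁻¹ W' := by
      refine h.min _ ?_ (fun h' => h0 (gm_eq_bot h')) ?_
      · intro v hv
        rw [mem_gm, inv_inv] at hv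
        have := hW' hv
        rwa [mem_gm, units_inv_apply] at this
      · intro x hx w hw
        rw [mem_gm, inv_inv] at hw ⊢
        have hx' : conjHom g⁻¹ x ∈ B := by
          have hg' := mem_nz.1 ((nz B).inv_mem hg)
          rw [← hg'] at hx; exact hx
        have := hinv _ hx' _ hw
        simpa [conjHom_apply, units_inv_apply] using this
    intro v hv
    rw [mem_gm] at hv
    have := key hv
    rwa [mem_gm, inv_inv, units_apply_inv] at this

lemma exists_isMinInv [FiniteDimensional ℂ V] [Nontrivial V] (B : Subalgebra ℂ (Module.End ℂ V)) :
    ∃ W, IsMinInv B W := by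
  let S : Set (Submodule ℂ V) := {W | W ≠ ⊥ ∧ ∀ x ∈ B, ∀ w ∈ W, x w ∈ W}
  have hS : S.Nonempty := ⟨⊤, top_ne_bot, fun _ _ _ _ => trivial⟩
  obtain ⟨W, hW, hmin⟩ := (wellFounded_lt (α := Submodule ℂ V)).has_min S hS
  refine ⟨W, hW.1, hW.2, fun W' h1 h2 h3 => ?_⟩
  by_contra h
  exact hmin W' ⟨h2, h3⟩ (lt_of_le_not_ge h1 h)

/-- The sum of the minimal invariant subspaces. -/
def soc (B : Subalgebra ℂ (Module.End ℂ V)) : Submodule ℂ V := sSup {W | IsMinInv B W}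

lemma nz_le_stab_soc (B : Subalgebra ℂ (Module.End ℂ V)) : nz B ≤ U (algStab (soc B)) := by
  have key : ∀ g ∈ nz B, ∀ w ∈ soc B, (g : Module.End ℂ V) w ∈ soc B := by
    intro g hg
    have : soc B ≤ (soc B).comap (g : Module.End ℂ V) := by
      refine sSup_le fun W hW => ?_
      rw [← Submodule.map_le_iff_le_comap]
      exact le_sSup (a := gm g W) (IsMinInv.gm hW hg)
    exact this
  exact fun g hg => ⟨key g hg, key _ ((nz B).inv_mem hg)⟩

lemma soc_ne_bot [FiniteDimensional ℂ V] [Nontrivial V] (B : Subalgebra ℂ (Module.End ℂ V)) :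
    soc B ≠ ⊥ := by
  obtain ⟨W, hW⟩ := exists_isMinInv B
  intro h
  exact hW.ne_bot (le_bot_iff.1 (h ▸ le_sSup (a := W) hW))

lemma isSemisimpleModule_of_soc {B : Subalgebra ℂ (Module.End ℂ V)} (h : soc B = ⊤) :
    IsSemisimpleModule B V := by
  let down : Submodule B V → Submodule ℂ V := fun m =>
    { carrier := m
      add_mem' := m.add_mem
      zero_mem' := m.zero_mem
      smul_mem' := fun c w hw => by
        have := m.smul_mem (algebraMap ℂ B c) hw
        simpa [Subalgebra.smul_def] using this }
  apply IsSemisimpleModule.of_sSup_simples_eq_top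
  rw [eq_top_iff]
  have : soc B ≤ down (sSup {m : Submodule B V | IsSimpleModule B m}) := by
    refine sSup_le fun W hW => ?_
    let m : Submodule B V :=
      { carrier := W
        add_mem' := W.add_mem
        zero_mem' := W.zero_mem
        smul_mem' := fun c w hw => hW.inv _ c.2 _ hw }
    have hm : IsSimpleModule B m := by
      rw [isSimpleModule_iff_isAtom]
      refine ⟨fun h0 => hW.ne_bot ?_, fun k hk => ?_⟩
      · rw [eq_bot_iff]
        intro w hw
        have : w ∈ m := hw
        rw [h0] at this
        exact this
      · by_contra h0
        refine hk.not_ge ?_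
        refine hW.min (down k) hk.le ?_ fun x hx w hw => k.smul_mem ⟨x, hx⟩ hw
        intro h1
        apply h0
        rw [eq_bot_iff]
        intro w hw
        have : w ∈ down k := hw
        rw [h1] at this
        exact this
    have h' : m ≤ sSup {m : Submodule B V | IsSimpleModule B m} := le_sSup (a := m) hm
    exact h'
  rw [h] at this
  exact fun v _ => this (Submodule.mem_top (x := v))

/-- The center of a subalgebra. -/
def zen (B : Subalgebra ℂ (Module.End ℂ V)) : Subalgebra ℂ (Module.End ℂ V) :=
  B ⊓ Subalgebra.centralizer ℂ B

lemma mem_zen {B : Subalgebra ℂ (Module.End ℂ V)} {x : Module.End ℂ V} :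
    x ∈ zen B ↔ x ∈ B ∧ ∀ y ∈ B, y * x = x * y := by
  simp [zen, Algebra.mem_inf, Subalgebra.mem_centralizer_iff]

lemma nz_le_nz_zen (B : Subalgebra ℂ (Module.End ℂ V)) : nz B ≤ nz (zen B) := by
  have key : ∀ g ∈ nz B, zen B ≤ cj g (zen B) := by
    intro g hg x hx
    rw [mem_zen] at hx
    have hB := mem_nz.1 hg
    change conjHom g x ∈ zen B
    rw [mem_zen]
    refine ⟨by have h := hx.1; rw [← hB] at h; exact h, fun y hy => ?_⟩
    have hy' : (g : Module.End ℂ V) * y * ((g⁻¹ : (Module.End ℂ V)ˣ)) ∈ B := by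
      rw [← hB, conj_mem_cj]; exact hy
    have := congrArg (conjHom g) (hx.2 _ hy')
    simpa [conjHom_apply, mul_assoc] using this
  intro g hg
  refine le_antisymm ?_ (key g hg)
  rw [cj_le_iff]
  exact key _ ((nz B).inv_mem hg)

lemma exists_isWt_zen [FiniteDimensional ℂ V] [Nontrivial V] (B : Subalgebra ℂ (Module.End ℂ V)) :
    ∃ W, IsWt (zen B) W := by
  obtain ⟨W, hW⟩ := exists_isMinInv B
  obtain ⟨v, hv, hv0⟩ := (Submodule.ne_bot_iff W).1 hW.ne_bot
  refine exists_isWt hv0 fun x hx => ?_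
  rw [mem_zen] at hx
  have : Nontrivial W := Submodule.nontrivial_iff_ne_bot.2 hW.ne_bot
  obtain ⟨c, hc⟩ := Module.End.exists_eigenvalue (x.restrict (hW.inv x hx.1))
  obtain ⟨w, hw⟩ := hc.exists_hasEigenvector
  have hw1 : x w.1 = c • w.1 := congrArg Subtype.val hw.apply_eq_smul
  refine ⟨c, ?_⟩
  have := hW.min (W ⊓ LinearMap.ker (x - c • 1)) inf_le_left ?_ ?_
  · have h := (this hv).2
    simpa [sub_eq_zero] using h
  · rw [Submodule.ne_bot_iff]
    exact ⟨w.1, ⟨w.2, by simp [hw1]⟩, fun h => hw.2 (Subtype.ext h)⟩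
  · rintro y hy u ⟨hu1, hu2⟩
    refine ⟨hW.inv y hy u hu1, ?_⟩
    have hu3 : x u = c • u := by simpa [sub_eq_zero] using hu2
    have h := LinearMap.congr_fun (hx.2 y hy) u
    simp only [Module.End.mul_apply] at h
    simp [← h, hu3]

lemma exists_algEquiv_of_zen [FiniteDimensional ℂ V] [Nontrivial V]
    {B : Subalgebra ℂ (Module.End ℂ V)} (h : soc B = ⊤) (hz : zen B = ⊥) :
    ∃ d : ℕ, Nonempty (B ≃ₐ[ℂ] Module.End ℂ (Fin d → ℂ)) := by
  have hV := isSemisimpleModule_of_soc h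
  let b := Module.finBasis ℂ V
  let f : B →ₗ[B] (Fin (finrank ℂ V) → V) :=
    LinearMap.pi fun i => LinearMap.toSpanSingleton B V (b i)
  have hf : Function.Injective f := by
    intro x y hxy
    refine Subtype.ext (b.ext fun i => ?_)
    exact congrFun hxy i
  have hB : IsSemisimpleRing B := IsSemisimpleModule.of_injective f hf
  obtain ⟨k, d, hd, ⟨φ⟩⟩ := IsSemisimpleRing.exists_algEquiv_pi_matrix_of_isAlgClosed ℂ B
  have hsub : ∀ i j : Fin k, i = j := by
    intro i j
    by_contra hij
    let e : (Π i, Matrix (Fin (d i)) (Fin (d i)) ℂ) := Pi.single i 1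
    have he : ((φ.symm e : B) : Module.End ℂ V) ∈ zen B := by
      rw [mem_zen]
      refine ⟨(φ.symm e).2, fun y hy => ?_⟩
      have : (⟨y, hy⟩ : B) * φ.symm e = φ.symm e * ⟨y, hy⟩ := by
        apply φ.injective
        rw [map_mul, map_mul, φ.apply_symm_apply]
        ext l
        by_cases hl : l = i
        · subst hl; simp [e]
        · simp [e, Pi.single_eq_of_ne hl]
      exact congrArg Subtype.val this
    rw [hz, mem_bot] at he
    obtain ⟨c, hc⟩ := he
    have h1 : φ.symm e = c • 1 := Subtype.ext hc
    have h2 : e = c • 1 := by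
      rw [← φ.apply_symm_apply e, h1, map_smul, map_one]
    have hi := congrFun h2 i
    have hj := congrFun h2 j
    have h3 : c = 0 := by
      have := congrFun (congrFun hj ⟨0, Nat.pos_of_ne_zero (hd j).out⟩) ⟨0, Nat.pos_of_ne_zero (hd j).out⟩
      simpa [e, Pi.single_eq_of_ne (Ne.symm hij)] using this.symm
    have := congrFun (congrFun hi ⟨0, Nat.pos_of_ne_zero (hd i).out⟩) ⟨0, Nat.pos_of_ne_zero (hd i).out⟩
    simp [e, h3] at this
  have hk : 0 < k := by
    by_contra h0
    have : IsEmpty (Fin k) := by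
      rw [Nat.eq_zero_of_not_pos h0]; infer_instance
    have h1 : (1 : B) = 0 := φ.injective (Subsingleton.elim _ _)
    exact one_ne_zero (congrArg Subtype.val h1 : (1 : Module.End ℂ V) = 0)
  let i0 : Fin k := ⟨0, hk⟩
  let ψ : B →ₐ[ℂ] Matrix (Fin (d i0)) (Fin (d i0)) ℂ := (Pi.evalAlgHom ℂ _ i0).comp φ.toAlgHom
  have hψ : Function.Bijective ψ := by
    constructor
    · intro x y hxy
      apply φ.injective
      ext1 j
      rw [hsub j i0]; exact hxy
    · intro m
      refine ⟨φ.symm (Pi.single i0 m), ?_⟩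
      simp [ψ]
  exact ⟨d i0, ⟨(AlgEquiv.ofBijective ψ hψ).trans Matrix.toLinAlgEquiv'⟩⟩

end Socle

section Scalars

variable {V : Type} [AddCommGroup V] [Module ℂ V]

/-- Scalars as units of the endomorphism ring. -/
def sc (V : Type) [AddCommGroup V] [Module ℂ V] : ℂˣ →* (Module.End ℂ V)ˣ :=
  Units.map (algebraMap ℂ (Module.End ℂ V)).toMonoidHom

lemma sc_coe (c : ℂˣ) : (sc V c : Module.End ℂ V) = (c : ℂ) • 1 := by
  simp [sc, Algebra.algebraMap_eq_smul_one]

lemma sc_comm (c : ℂˣ) (g : (Module.End ℂ V)ˣ) : sc V c * g = g * sc V c := by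
  ext1; simp [sc_coe]

variable [FiniteDimensional ℂ V] [Nontrivial V]

lemma finite_scalars : {s : (Module.End ℂ V)ˣ | (s : Module.End ℂ V) ∈
    (⊥ : Subalgebra ℂ (Module.End ℂ V)) ∧ LinearMap.det (s : Module.End ℂ V) = 1}.Finite := by
  have hn : 0 < finrank ℂ V := Module.finrank_pos
  have h1 : {c : ℂ | c ^ finrank ℂ V = 1}.Finite := by
    refine ((Polynomial.nthRoots (finrank ℂ V) (1 : ℂ)).toFinset.finite_toSet).subset ?_
    intro c hc
    simpa [Polynomial.mem_nthRoots hn] using hc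
  have h2 : ((fun c : ℂ => c • (1 : Module.End ℂ V)) '' {c : ℂ | c ^ finrank ℂ V = 1}).Finite :=
    h1.image _
  refine Set.Finite.of_finite_image (f := fun s : (Module.End ℂ V)ˣ => (s : Module.End ℂ V))
    (h2.subset ?_) (fun a _ b _ h => Units.ext h)
  rintro _ ⟨s, ⟨hs, hd⟩, rfl⟩
  obtain ⟨c, hc⟩ := mem_bot.1 hs
  refine ⟨c, ?_, hc.symm⟩
  rw [hc, LinearMap.det_smul] at hd
  simpa using hd

lemma exists_sc_det (s : (Module.End ℂ V)ˣ) :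
    ∃ c : ℂˣ, LinearMap.det ((sc V c * s : (Module.End ℂ V)ˣ) : Module.End ℂ V) = 1 := by
  have hn : 0 < finrank ℂ V := Module.finrank_pos
  have hs : LinearMap.det (s : Module.End ℂ V) ≠ 0 := by
    have := s.isUnit.map (LinearMap.det : Module.End ℂ V →* ℂ)
    exact this.ne_zero
  obtain ⟨c, hc⟩ := IsAlgClosed.exists_pow_nat_eq (LinearMap.det (s : Module.End ℂ V))⁻¹ hn
  have hc0 : c ≠ 0 := by
    rintro rfl
    rw [zero_pow hn.ne'] at hc
    exact hs (inv_eq_zero.1 hc.symm)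
  refine ⟨Units.mk0 c hc0, ?_⟩
  rw [Units.val_mul, map_mul, sc_coe, LinearMap.det_smul, Units.val_mk0, hc]
  simp [hs]

end Scalars

section Normalizer

variable {V V' : Type} [AddCommGroup V] [Module ℂ V] [AddCommGroup V'] [Module ℂ V']

/-- Pairs acting compatibly on an embedded endomorphism algebra. -/
def relProj (ψ : Module.End ℂ V' →ₐ[ℂ] Module.End ℂ V) :
    Subgroup ((Module.End ℂ V)ˣ × (Module.End ℂ V')ˣ) where
  carrier := {p | LinearMap.det (p.2 : Module.End ℂ V') = 1 ∧
    ∀ y, (p.1 : Module.End ℂ V) * ψ y = ψ (p.2 * y * ((p.2⁻¹ : (Module.End ℂ V')ˣ))) * p.1}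
  mul_mem' := by
    rintro p q ⟨hp, hp'⟩ ⟨hq, hq'⟩
    refine ⟨by simp [hp, hq], fun y => ?_⟩
    simp only [Prod.fst_mul, Prod.snd_mul, Units.val_mul, mul_inv_rev]
    rw [mul_assoc, hq', ← mul_assoc, hp', mul_assoc]
    simp only [mul_assoc]
  one_mem' := by simp
  inv_mem' := by
    rintro p ⟨hp, hp'⟩
    refine ⟨?_, fun y => ?_⟩
    · have : LinearMap.det ((p.2 * p.2⁻¹ : (Module.End ℂ V')ˣ) : Module.End ℂ V') = 1 := by simp
      rw [Units.val_mul, map_mul, hp, one_mul] at this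
      exact this
    · have := hp' (((p.2⁻¹ : (Module.End ℂ V')ˣ) : Module.End ℂ V') * y * p.2)
      simp only [Prod.fst_inv, Prod.snd_inv, inv_inv]
      rw [Units.inv_mul_eq_iff_eq_mul, ← mul_assoc, this, mul_assoc _ (p.1 : Module.End ℂ V),
        Units.mul_inv, mul_one]
      simp [mul_assoc]

/-- The span of the images of `ψ y` for the maps `y` with range in `ℓ`. -/
def relProjSpan (ψ : Module.End ℂ V' →ₐ[ℂ] Module.End ℂ V) (l : Submodule ℂ V') :
    Submodule ℂ V :=
  Submodule.span ℂ {w | ∃ y v, (∀ u, y u ∈ l) ∧ w = ψ y v}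

lemma relProj_stab {ψ : Module.End ℂ V' →ₐ[ℂ] Module.End ℂ V} {l : Submodule ℂ V'}
    {g : (Module.End ℂ V)ˣ} {s : (Module.End ℂ V')ˣ} (hgs : (g, s) ∈ relProj ψ)
    (hs : s ∈ U (algStab l)) : g ∈ U (algStab (relProjSpan ψ l)) := by
  have key : ∀ (g : (Module.End ℂ V)ˣ) (s : (Module.End ℂ V')ˣ), (g, s) ∈ relProj ψ →
      s ∈ U (algStab l) → ∀ w ∈ relProjSpan ψ l, (g : Module.End ℂ V) w ∈ relProjSpan ψ l := by
    intro g s hgs hs w hw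
    have : relProjSpan ψ l ≤ (relProjSpan ψ l).comap (g : Module.End ℂ V) := by
      refine Submodule.span_le.2 ?_
      rintro _ ⟨y, v, hy, rfl⟩
      refine Submodule.subset_span ⟨s * y * ((s⁻¹ : (Module.End ℂ V')ˣ)), (g : Module.End ℂ V) v, ?_,
        ?_⟩
      · exact fun u => hs.1 _ (hy _)
      · exact LinearMap.congr_fun (hgs.2 y) v
    exact this hw
  exact ⟨key g s hgs hs, key g⁻¹ s⁻¹ ((relProj ψ).inv_mem hgs) ((U _).inv_mem hs)⟩

lemma relProj_lift [FiniteDimensional ℂ V'] [Nontrivial V'] {B : Subalgebra ℂ (Module.End ℂ V)}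
    (φ : B ≃ₐ[ℂ] Module.End ℂ V') {g : (Module.End ℂ V)ˣ} (hg : g ∈ nz B) :
    ∃ s, (g, s) ∈ relProj (B.val.comp φ.symm.toAlgHom) := by
  have h1 : ∀ x ∈ B, conjHom g x ∈ B := fun x hx => by
    rw [← mem_nz.1 hg] at hx; exact hx
  have h2 : ∀ x ∈ B, conjHom g⁻¹ x ∈ B := fun x hx => by
    rw [← mem_nz.1 ((nz B).inv_mem hg)] at hx; exact hx
  have e1 : ∀ x, conjHom g (conjHom g⁻¹ x) = x := fun x => by simp [conjHom_apply, mul_assoc]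
  have e2 : ∀ x, conjHom g⁻¹ (conjHom g x) = x := fun x => by simp [conjHom_apply, mul_assoc]
  let α : B ≃ₐ[ℂ] B := AlgEquiv.ofAlgHom
    (((conjHom g⁻¹).comp B.val).codRestrict B (fun x => h2 _ x.2))
    (((conjHom g).comp B.val).codRestrict B (fun x => h1 _ x.2))
    (AlgHom.ext fun x => Subtype.ext (e2 x)) (AlgHom.ext fun x => Subtype.ext (e1 x))
  obtain ⟨T, hT⟩ := ((φ.symm.trans α).trans φ).eq_linearEquivConjAlgEquiv
  let s : (Module.End ℂ V')ˣ := (LinearMap.GeneralLinearGroup.generalLinearEquiv ℂ V').symm T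
  have hs : ∀ y, φ (α (φ.symm y)) = s * y * ((s⁻¹ : (Module.End ℂ V')ˣ)) := by
    intro y
    have := congrArg (fun f => f y) hT
    simp only [AlgEquiv.trans_apply] at this
    rw [this]
    rfl
  obtain ⟨c, hc⟩ := exists_sc_det s
  refine ⟨sc V' c * s, hc, fun y => ?_⟩
  have h3 : ((sc V' c * s : (Module.End ℂ V')ˣ) : Module.End ℂ V') * y *
      (((sc V' c * s)⁻¹ : (Module.End ℂ V')ˣ)) = φ (α (φ.symm y)) := by
    rw [hs]
    rw [sc_comm, mul_inv_rev, Units.val_mul, Units.val_mul]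
    have h4 : (sc V' c : Module.End ℂ V') * y * ((sc V' c)⁻¹ : (Module.End ℂ V')ˣ) = y := by
      rw [Units.mul_inv_eq_iff_eq_mul, sc_coe]; simp
    calc _ = (s : Module.End ℂ V') * ((sc V' c : Module.End ℂ V') * y * ((sc V' c)⁻¹ : (Module.End ℂ V')ˣ)) * ((s⁻¹ : (Module.End ℂ V')ˣ)) := by
          simp only [mul_assoc]
      _ = _ := by rw [h4]
  have h5 : ((g, sc V' c * s) : (Module.End ℂ V)ˣ × (Module.End ℂ V')ˣ).2 = sc V' c * s := rfl
  rw [h5, h3]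
  change (g : Module.End ℂ V) * (φ.symm y : B) = (φ.symm (φ (α (φ.symm y))) : B) * (g : Module.End ℂ V)
  rw [φ.symm_apply_apply]
  change _ = conjHom g⁻¹ (φ.symm y : B) * (g : Module.End ℂ V)
  simp [conjHom_apply]

lemma relProj_fin [FiniteDimensional ℂ V'] [Nontrivial V']
    {ψ : Module.End ℂ V' →ₐ[ℂ] Module.End ℂ V} (hψ : Function.Injective ψ) :
    {s | ((1 : (Module.End ℂ V)ˣ), s) ∈ relProj ψ}.Finite := by
  refine (finite_scalars (V := V')).subset ?_
  rintro s ⟨hs, h⟩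
  refine ⟨?_, hs⟩
  apply centr_eq_top
  rw [eq_top_iff]
  intro y _
  rw [mem_centr]
  have := h y
  simp only [Units.val_one, one_mul, mul_one] at this
  have h2 := hψ this
  rw [Units.eq_mul_inv_iff_mul_eq] at h2
  exact h2.symm

/-- Approximate groups normalizing an embedded endomorphism algebra. -/
lemma exists_stab_of_algEquiv [FiniteDimensional ℂ V] {n : ℕ} (hn : finrank ℂ V = n) {K C d : ℕ}
    {A : Set (Module.End ℂ V)ˣ} (hA : IsApx K A)
    (hC : ∀ (V : Type) [AddCommGroup V] [Module ℂ V]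
      [FiniteDimensional ℂ V], finrank ℂ V < n → ∀ A : Set (Module.End ℂ V)ˣ, IsApx K A → TriCov C A)
    {B : Subalgebra ℂ (Module.End ℂ V)} (h1 : B ≠ ⊥) (h2 : B ≠ ⊤) (hAB : A ⊆ nz B)
    (φ : B ≃ₐ[ℂ] Module.End ℂ (Fin d → ℂ)) :
    ∃ W : Submodule ℂ V, W ≠ ⊥ ∧ W ≠ ⊤ ∧ Cov C A (U (algStab W)) := by
  have hrank : finrank ℂ B = d * d := by
    rw [φ.toLinearEquiv.finrank_eq, Module.finrank_linearMap]; simp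
  have hd2 : 2 ≤ d := by
    by_contra h
    have h3 : d * d ≤ 1 := by
      have : d ≤ 1 := by omega
      nlinarith
    refine h1 (subalg_eq_of_finrank bot_le ?_).symm
    rw [hrank]
    refine h3.trans ?_
    rcases subsingleton_or_nontrivial V with hV | hV
    · exfalso
      apply h2
      rw [eq_top_iff]
      intro x _
      rw [Subsingleton.elim x 0]
      exact B.zero_mem
    · exact Module.finrank_pos
  have hdn : d < n := by
    by_contra h
    refine h2 (subalg_eq_of_finrank le_top ?_)
    rw [hrank]
    calc finrank ℂ (⊤ : Subalgebra ℂ (Module.End ℂ V)) = finrank ℂ (Module.End ℂ V) := finrank_top ℂ _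
      _ = n * n := by rw [Module.finrank_linearMap, hn]
      _ ≤ _ := Nat.mul_le_mul (by omega) (by omega)
  have : Nontrivial (Fin d → ℂ) := by
    have : Nonempty (Fin d) := ⟨⟨0, by omega⟩⟩
    infer_instance
  set ψ : Module.End ℂ (Fin d → ℂ) →ₐ[ℂ] Module.End ℂ V := B.val.comp φ.symm.toAlgHom with hψ
  have hinj : Function.Injective ψ := Subtype.val_injective.comp φ.symm.injective
  have lift : ∀ g ∈ A, ∃ s, (g, s) ∈ relProj ψ := fun g hg => relProj_lift φ (hAB hg)
  have hf : finrank ℂ (Fin d → ℂ) = d := by simp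
  obtain ⟨b, hb⟩ := hC (Fin d → ℂ) (by omega) _ (hA.relImage_isApx lift (relProj_fin hinj))
  let i0 : Fin (finrank ℂ (Fin d → ℂ)) := ⟨0, by omega⟩
  let i1 : Fin (finrank ℂ (Fin d → ℂ)) := ⟨1, by omega⟩
  have h01 : i1 ≠ i0 := by simp [i0, i1]
  let l := Submodule.span ℂ {b i0}
  have htri : U (tri b) ≤ U (algStab l) := by
    refine U_mono ?_
    intro x hx w hw
    obtain ⟨c, rfl⟩ := Submodule.mem_span_singleton.1 hw
    rw [map_smul]
    refine l.smul_mem _ ?_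
    rw [← b.sum_repr (x (b i0))]
    refine Submodule.sum_mem _ fun i _ => ?_
    by_cases hi : i = i0
    · rw [hi]; exact l.smul_mem _ (Submodule.mem_span_singleton_self _)
    · have : b.repr (x (b i0)) i = 0 := by
        rw [← ent_apply]
        refine hx _ _ ?_
        have : (i : ℕ) ≠ 0 := fun h => hi (Fin.ext h)
        have h0 : (i0 : ℕ) = 0 := rfl
        omega
      rw [this, zero_smul]; exact l.zero_mem
  refine ⟨relProjSpan ψ l, ?_, ?_, ?_⟩
  · let y : Module.End ℂ (Fin d → ℂ) := (b.coord i0).smulRight (b i0)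
    have hy : y ≠ 0 := by
      intro h
      have := LinearMap.congr_fun h (b i0)
      simp [y, b.ne_zero] at this
    intro h
    apply hy
    apply hinj
    rw [map_zero]
    ext v
    have : ψ y v ∈ relProjSpan ψ l :=
      Submodule.subset_span ⟨y, v, fun u => l.smul_mem _ (Submodule.mem_span_singleton_self _), rfl⟩
    rw [h] at this
    exact this
  · let y : Module.End ℂ (Fin d → ℂ) := (b.coord i1).smulRight (b i0)
    have hy : y ≠ 0 := by
      intro h
      have := LinearMap.congr_fun h (b i1)
      simp [y, b.ne_zero] at this
    have hy0 : y (b i0) = 0 := by simp [y, h01.symm]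
    intro h
    apply hy
    apply hinj
    rw [map_zero]
    ext v
    have : relProjSpan ψ l ≤ LinearMap.ker (ψ y) := by
      refine Submodule.span_le.2 ?_
      rintro _ ⟨z, u, hz, rfl⟩
      have hyz : y * z = 0 := by
        refine LinearMap.ext fun t => ?_
        obtain ⟨c, hc⟩ := Submodule.mem_span_singleton.1 (hz t)
        rw [Module.End.mul_apply, ← hc, map_smul, hy0, smul_zero]; rfl
      have h3 : ψ y (ψ z u) = (ψ y * ψ z) u := rfl
      simp only [SetLike.mem_coe, LinearMap.mem_ker]
      rw [h3, ← map_mul, hyz, map_zero]; rfl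
    rw [h] at this
    exact this Submodule.mem_top
  · refine (IsApx.relImage_cov lift hb).mono le_rfl subset_rfl ?_
    rintro g ⟨s, hs, hgs⟩
    exact relProj_stab hgs (htri hs)

/-- Approximate groups normalizing a proper nontrivial subalgebra. -/
lemma triCov_of_nz {n : ℕ} (hT : TBelow n) (K : ℕ) : ∃ C : ℕ, ∀ (V : Type) [AddCommGroup V]
    [Module ℂ V] [FiniteDimensional ℂ V], finrank ℂ V = n → ∀ A : Set (Module.End ℂ V)ˣ,
    IsApx K A → ∀ B : Subalgebra ℂ (Module.End ℂ V), B ≠ ⊥ → B ≠ ⊤ → A ⊆ nz B → TriCov C A := by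
  obtain ⟨C0, hC0⟩ := hT K
  obtain ⟨C1, hC1⟩ := triCov_of_cov_stab hT K 1
  obtain ⟨C2, hC2⟩ := triCov_of_cov_stab hT K (n * n)
  obtain ⟨C3, hC3⟩ := triCov_of_cov_stab hT K C0
  refine ⟨C1 + C2 + C3, ?_⟩
  intro V _ _ _ hV A hA B h1 h2 hAB
  have : Nontrivial V := by
    by_contra h
    rw [not_nontrivial_iff_subsingleton] at h
    apply h2
    rw [eq_top_iff]
    intro x _
    rw [Subsingleton.elim x 0]
    exact B.zero_mem
  by_cases hz : zen B = ⊥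
  · by_cases hs : soc B = ⊤
    · obtain ⟨d, ⟨φ⟩⟩ := exists_algEquiv_of_zen hs hz
      obtain ⟨W, hW1, hW2, hW⟩ := exists_stab_of_algEquiv hV hA hC0 h1 h2 hAB φ
      exact (hC3 V hV A hA W hW1 hW2 hW).mono (by omega)
    · exact (hC1 V hV A hA _ (soc_ne_bot B) hs
        (Cov.of_subset (hAB.trans (nz_le_stab_soc B)))).mono (by omega)
  · obtain ⟨W, hW⟩ := exists_isWt_zen B
    have := isWt_cov hW (hAB.trans (nz_le_nz_zen B))
    rw [hV] at this
    exact (hC2 V hV A hA W hW.1 (hW.ne_top hz) this).mono (by omega)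

/-- Approximate groups mostly normalizing a proper nontrivial subalgebra. -/
lemma triCov_of_cov_nz {n : ℕ} (hT : TBelow n) (K c : ℕ) : ∃ C : ℕ, ∀ (V : Type) [AddCommGroup V]
    [Module ℂ V] [FiniteDimensional ℂ V], finrank ℂ V = n → ∀ A : Set (Module.End ℂ V)ˣ,
    IsApx K A → ∀ B : Subalgebra ℂ (Module.End ℂ V), B ≠ ⊥ → B ≠ ⊤ → Cov c A (nz B) →
    TriCov C A := by
  obtain ⟨C, hC⟩ := triCov_of_nz hT (K ^ 3)
  refine ⟨c * C, ?_⟩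
  intro V _ _ _ hV A hA B h1 h2 hAB
  exact TriCov.of_cov hA hAB (hC V hV _ (hA.inter _) B h1 h2 Set.inter_subset_right)

end Normalizer

section Heavy

lemma exists_large_inter {ι α : Type*} [DecidableEq ι] [DecidableEq α] (T : Finset ι)
    (F : ι → Finset α) (X : Finset α) {q s : ℕ} (hq : 1 ≤ q) (hF : ∀ i ∈ T, F i ⊆ X)
    (hs : ∀ i ∈ T, (F i).card = s) (hX : X.card ≤ q * s) (hT : T.card = 2 * q) :
    ∃ i ∈ T, ∃ j ∈ T, i ≠ j ∧ s ≤ 4 * q * (F i ∩ F j).card := by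
  by_contra! h
  have h1 : ∑ i ∈ T, (F i).card = ∑ x ∈ X, (T.filter (fun i => x ∈ F i)).card := by
    have := Finset.sum_card_bipartiteAbove_eq_sum_card_bipartiteBelow
      (s := T) (t := X) (fun i x => x ∈ F i)
    refine Eq.trans (Finset.sum_congr rfl fun i hi => ?_) this
    congr 1
    ext x
    simp only [Finset.mem_bipartiteAbove]
    exact ⟨fun hx => ⟨hF i hi hx, hx⟩, fun hx => hx.2⟩
  have h2 : ∑ p ∈ T.offDiag, (F p.1 ∩ F p.2).card =
      ∑ x ∈ X, (T.filter (fun i => x ∈ F i)).offDiag.card := by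
    have := Finset.sum_card_bipartiteAbove_eq_sum_card_bipartiteBelow
      (s := T.offDiag) (t := X) (fun (p : ι × ι) x => x ∈ F p.1 ∩ F p.2)
    calc _ = _ := ?_
      _ = _ := this
      _ = _ := ?_
    · refine Finset.sum_congr rfl fun p hp => ?_
      congr 1
      ext x
      simp only [Finset.mem_bipartiteAbove]
      exact ⟨fun hx => ⟨hF _ (Finset.mem_offDiag.1 hp).1 (Finset.mem_inter.1 hx).1, hx⟩, fun hx => hx.2⟩
    · refine Finset.sum_congr rfl fun x _ => ?_
      congr 1
      ext p
      simp only [Finset.mem_bipartiteBelow, Finset.mem_offDiag, Finset.mem_filter, Finset.mem_inter]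
      tauto
  have h3 : ∑ x ∈ X, (T.filter (fun i => x ∈ F i)).card ≤
      ∑ x ∈ X, (1 + (T.filter (fun i => x ∈ F i)).offDiag.card) := by
    refine Finset.sum_le_sum fun x _ => ?_
    rw [Finset.offDiag_card]
    generalize (T.filter (fun i => x ∈ F i)).card = k
    rcases k with _ | _ | k
    · simp
    · simp
    · rw [← Nat.sub_one_mul, show k + 1 + 1 - 1 = k + 1 by omega]
      nlinarith
  rw [← h1, Finset.sum_add_distrib, ← h2, Finset.sum_congr rfl hs] at h3
  simp only [Finset.sum_const, smul_eq_mul, mul_one, hT] at h3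
  have h4 : q * s ≤ ∑ p ∈ T.offDiag, (F p.1 ∩ F p.2).card := by nlinarith
  have h5 : 4 * q * ∑ p ∈ T.offDiag, (F p.1 ∩ F p.2).card ≤ T.offDiag.card * s := by
    rw [Finset.mul_sum]
    refine Finset.sum_le_card_nsmul _ _ _ fun p hp => ?_
    rw [Finset.mem_offDiag] at hp
    exact (h p.1 hp.1 p.2 hp.2.1 hp.2.2).le
  obtain ⟨i, hi, j, hj, hij⟩ := Finset.one_lt_card.1 (show 1 < T.card by omega)
  have hs0 : 0 < s := lt_of_le_of_lt (Nat.zero_le _) (h i hi j hj hij)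
  rw [Finset.offDiag_card, hT] at h5
  have h6 : 2 * q * (2 * q) - 2 * q < 4 * q * q := by
    have : 2 * q * (2 * q) = 4 * q * q := by ring
    have : 0 < 4 * q * q := by positivity
    omega
  have h7 : 4 * q * (q * s) ≤ (2 * q * (2 * q) - 2 * q) * s := (Nat.mul_le_mul_left _ h4).trans h5
  have h8 := Nat.mul_lt_mul_of_pos_right h6 hs0
  nlinarith

lemma Cov.exists_heavy {G : Type*} [Group G] {C : ℕ} {P H : Set G} (h : Cov C P H)
    (hP : P.Finite) : ∃ y, P.ncard ≤ C * {x ∈ H | y * x ∈ P}.ncard := by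
  classical
  rcases P.eq_empty_or_nonempty with rfl | ⟨p, hp⟩
  · exact ⟨1, by simp⟩
  obtain ⟨Y, hY, hYH⟩ := h
  choose! g hg using hYH
  lift P to Finset G using hP
  by_contra! hcon
  have h1 : P.card = ∑ y ∈ Y, (P.filter (fun x => g x = y)).card :=
    Finset.card_eq_sum_card_fiberwise fun x hx => (hg x hx).1
  have h2 : ∑ y ∈ Y, C * (P.filter (fun x => g x = y)).card < ∑ y ∈ Y, P.card := by
    refine Finset.sum_lt_sum_of_nonempty ⟨_, (hg p hp).1⟩ fun y hy => ?_
    refine lt_of_le_of_lt (Nat.mul_le_mul_left _ ?_)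
      (lt_of_lt_of_eq (hcon y) (Set.ncard_coe_finset P))
    rw [← Finset.card_image_of_injective _ (mul_right_injective y⁻¹), ← Set.ncard_coe_finset]
    refine Set.ncard_le_ncard ?_ ?_
    · intro x hx
      simp only [Finset.coe_image, Finset.coe_filter, Set.mem_image, Set.mem_ofPred_eq] at hx
      obtain ⟨u, ⟨hu1, hu2⟩, rfl⟩ := hx
      exact ⟨by rw [← hu2]; exact (hg u hu1).2, by simpa using hu1⟩
    · refine Set.Finite.subset ((P.finite_toSet).image (fun x => y⁻¹ * x)) ?_
      rintro x ⟨-, hx⟩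
      exact ⟨_, hx, by simp⟩
  rw [← Finset.mul_sum, ← h1, Finset.sum_const, smul_eq_mul] at h2
  have := Nat.mul_le_mul_right P.card hY
  omega

variable {V : Type} [AddCommGroup V] [Module ℂ V]

/-- Left translation on the first factor. -/
def actL (a : Module.End ℂ V) : (Module.End ℂ V × ℂ) →ₗ[ℂ] (Module.End ℂ V × ℂ) :=
  LinearMap.prodMap (LinearMap.mulLeft ℂ a) LinearMap.id

/-- Left translate of a subspace. -/
def tr (a : (Module.End ℂ V)ˣ) (L : Submodule ℂ (Module.End ℂ V × ℂ)) :
    Submodule ℂ (Module.End ℂ V × ℂ) :=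
  L.comap (actL ((a⁻¹ : (Module.End ℂ V)ˣ) : Module.End ℂ V))

lemma mem_tr {a : (Module.End ℂ V)ˣ} {L : Submodule ℂ (Module.End ℂ V × ℂ)} {x : Module.End ℂ V}
    {t : ℂ} : (x, t) ∈ tr a L ↔ (((a⁻¹ : (Module.End ℂ V)ˣ) : Module.End ℂ V) * x, t) ∈ L := Iff.rfl

lemma tr_mul (a b : (Module.End ℂ V)ˣ) (L : Submodule ℂ (Module.End ℂ V × ℂ)) :
    tr (a * b) L = tr a (tr b L) := by
  ext ⟨x, t⟩; simp [mem_tr, mul_assoc]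

lemma tr_one (L : Submodule ℂ (Module.End ℂ V × ℂ)) : tr 1 L = L := by
  ext ⟨x, t⟩; simp [mem_tr]

/-- The stabilizer of a subspace under left translations. -/
def stabL (L : Submodule ℂ (Module.End ℂ V × ℂ)) : Subgroup (Module.End ℂ V)ˣ where
  carrier := {a | tr a L = L}
  mul_mem' := by
    intro a b (ha : tr a L = L) (hb : tr b L = L)
    change tr (a * b) L = L
    rw [tr_mul, hb, ha]
  one_mem' := tr_one L
  inv_mem' := by
    intro a (ha : tr a L = L)
    change tr a⁻¹ L = L
    conv_lhs => rw [← ha]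
    rw [← tr_mul, inv_mul_cancel, tr_one]

lemma finrank_tr_le [FiniteDimensional ℂ V] (a : (Module.End ℂ V)ˣ)
    (L : Submodule ℂ (Module.End ℂ V × ℂ)) : finrank ℂ (tr a L) ≤ finrank ℂ L := by
  have hinj : Function.Injective (actL ((a⁻¹ : (Module.End ℂ V)ˣ) : Module.End ℂ V)) := by
    rintro ⟨x, t⟩ ⟨y, u⟩ h
    have h1 : ((a⁻¹ : (Module.End ℂ V)ˣ) : Module.End ℂ V) * x =
      ((a⁻¹ : (Module.End ℂ V)ˣ) : Module.End ℂ V) * y := congrArg Prod.fst h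
    have h2 : t = u := congrArg Prod.snd h
    rw [(a⁻¹).isUnit.mul_right_inj] at h1
    rw [h1, h2]
  refine LinearMap.finrank_le_finrank_of_injective
    (f := (actL ((a⁻¹ : (Module.End ℂ V)ˣ) : Module.End ℂ V)).restrict (p := tr a L) (q := L)
      (fun x hx => hx)) ?_
  intro x y h
  exact Subtype.ext (hinj (congrArg Subtype.val h))

lemma exists_stabL (K r : ℕ) : ∀ c : ℕ, 1 ≤ c → ∃ C : ℕ, ∀ (V : Type) [AddCommGroup V] [Module ℂ V]
    [FiniteDimensional ℂ V] (A : Set (Module.End ℂ V)ˣ), IsApx K A →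
    ∀ L : Submodule ℂ (Module.End ℂ V × ℂ), finrank ℂ L ≤ r →
    A.ncard ≤ c * {a ∈ A | ((a : Module.End ℂ V), (1 : ℂ)) ∈ L}.ncard →
    ∃ L' : Submodule ℂ (Module.End ℂ V × ℂ), finrank ℂ L' ≤ finrank ℂ L ∧
      (∃ a : (Module.End ℂ V)ˣ, ((a : Module.End ℂ V), (1 : ℂ)) ∈ L') ∧ Cov C A (stabL L') := by
  classical
  induction r with
  | zero =>
    intro c hc
    refine ⟨0, ?_⟩
    intro V _ _ _ A hA L hL hAL
    exfalso
    have h0 : L = ⊥ := Submodule.finrank_eq_zero.1 (by omega)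
    have : {a ∈ A | ((a : Module.End ℂ V), (1 : ℂ)) ∈ L} = ∅ := by
      ext a; simp [h0]
    rw [this] at hAL
    have := hA.ncard_pos
    simp at hAL
    omega
  | succ r ih =>
    intro c hc
    by_cases hK : K = 0
    · refine ⟨0, ?_⟩
      intro V _ _ _ A hA L hL hAL
      have := hA.one_le; omega
    obtain ⟨C, hC⟩ := ih (4 * (K * c) * c * K) (Nat.succ_le_of_lt (by positivity))
    refine ⟨2 * (K * c) + C, ?_⟩
    intro V _ _ _ A hA L hL hAL
    set S := {a ∈ A | ((a : Module.End ℂ V), (1 : ℂ)) ∈ L} with hS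
    have hSA : S ⊆ A := fun a ha => ha.1
    have hSf : S.Finite := hA.fin.subset hSA
    have hSne : S.Nonempty := by
      rw [← Set.ncard_pos hSf]
      have := hA.ncard_pos
      by_contra h
      have : S.ncard = 0 := by omega
      rw [this] at hAL; omega
    by_cases hcov : ((fun a => tr a L) '' A).ncard < 2 * (K * c)
    · refine ⟨L, le_rfl, ⟨_, hSne.some_mem.2⟩, ?_⟩
      refine Cov.mono (C := 2 * (K * c)) ?_ (by omega) subset_rfl subset_rfl
      refine Cov.of_finite_image (fun a => tr a L) (hA.fin.image _) hcov.le
        (fun s hs => Set.mem_image_of_mem _ hs) ?_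
      intro s _ t _ (hst : tr s L = tr t L)
      change tr (s⁻¹ * t) L = L
      rw [tr_mul, ← hst, ← tr_mul, inv_mul_cancel, tr_one]
    · rw [not_lt] at hcov
      obtain ⟨T0, hT0, hT0c⟩ := Set.exists_subset_card_eq hcov
      have hT0f : T0.Finite := (hA.fin.image _).subset hT0
      choose! f hf using fun t (ht : t ∈ T0) => hT0 ht
      have hfinj : Set.InjOn f T0 := by
        intro s hs t ht hst
        rw [← (hf s hs).2, ← (hf t ht).2, hst]
      have w1 : ∀ t ∈ hT0f.toFinset, hSf.toFinset.image (fun x => f t * x) ⊆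
          (hA.fin_pow 2).toFinset := by
        intro t ht x hx
        rw [Set.Finite.mem_toFinset] at ht ⊢
        obtain ⟨u, hu, rfl⟩ := Finset.mem_image.1 hx
        rw [pow_two]
        exact Set.mul_mem_mul (hf t ht).1 (hSA (hSf.mem_toFinset.1 hu))
      have w2 : ∀ t ∈ hT0f.toFinset, (hSf.toFinset.image (fun x => f t * x)).card = S.ncard := by
        intro t ht
        rw [Finset.card_image_of_injective _ (mul_right_injective _), Set.ncard_eq_toFinset_card _ hSf]
      have w3 : (hA.fin_pow 2).toFinset.card ≤ K * c * S.ncard := by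
        rw [← Set.ncard_eq_toFinset_card _ (hA.fin_pow 2)]
        have := hA.ncard_pow 1
        rw [pow_one] at this
        calc _ ≤ K * A.ncard := this
          _ ≤ K * (c * S.ncard) := Nat.mul_le_mul_left _ hAL
          _ = _ := by ring
      have w4 : hT0f.toFinset.card = 2 * (K * c) := by
        rw [← Set.ncard_eq_toFinset_card _ hT0f, hT0c]
      obtain ⟨a, ha, b, hb, hab, hlarge⟩ := exists_large_inter (hT0f.toFinset)
        (fun t => hSf.toFinset.image (fun x => f t * x)) (hA.fin_pow 2).toFinset
        (Nat.succ_le_of_lt (by positivity)) w1 w2 w3 w4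
      rw [Set.Finite.mem_toFinset] at ha hb
      set F := Finset.image (fun x => f a * x) hSf.toFinset ∩
        Finset.image (fun x => f b * x) hSf.toFinset with hF
      have hFA : ∀ x ∈ F, x ∈ A ^ 2 ∧ ((x : Module.End ℂ V), (1 : ℂ)) ∈ tr (f a) L ⊓ tr (f b) L := by
        intro x hx
        obtain ⟨hx1, hx2⟩ := Finset.mem_inter.1 hx
        obtain ⟨u, hu, rfl⟩ := Finset.mem_image.1 hx1
        obtain ⟨v, hv, hv'⟩ := Finset.mem_image.1 hx2
        rw [Set.Finite.mem_toFinset] at hu hv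
        refine ⟨by rw [pow_two]; exact Set.mul_mem_mul (hf a ha).1 hu.1, ?_, ?_⟩
        · rw [SetLike.mem_coe, mem_tr]
          simpa using hu.2
        · rw [SetLike.mem_coe, mem_tr]
          rw [← hv']
          simpa using hv.2
      have hFc : Cov K (F : Set (Module.End ℂ V)ˣ) A :=
        hA.cov.mono le_rfl (fun x hx => by rw [← pow_two]; exact (hFA x hx).1) subset_rfl
      obtain ⟨y, hyF⟩ := hFc.exists_heavy F.finite_toSet
      rw [Set.ncard_coe_finset] at hyF
      set L1 := tr y⁻¹ (tr (f a) L ⊓ tr (f b) L) with hL1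
      have hlt : finrank ℂ L1 < finrank ℂ L := by
        refine lt_of_le_of_lt (finrank_tr_le _ _) ?_
        by_contra h
        rw [not_lt] at h
        have e1 : tr (f a) L ⊓ tr (f b) L = tr (f a) L :=
          Submodule.eq_of_le_of_finrank_le inf_le_left ((finrank_tr_le _ _).trans h)
        have e2 : tr (f a) L ⊓ tr (f b) L = tr (f b) L :=
          Submodule.eq_of_le_of_finrank_le inf_le_right ((finrank_tr_le _ _).trans h)
        apply hab
        rw [← (hf a ha).2, ← (hf b hb).2]
        exact e1.symm.trans e2
      have hcard : {x ∈ A | y * x ∈ (F : Set (Module.End ℂ V)ˣ)}.ncard ≤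
          {a ∈ A | ((a : Module.End ℂ V), (1 : ℂ)) ∈ L1}.ncard := by
        refine Set.ncard_le_ncard ?_ (hA.fin.subset fun a ha => ha.1)
        rintro x ⟨hx1, hx2⟩
        refine ⟨hx1, ?_⟩
        rw [hL1, mem_tr]
        simpa using (hFA _ hx2).2
      obtain ⟨L', h1, h2, h3⟩ := hC V A hA L1 (by omega) (by
        calc A.ncard ≤ c * S.ncard := hAL
          _ ≤ c * (4 * (K * c) * (K * {a ∈ A | ((a : Module.End ℂ V), (1 : ℂ)) ∈ L1}.ncard)) := by
            refine Nat.mul_le_mul_left _ (hlarge.trans (Nat.mul_le_mul_left _ (hyF.trans ?_)))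
            exact Nat.mul_le_mul_left _ hcard
          _ = _ := by ring)
      exact ⟨L', by omega, h2, h3.mono (by omega) subset_rfl subset_rfl⟩

lemma exists_kernel_of_leftIdeal [FiniteDimensional ℂ V] (L : Submodule ℂ (Module.End ℂ V))
    (hL : L ≠ ⊤) (h : ∀ x : Module.End ℂ V, ∀ w ∈ L, x * w ∈ L) :
    ∃ k : V, k ≠ 0 ∧ ∀ w ∈ L, w k = 0 := by
  by_contra! hk
  let b := Module.finBasis ℂ L
  let f : V →ₗ[ℂ] (Fin (finrank ℂ L) → V) := LinearMap.pi fun i => (b i : Module.End ℂ V)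
  have hf : LinearMap.ker f = ⊥ := by
    rw [LinearMap.ker_eq_bot']
    intro k hk0
    by_contra hne
    obtain ⟨w, hw, hwk⟩ := hk k hne
    apply hwk
    have h1 : (⟨w, hw⟩ : L) = ∑ i, b.repr ⟨w, hw⟩ i • b i := (b.sum_repr _).symm
    have h2 : w = ∑ i, b.repr ⟨w, hw⟩ i • (b i : Module.End ℂ V) := by
      have h3 := congrArg L.subtype h1
      rw [map_sum] at h3
      exact h3
    rw [h2, LinearMap.sum_apply]
    refine Finset.sum_eq_zero fun i _ => ?_
    have h3 : (b i : Module.End ℂ V) k = 0 := congrFun hk0 i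
    rw [LinearMap.smul_apply, h3, smul_zero]
  obtain ⟨g, hg⟩ := f.exists_leftInverse_of_injective hf
  have h1 : (1 : Module.End ℂ V) ∈ L := by
    have h2 : (1 : Module.End ℂ V) =
        ∑ i, (g ∘ₗ LinearMap.single ℂ (fun _ => V) i : Module.End ℂ V) * (b i : Module.End ℂ V) := by
      refine LinearMap.ext fun v => ?_
      have h3 : g (f v) = v := LinearMap.congr_fun hg v
      rw [LinearMap.sum_apply]
      simp only [Module.End.mul_apply, LinearMap.comp_apply, LinearMap.single_apply]
      rw [← map_sum, Module.End.one_apply]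
      conv_lhs => rw [← h3]
      congr 1
      exact (Finset.univ_sum_single (f v)).symm
    rw [h2]
    exact Submodule.sum_mem _ fun i _ => h _ _ (b i).2
  apply hL
  rw [eq_top_iff]
  intro x _
  simpa using h x 1 h1

/-- Approximate groups with many elements on a proper affine subspace. -/
lemma triCov_of_heavy {n : ℕ} (hT : TBelow n) (hn : 2 ≤ n) (K c : ℕ) : ∃ C : ℕ, ∀ (V : Type)
    [AddCommGroup V] [Module ℂ V] [FiniteDimensional ℂ V], finrank ℂ V = n →
    ∀ A : Set (Module.End ℂ V)ˣ, IsApx K A → ∀ L : Submodule ℂ (Module.End ℂ V × ℂ), L ≠ ⊤ →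
    A.ncard ≤ c * {a ∈ A | ((a : Module.End ℂ V), (1 : ℂ)) ∈ L}.ncard → TriCov C A := by
  obtain ⟨C0, hC0⟩ := exists_stabL K (n * n + 1) (c + 1) (by omega)
  obtain ⟨C1, hC1⟩ := triCov_of_cov_nz hT K C0
  obtain ⟨C2, hC2⟩ := triCov_of_cov_stab hT K C0
  refine ⟨C0 + C1 + C2, ?_⟩
  intro V _ _ _ hV A hA L hL hAL
  have hfin : finrank ℂ (Module.End ℂ V × ℂ) = n * n + 1 := by
    rw [Module.finrank_prod, Module.finrank_linearMap, hV, Module.finrank_self]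
  obtain ⟨L', h1, ⟨a0, ha0⟩, h3⟩ := hC0 V A hA L (hfin ▸ Submodule.finrank_le L)
    (hAL.trans (Nat.mul_le_mul_right _ (by omega)))
  have hL' : L' ≠ ⊤ := by
    rintro rfl
    rw [finrank_top] at h1
    exact absurd (Submodule.finrank_lt hL) (not_lt.2 h1)
  let L0 : Submodule ℂ (Module.End ℂ V) := L'.comap (LinearMap.inl ℂ (Module.End ℂ V) ℂ)
  have mem_L0 : ∀ w, w ∈ L0 ↔ (w, (0 : ℂ)) ∈ L' := fun w => Iff.rfl
  have hL0 : L0 ≠ ⊤ := by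
    intro h
    apply hL'
    rw [eq_top_iff]
    rintro ⟨x, t⟩ _
    have h4 : x - t • (a0 : Module.End ℂ V) ∈ L0 := by rw [h]; trivial
    have := L'.add_mem (L'.smul_mem t ha0) ((mem_L0 _).1 h4)
    simpa using this
  let E : Subalgebra ℂ (Module.End ℂ V) :=
    { carrier := {e | ∀ w ∈ L0, e * w ∈ L0}
      mul_mem' := fun {a b} ha hb w hw => by rw [mul_assoc]; exact ha _ (hb w hw)
      one_mem' := fun w hw => by rwa [one_mul]
      add_mem' := fun {a b} ha hb w hw => by rw [add_mul]; exact L0.add_mem (ha w hw) (hb w hw)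
      zero_mem' := fun w _ => by rw [zero_mul]; exact L0.zero_mem
      algebraMap_mem' := fun c w hw => by
        rw [← Algebra.smul_def]; exact L0.smul_mem c hw }
  have key : ∀ a ∈ stabL L', ∀ x t, (x, t) ∈ L' → ((a : Module.End ℂ V) * x, t) ∈ L' := by
    intro a ha x t hx
    have ha' : tr a L' = L' := ha
    rw [← ha', mem_tr]
    simpa using hx
  have hSE : stabL L' ≤ U E := fun a ha => ⟨fun w hw => key a ha w 0 hw,
    fun w hw => key a⁻¹ ((stabL L').inv_mem ha) w 0 hw⟩
  by_cases hE1 : E = ⊥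
  · refine TriCov.of_bot ?_
    rw [← hE1]
    exact h3.mono (by omega) subset_rfl hSE
  by_cases hE2 : E = ⊤
  · obtain ⟨k, hk0, hk⟩ := exists_kernel_of_leftIdeal L0 hL0 (fun x w hw => by
      have : x ∈ E := by rw [hE2]; trivial
      exact this w hw)
    set v := (a0 : Module.End ℂ V) k with hv
    have hv0 : v ≠ 0 := by
      intro h
      apply hk0
      rw [← units_inv_apply a0 k, ← hv, h, map_zero]
    have hfix : ∀ a ∈ stabL L', (a : Module.End ℂ V) v = v := by
      intro a ha
      have h5 := L'.sub_mem (key a ha _ _ ha0) ha0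
      have h6 := hk ((a : Module.End ℂ V) * a0 - a0) (by
        rw [mem_L0]; simpa using h5)
      rw [LinearMap.sub_apply, sub_eq_zero] at h6
      exact h6
    have hst : stabL L' ≤ U (algStab (Submodule.span ℂ {v})) := by
      have : ∀ a ∈ stabL L', ∀ w ∈ Submodule.span ℂ {v},
          (a : Module.End ℂ V) w ∈ Submodule.span ℂ {v} := by
        intro a ha w hw
        obtain ⟨c, rfl⟩ := Submodule.mem_span_singleton.1 hw
        rw [map_smul, hfix a ha]
        exact hw
      exact fun a ha => ⟨this a ha, this a⁻¹ ((stabL L').inv_mem ha)⟩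
    refine (hC2 V hV A hA (Submodule.span ℂ {v}) ?_ ?_ (h3.mono le_rfl subset_rfl hst)).mono
      (by omega)
    · simpa using hv0
    · intro h
      have h7 := finrank_span_singleton (K := ℂ) hv0
      rw [h, finrank_top] at h7
      omega
  · exact (hC1 V hV A hA E hE1 hE2
      (h3.mono le_rfl subset_rfl (hSE.trans (U_le_nz E)))).mono (by omega)

/-- Approximate groups containing an element with few commuting elements. -/
lemma triCov_of_centr {n : ℕ} (hT : TBelow n) (hn : 2 ≤ n) (K m F : ℕ) : ∃ C : ℕ, ∀ (V : Type)
    [AddCommGroup V] [Module ℂ V] [FiniteDimensional ℂ V], finrank ℂ V = n →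
    ∀ A : Set (Module.End ℂ V)ˣ, IsApx K A → ∀ z ∈ A ^ m,
    (A ^ 2 ∩ U (centr (z : Module.End ℂ V)) : Set (Module.End ℂ V)ˣ).ncard ≤ F → TriCov C A := by
  obtain ⟨C, hC⟩ := triCov_of_heavy hT hn K (F * K ^ (m + 1))
  refine ⟨C, ?_⟩
  intro V _ _ _ hV A hA z hz hF
  set P := (fun a => a * z * a⁻¹) '' A with hP
  have hPf : P.Finite := hA.fin.image _
  have h1 : Cov P.ncard A (U (centr (z : Module.End ℂ V))) := by
    refine Cov.of_finite_image (fun a => a * z * a⁻¹) hPf le_rfl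
      (fun a ha => Set.mem_image_of_mem _ ha) ?_
    intro s _ t _ hst
    rw [mem_U_centr]
    have h2 : s * z * s⁻¹ = t * z * t⁻¹ := hst
    calc z * (s⁻¹ * t) = s⁻¹ * (s * z * s⁻¹) * t := by group
      _ = s⁻¹ * t * z := by rw [h2]; group
  have h2 := h1.card_le hA.fin
  rw [hA.inv_eq, ← pow_two] at h2
  have hPA : P ⊆ A ^ (m + 1 + 1) := by
    rintro _ ⟨a, ha, rfl⟩
    have e1 : a ∈ A ^ 1 := by simpa using ha
    have := hA.mul_pow (hA.mul_pow e1 hz) (hA.inv_pow e1)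
    rwa [show 1 + m + 1 = m + 1 + 1 by omega] at this
  have h3 : Cov (K ^ (m + 1)) P A := (hA.cov_pow (m + 1)).mono le_rfl hPA subset_rfl
  obtain ⟨y, hy⟩ := h3.exists_heavy hPf
  let l : Module.End ℂ V × ℂ →ₗ[ℂ] ℂ :=
    (LinearMap.trace ℂ V ∘ₗ LinearMap.mulLeft ℂ (y : Module.End ℂ V)) ∘ₗ LinearMap.fst ℂ _ _ -
      (LinearMap.trace ℂ V (z : Module.End ℂ V)) • LinearMap.snd ℂ _ _
  have hl : ∀ x t, l (x, t) = LinearMap.trace ℂ V ((y : Module.End ℂ V) * x) -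
    LinearMap.trace ℂ V (z : Module.End ℂ V) * t := fun x t => rfl
  refine hC V hV A hA (LinearMap.ker l) ?_ ?_
  · intro h
    have h4 : (((y⁻¹ : (Module.End ℂ V)ˣ) : Module.End ℂ V), (0 : ℂ)) ∈ LinearMap.ker l := by
      rw [h]; trivial
    rw [LinearMap.mem_ker, hl] at h4
    rw [Units.mul_inv, LinearMap.trace_one, hV] at h4
    simp at h4
    omega
  · calc A.ncard ≤ P.ncard * F := h2.trans (Nat.mul_le_mul_left _ hF)
      _ ≤ K ^ (m + 1) * {x ∈ A | y * x ∈ P}.ncard * F := Nat.mul_le_mul_right _ hy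
      _ ≤ K ^ (m + 1) * {a ∈ A | ((a : Module.End ℂ V), (1 : ℂ)) ∈ LinearMap.ker l}.ncard * F := by
        refine Nat.mul_le_mul_right _ (Nat.mul_le_mul_left _ (Set.ncard_le_ncard ?_
          (hA.fin.subset fun a ha => ha.1)))
        rintro x ⟨hx1, a, ha, hx2⟩
        refine ⟨hx1, ?_⟩
        have hx3 : (y : Module.End ℂ V) * x = a * z * ((a⁻¹ : (Module.End ℂ V)ˣ)) := by
          have := congrArg Units.val hx2
          simpa using this.symm
        rw [LinearMap.mem_ker, hl, hx3, LinearMap.trace_mul_comm, ← mul_assoc, Units.inv_mul]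
        simp
      _ = _ := by ring

end Heavy

section MinMod

variable {V : Type} [AddCommGroup V] [Module ℂ V] {n : ℕ} {b : Module.Basis (Fin n) ℂ V}

/-- The ratio of two diagonal entries. -/
noncomputable def diagRatio (b : Module.Basis (Fin n) ℂ V) (i j : Fin n) (h : (Module.End ℂ V)ˣ) :
    ℂ := ent b (h : Module.End ℂ V) i i * (ent b (h : Module.End ℂ V) j j)⁻¹

lemma card_le_of_classes {κ : Type*} {s : Finset ℂ} (Y : Finset κ) (R : ℂ → κ → Prop)
    (h1 : ∀ c ∈ s, ∃ y ∈ Y, R c y) (h2 : ∀ c ∈ s, ‖c‖ ≤ 1)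
    (h3 : ∀ y, ∀ c ∈ s, ∀ d ∈ s, R c y → R d y → c ≠ d → 1 ≤ ‖c - d‖) :
    s.card ≤ 25 * Y.card := by
  classical
  rcases isEmpty_or_nonempty κ with hκ | hκ
  · rcases s.eq_empty_or_nonempty with rfl | ⟨c, hc⟩
    · simp
    · exact (hκ.false (h1 c hc).choose).elim
  choose! f hfY hf using h1
  refine Finset.card_le_mul_card_image_of_maps_to hfY 25 fun y _ => ?_
  have := Besicovitch.card_le_of_separated (s.filter fun c => f c = y)
    (fun c hc => (h2 c (Finset.mem_filter.1 hc).1).trans (by norm_num)) (by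
      intro c hc d hd hcd
      rw [Finset.mem_filter] at hc hd
      exact h3 y c hc.1 d hd.1 (hc.2 ▸ hf c hc.1) (hd.2 ▸ hf d hd.1) hcd)
  rwa [Complex.finrank_real_complex] at this

/-- A nontrivial superdiagonal entry forces almost all elements to have equal corresponding diagonal
entries. -/
lemma cov_triEq {K : ℕ} {A : Set (Module.End ℂ V)ˣ} (hA : IsApx K A)
    {H : Subgroup (Module.End ℂ V)ˣ} (hH : H ≤ U (tri b)) {e m : ℕ} (he : 1 ≤ e) (hm : 4 ≤ m)
    {i j : Fin n} (hij : (j : ℕ) = i + e) {y : (Module.End ℂ V)ˣ} (hyA : y ∈ A ^ m) (hyH : y ∈ H)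
    (hyN : y ∈ NN b e) (hy : ent b (y : Module.End ℂ V) i j ≠ 0) :
    Cov (50 * K ^ (m + 3)) (A ^ 2 ∩ H) (U (triEq b i j)) := by
  classical
  let P : Set (Module.End ℂ V)ˣ :=
    {y | y ∈ A ^ m ∧ y ∈ H ∧ y ∈ NN b e ∧ ent b (y : Module.End ℂ V) i j ≠ 0}
  have hP : P.Finite := (hA.fin_pow m).subset fun x hx => hx.1
  obtain ⟨y0, ⟨hy0A, hy0H, hy0N, hy0⟩, hmin⟩ :=
    Set.exists_min_image P (fun y => ‖ent b (y : Module.End ℂ V) i j‖) hP ⟨y, hyA, hyH, hyN, hy⟩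
  have hS : (A ^ 2 ∩ H : Set (Module.End ℂ V)ˣ).Finite :=
    (hA.fin_pow 2).subset Set.inter_subset_left
  let Λ : Finset ℂ := hS.toFinset.image (diagRatio b i j)
  let Λ1 := Λ.filter fun c => ‖c‖ ≤ 1
  have hΛ : ∀ c, c ∈ Λ ↔ ∃ h, (h ∈ A ^ 2 ∧ h ∈ H) ∧ diagRatio b i j h = c := by
    intro c
    simp [Λ]
  obtain ⟨Y, hY, hYc⟩ := hA.pow_inter (m + 3) (H ⊓ NN b e)
  have hconj : ∀ h, h ∈ A ^ 2 → h ∈ H → h * y0 * h⁻¹ ∈ A ^ (m + 3 + 1) ∧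
      h * y0 * h⁻¹ ∈ H ⊓ NN b e ∧ ent b ((h * y0 * h⁻¹ : (Module.End ℂ V)ˣ) : Module.End ℂ V) i j =
        diagRatio b i j h * ent b (y0 : Module.End ℂ V) i j := by
    intro h hh hhH
    refine ⟨?_, ⟨H.mul_mem (H.mul_mem hhH hy0H) (H.inv_mem hhH), NN_conj (hH hhH) hy0N⟩,
      ent_conj he (hH hhH) hy0N hij⟩
    have := hA.mul_pow (hA.mul_pow hh hy0A) (hA.inv_pow hh)
    rwa [show 2 + m + 2 = m + 3 + 1 by ring] at this
  have h25 : Λ1.card ≤ 25 * Y.card := by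
    refine card_le_of_classes Y (fun c y => ∃ h, (h ∈ A ^ 2 ∧ h ∈ H) ∧ diagRatio b i j h = c ∧
      y⁻¹ * (h * y0 * h⁻¹) ∈ A ^ 2 ∩ ((H ⊓ NN b e : Subgroup _) : Set (Module.End ℂ V)ˣ)) ?_ ?_ ?_
    · intro c hc
      obtain ⟨h, hh, rfl⟩ := (hΛ c).1 (Finset.mem_filter.1 hc).1
      obtain ⟨h1, h2, -⟩ := hconj h hh.1 hh.2
      obtain ⟨y, hy, hy'⟩ := hYc _ ⟨h1, h2⟩
      exact ⟨y, hy, h, hh, rfl, hy'⟩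
    · exact fun c hc => (Finset.mem_filter.1 hc).2
    · rintro y _ - _ - ⟨h, hh, rfl, h1, h1'⟩ ⟨k, hk, rfl, h2, h2'⟩ hne
      set z := (y⁻¹ * (h * y0 * h⁻¹))⁻¹ * (y⁻¹ * (k * y0 * k⁻¹)) with hz
      have hz1 : z ∈ A ^ 4 := hA.mul_pow (m := 2) (k := 2) (hA.inv_pow h1) h2
      have hz2 : z ∈ H ⊓ NN b e := (H ⊓ NN b e).mul_mem ((H ⊓ NN b e).inv_mem h1') h2'
      have hz3 : h * y0 * h⁻¹ * z = k * y0 * k⁻¹ := by rw [hz]; group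
      have hz4 : ent b (z : Module.End ℂ V) i j =
          (diagRatio b i j k - diagRatio b i j h) * ent b (y0 : Module.End ℂ V) i j := by
        have := ent_NN_mul he (hconj h hh.1 hh.2).2.1.2 hz2.2 hij
        rw [hz3, (hconj h hh.1 hh.2).2.2, (hconj k hk.1 hk.2).2.2] at this
        rw [sub_mul, this]; ring
      have hz5 := hmin z ⟨hA.pow_mono hm hz1, hz2.1, hz2.2, by
        rw [hz4]; exact mul_ne_zero (sub_ne_zero.2 (Ne.symm hne)) hy0⟩
      simp only [hz4, norm_mul] at hz5
      rw [norm_sub_rev]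
      exact (le_mul_iff_one_le_left (norm_pos_iff.2 hy0)).1 hz5
  have hΛc : Λ ⊆ Λ1 ∪ Λ1.image (·⁻¹) := by
    intro c hc
    rw [Finset.mem_union]
    by_cases h : ‖c‖ ≤ 1
    · exact Or.inl (Finset.mem_filter.2 ⟨hc, h⟩)
    · right
      refine Finset.mem_image.2 ⟨c⁻¹, Finset.mem_filter.2 ⟨?_, ?_⟩, inv_inv c⟩
      · obtain ⟨k, hh, rfl⟩ := (hΛ c).1 hc
        refine (hΛ _).2 ⟨k⁻¹, ⟨hA.inv_pow hh.1, H.inv_mem hh.2⟩, ?_⟩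
        rw [diagRatio, diagRatio, ent_diag_inv (hH hh.2), ent_diag_inv (hH hh.2), mul_inv]
      · rw [norm_inv]
        exact inv_le_one_of_one_le₀ (not_le.1 h).le
  have hcard : Λ.card ≤ 50 * K ^ (m + 3) := by
    have h1 := (Finset.card_le_card hΛc).trans (Finset.card_union_le _ _)
    have h2 : (Λ1.image (·⁻¹)).card ≤ Λ1.card := Finset.card_image_le
    omega
  refine Cov.of_finite_image (diagRatio b i j) (T := (Λ : Set ℂ)) Λ.finite_toSet
    (by rwa [Set.ncard_coe_finset]) (fun s hs => (hΛ _).2 ⟨s, hs, rfl⟩) ?_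
  intro s hs t ht hst
  have hs' := hH hs.2
  have ht' := hH ht.2
  have hu := (U (tri b)).mul_mem ((U (tri b)).inv_mem hs') ht'
  have key : ∀ s t : (Module.End ℂ V)ˣ, s ∈ U (tri b) → t ∈ U (tri b) →
      diagRatio b i j s = diagRatio b i j t →
      ((s⁻¹ * t : (Module.End ℂ V)ˣ) : Module.End ℂ V) ∈ triEq b i j := by
    intro s t hs' ht' hst
    have hu := (U (tri b)).mul_mem ((U (tri b)).inv_mem hs') ht'
    refine mem_triEq.2 ⟨(mem_U.1 hu).1, ?_⟩
    have a1 := ent_diag_ne_zero hs' i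
    have a2 := ent_diag_ne_zero hs' j
    have a3 := ent_diag_ne_zero ht' j
    rw [Units.val_mul, ent_mul_diag (mem_U.1 hs').2 (mem_U.1 ht').1,
      ent_mul_diag (mem_U.1 hs').2 (mem_U.1 ht').1, ent_diag_inv hs', ent_diag_inv hs']
    rw [diagRatio, diagRatio] at hst
    field_simp at hst ⊢
    linear_combination -hst
  refine mem_U.2 ⟨key s t hs' ht' hst, ?_⟩
  rw [mul_inv_rev, inv_inv]
  have := key t s ht' hs' hst.symm
  exact this

end MinMod

section Jordan

variable {V : Type} [AddCommGroup V] [Module ℂ V] [FiniteDimensional ℂ V]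

/-- A finite linear group preserves a norm on `Module.End ℂ V` from both sides. -/
lemma exists_invariant_norm (Γ : Subgroup (Module.End ℂ V)ˣ) [Finite Γ] :
    ∃ (F : Type) (_ : NormedAddCommGroup F) (_ : NormedSpace ℂ F) (f : Module.End ℂ V ≃ₗ[ℂ] F),
      ∀ x : Module.End ℂ V, ∀ g ∈ Γ, ‖f (g * x)‖ = ‖f x‖ ∧ ‖f (x * g)‖ = ‖f x‖ := by
  classical
  have : Fintype Γ := Fintype.ofFinite Γ
  let b := Module.finBasis ℂ V
  let f0 : Module.End ℂ V →ₗ[ℂ] (Γ × Γ → Fin (finrank ℂ V) → Fin (finrank ℂ V) → ℂ) :=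
    { toFun := fun x p i j => ent b (((p.1 : (Module.End ℂ V)ˣ) : Module.End ℂ V) * x *
        ((p.2 : (Module.End ℂ V)ˣ) : Module.End ℂ V)) i j
      map_add' := by
        intro x y
        funext p i j
        simp only [mul_add, add_mul, ent_add, Pi.add_apply]
      map_smul' := by
        intro c x
        funext p i j
        simp only [mul_smul_comm, smul_mul_assoc, ent_smul, Pi.smul_apply, RingHom.id_apply,
          smul_eq_mul] }
  have hf0 : ∀ x p i j, f0 x p i j = ent b (((p.1 : (Module.End ℂ V)ˣ) : Module.End ℂ V) * x *
        ((p.2 : (Module.End ℂ V)ˣ) : Module.End ℂ V)) i j := fun _ _ _ _ => rfl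
  have hinj : Function.Injective f0 := by
    intro x y hxy
    refine ent_ext b fun i j => ?_
    have := congrFun (congrFun (congrFun hxy (1, 1)) i) j
    simpa [hf0] using this
  have key : ∀ (g h : Γ) x, ‖f0 (((g : (Module.End ℂ V)ˣ) : Module.End ℂ V) * x *
      ((h : (Module.End ℂ V)ˣ) : Module.End ℂ V))‖ ≤ ‖f0 x‖ := by
    intro g h x
    refine (pi_norm_le_iff_of_nonneg (norm_nonneg _)).2 fun p => ?_
    refine le_trans (le_of_eq ?_) (norm_le_pi_norm (f0 x) (p.1 * g, h * p.2))
    congr 1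
  refine ⟨LinearMap.range f0, inferInstance, inferInstance, LinearEquiv.ofInjective f0 hinj, ?_⟩
  intro x g hg
  have hn : ∀ x, ‖LinearEquiv.ofInjective f0 hinj x‖ = ‖f0 x‖ := fun x => rfl
  simp only [hn]
  refine ⟨le_antisymm ?_ ?_, le_antisymm ?_ ?_⟩
  · simpa using key ⟨g, hg⟩ 1 x
  · simpa [← mul_assoc] using key ⟨g, hg⟩⁻¹ 1 (g * x)
  · simpa using key 1 ⟨g, hg⟩ x
  · simpa [mul_assoc] using key 1 ⟨g, hg⟩⁻¹ (x * g)

/-- A quantitative form of Jordan's theorem. -/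
lemma triCov_of_finite {n : ℕ} (hT : TBelow n) (K : ℕ) : ∃ C : ℕ, ∀ (V : Type) [AddCommGroup V]
    [Module ℂ V] [FiniteDimensional ℂ V], finrank ℂ V = n → ∀ A : Set (Module.End ℂ V)ˣ,
    IsApx K A → (Subgroup.closure A : Set (Module.End ℂ V)ˣ).Finite → TriCov C A := by
  classical
  obtain ⟨C, hC⟩ := triCov_of_cov_nz hT K (5 ^ (2 * (n * n)) * K ^ 3)
  refine ⟨C + 1, ?_⟩
  intro V _ _ _ hV A hA hfin
  by_cases hsc : ∀ h ∈ A ^ 2, (h : Module.End ℂ V) ∈ (⊥ : Subalgebra ℂ (Module.End ℂ V))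
  · refine TriCov.of_bot ((Cov.of_subset (H := (U (⊥ : Subalgebra ℂ (Module.End ℂ V)) :
      Set (Module.End ℂ V)ˣ)) ?_).mono (by omega) subset_rfl subset_rfl)
    intro a ha
    have h2 : A ⊆ A ^ 2 := hA.subset_pow two_ne_zero
    exact mem_U.2 ⟨hsc _ (h2 ha), hsc _ (h2 (hA.inv a ha))⟩
  have : Finite (Subgroup.closure A) := hfin
  obtain ⟨F, _, _, f, hf⟩ := exists_invariant_norm (Subgroup.closure A)
  have : FiniteDimensional ℂ F := f.finiteDimensional
  have hclos : ∀ m, A ^ m ⊆ (Subgroup.closure A : Set (Module.End ℂ V)ˣ) := by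
    intro m
    induction m with
    | zero => simp
    | succ m ih =>
      rw [pow_succ]
      rintro _ ⟨a, ha, c, hc, rfl⟩
      exact Subgroup.mul_mem _ (ih ha) (Subgroup.subset_closure hc)
  let P : Set (Module.End ℂ V)ˣ :=
    {h | h ∈ A ^ 2 ∧ (h : Module.End ℂ V) ∉ (⊥ : Subalgebra ℂ (Module.End ℂ V))}
  have hP : P.Finite := (hA.fin_pow 2).subset fun x hx => hx.1
  push Not at hsc
  obtain ⟨h0, h0A, h0b⟩ := hsc
  obtain ⟨h, ⟨hhA, hhb⟩, hmin⟩ :=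
    Set.exists_min_image P (fun h => ‖f ((h : Module.End ℂ V) - 1)‖) hP ⟨h0, h0A, h0b⟩
  set r := ‖f ((h : Module.End ℂ V) - 1)‖ with hr
  have hr0 : 0 < r := by
    rw [hr, norm_pos_iff, Ne, LinearEquiv.map_eq_zero_iff, sub_eq_zero]
    intro h1
    exact hhb (h1 ▸ one_mem _)
  have hconj : ∀ a ∈ A, ‖f (((a * h * a⁻¹ : (Module.End ℂ V)ˣ) : Module.End ℂ V) - 1)‖ = r := by
    intro a ha
    have haΓ := Subgroup.subset_closure (k := A) ha
    have e1 : ((a * h * a⁻¹ : (Module.End ℂ V)ˣ) : Module.End ℂ V) - 1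
        = a * ((h : Module.End ℂ V) - 1) * ((a⁻¹ : (Module.End ℂ V)ˣ) : Module.End ℂ V) := by
      rw [mul_sub, sub_mul]; simp
    rw [e1, (hf _ _ (Subgroup.inv_mem _ haΓ)).2, (hf _ _ haΓ).1]
  have hcA : ∀ a ∈ A, a * h * a⁻¹ ∈ A ^ 4 := by
    intro a ha
    have := hA.mul_pow (hA.mul_pow (m := 1) (by simpa using ha) hhA)
      (k := 1) (by simpa using hA.inv _ ha)
    simpa using this
  obtain ⟨Y, hY, hYc⟩ := hA.cov_pow 3
  let orb : Finset (Subalgebra ℂ (Module.End ℂ V)) :=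
    hA.fin.toFinset.image fun a => cj a (centr (h : Module.End ℂ V))
  have horb : ∀ E ∈ orb, ∃ a ∈ A, ∃ y ∈ Y, y⁻¹ * (a * h * a⁻¹) ∈ A ∧
      centr ((a * h * a⁻¹ : (Module.End ℂ V)ˣ) : Module.End ℂ V) = E := by
    intro E hE
    obtain ⟨a, ha, rfl⟩ := Finset.mem_image.1 hE
    rw [Set.Finite.mem_toFinset] at ha
    obtain ⟨y, hy, hy'⟩ := hYc _ (hcA a ha)
    exact ⟨a, ha, y, hy, hy', (cj_centr a h).symm⟩
  have hcard : orb.card ≤ 5 ^ (2 * (n * n)) * K ^ 3 := by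
    choose! a haA y hyY hyA hE using horb
    refine (Finset.card_le_mul_card_image_of_maps_to hyY (5 ^ (2 * (n * n))) fun z _ => ?_).trans
      (Nat.mul_le_mul_left _ hY)
    let v : Subalgebra ℂ (Module.End ℂ V) → F := fun E =>
      (r⁻¹ : ℝ) • f (((a E * h * (a E)⁻¹ : (Module.End ℂ V)ˣ) : Module.End ℂ V) - 1)
    have hsep : ∀ E ∈ orb, ∀ E' ∈ orb, y E = z → y E' = z → E ≠ E' → 1 ≤ ‖v E - v E'‖ := by
      intro E hEo E' hEo' hy1 hy2 hne
      have e1 : v E - v E' = (r⁻¹ : ℝ) • f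
          (((a E * h * (a E)⁻¹ : (Module.End ℂ V)ˣ) : Module.End ℂ V) -
            ((a E' * h * (a E')⁻¹ : (Module.End ℂ V)ˣ) : Module.End ℂ V)) := by
        simp only [v]
        rw [← smul_sub, ← map_sub, sub_sub_sub_cancel_right]
      rw [e1, norm_smul, norm_inv, Real.norm_of_nonneg hr0.le, le_inv_mul_iff₀ hr0, mul_one]
      set u := a E * h * (a E)⁻¹ with hu
      set u' := a E' * h * (a E')⁻¹ with hu'
      have hw : u'⁻¹ * u ∈ A ^ 2 := by
        have e2 : u'⁻¹ * u = (z⁻¹ * u')⁻¹ * (z⁻¹ * u) := by group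
        rw [e2, pow_two]
        refine Set.mul_mem_mul (hA.inv _ ?_) ?_
        · have := hyA E' hEo'
          rwa [hy2] at this
        · have := hyA E hEo
          rwa [hy1] at this
      have hw' : ((u'⁻¹ * u : (Module.End ℂ V)ˣ) : Module.End ℂ V) ∉
          (⊥ : Subalgebra ℂ (Module.End ℂ V)) := by
        intro hb
        obtain ⟨c, hc⟩ := mem_bot.1 hb
        apply hne
        rw [← hE E hEo, ← hE E' hEo']
        have e3 : (u : Module.End ℂ V) = c • (u' : Module.End ℂ V) := by
          have : (u : Module.End ℂ V) = u' * ((u'⁻¹ * u : (Module.End ℂ V)ˣ) : Module.End ℂ V) := by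
            rw [← Units.val_mul, mul_inv_cancel_left]
          rw [this, hc, mul_smul_comm, mul_one]
        have hc0 : c ≠ 0 := by
          rintro rfl
          rw [zero_smul] at hc
          have : Nontrivial (Module.End ℂ V) := ⟨⟨(h : Module.End ℂ V), 1, fun h1 => hhb (h1 ▸ one_mem _)⟩⟩
          exact (u'⁻¹ * u).ne_zero hc
        ext x
        rw [← hu, ← hu', mem_centr, mem_centr, e3, smul_mul_assoc, mul_smul_comm]
        exact ⟨fun h => smul_right_injective _ hc0 h, fun h => by rw [h]⟩
      have := hmin _ ⟨hw, hw'⟩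
      refine this.trans (le_of_eq ?_)
      have e4 : (u : Module.End ℂ V) - u' =
          u' * (((u'⁻¹ * u : (Module.End ℂ V)ˣ) : Module.End ℂ V) - 1) := by
        rw [mul_sub, ← Units.val_mul, mul_inv_cancel_left, mul_one]
      rw [e4, (hf _ _ (hclos 4 (hcA _ (haA E' hEo')))).1]
    have hinj : Set.InjOn v ((orb.filter fun E => y E = z : Finset _) :
        Set (Subalgebra ℂ (Module.End ℂ V))) := by
      intro E hE1 E' hE2 hv
      rw [Finset.mem_coe, Finset.mem_filter] at hE1 hE2
      by_contra hne
      have := hsep E hE1.1 E' hE2.1 hE1.2 hE2.2 hne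
      rw [hv, sub_self, norm_zero] at this
      exact absurd this (by norm_num)
    rw [← Finset.card_image_of_injOn hinj]
    have hdim : finrank ℝ F = 2 * (n * n) := by
      rw [finrank_real_of_complex, ← f.finrank_eq, Module.finrank_linearMap, hV]
    rw [← hdim]
    refine Besicovitch.card_le_of_separated _ ?_ ?_
    · intro c hc
      obtain ⟨E, hE1, rfl⟩ := Finset.mem_image.1 hc
      rw [Finset.mem_filter] at hE1
      simp only [v]
      rw [norm_smul, norm_inv, Real.norm_of_nonneg hr0.le, hconj _ (haA E hE1.1),
        inv_mul_cancel₀ hr0.ne']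
      norm_num
    · intro c hc d hd hcd
      obtain ⟨E, hE1, rfl⟩ := Finset.mem_image.1 hc
      obtain ⟨E', hE2, rfl⟩ := Finset.mem_image.1 hd
      rw [Finset.mem_filter] at hE1 hE2
      refine hsep E hE1.1 E' hE2.1 hE1.2 hE2.2 ?_
      rintro rfl
      exact hcd rfl
  refine (hC V hV A hA (centr (h : Module.End ℂ V)) ?_ ?_ ?_).mono (by omega)
  · intro hb
    exact hhb (hb ▸ self_mem_centr _)
  · exact fun ht => hhb (centr_eq_top ht)
  · refine Cov.of_finite_image (fun a => cj a (centr (h : Module.End ℂ V)))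
      (T := (orb : Set (Subalgebra ℂ (Module.End ℂ V)))) orb.finite_toSet
      (by rwa [Set.ncard_coe_finset]) (fun s hs => ?_) ?_
    · exact Finset.mem_coe.2 (Finset.mem_image.2 ⟨s, by simpa using hs, rfl⟩)
    · intro s hs t ht hst
      rw [mem_nz, cj_mul, ← hst, cj_inv_cj]

/-- Approximate groups normalising, up to finite index, an algebra with a weight space. -/
lemma triCov_of_finite_orbit {n : ℕ} (hT : TBelow n) (hn : 0 < n) (K : ℕ) : ∃ C : ℕ,
    ∀ (V : Type) [AddCommGroup V]
    [Module ℂ V] [FiniteDimensional ℂ V], finrank ℂ V = n → ∀ A : Set (Module.End ℂ V)ˣ,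
    IsApx K A → (∀ a ∈ A, LinearMap.det (a : Module.End ℂ V) = 1) →
    ∀ (M : Subalgebra ℂ (Module.End ℂ V)) (W : Submodule ℂ V), M ≠ ⊥ → IsWt M W →
    {E | ∃ g ∈ Subgroup.closure A, E = cj g M}.Finite → TriCov C A := by
  obtain ⟨C1, hC1⟩ := triCov_of_nz hT K
  obtain ⟨C2, hC2⟩ := triCov_of_finite hT K
  refine ⟨C1 + C2, ?_⟩
  intro V _ _ _ hV A hA hdet M W hM hW hfin
  have : Nontrivial V := Module.nontrivial_of_finrank_pos (hV ▸ hn)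
  let 𝒲 : Set (Submodule ℂ V) := {W' | ∃ g ∈ Subgroup.closure A, IsWt (cj g M) W'}
  have h𝒲 : 𝒲.Finite := by
    refine (hfin.biUnion fun E _ => (isWt_finite E).1).subset ?_
    rintro W' ⟨g, hg, h⟩
    exact Set.mem_biUnion (x := cj g M) ⟨g, hg, rfl⟩ h
  have hW𝒲 : W ∈ 𝒲 := ⟨1, Subgroup.one_mem _, by rwa [cj_one]⟩
  have hinv : ∀ g ∈ Subgroup.closure A, ∀ W' ∈ 𝒲, gm g W' ∈ 𝒲 := by
    rintro g hg W' ⟨k, hk, h⟩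
    exact ⟨g * k, Subgroup.mul_mem _ hg hk, by rw [cj_mul]; exact h.gm g⟩
  let N : Subgroup (Module.End ℂ V)ˣ := Subgroup.closure A ⊓ ⨅ W' : 𝒲, U (algStab (W' : Submodule ℂ V))
  have hN : ∀ g, g ∈ N ↔ g ∈ Subgroup.closure A ∧ ∀ W' ∈ 𝒲, gm g W' = W' := by
    intro g
    simp only [N, Subgroup.mem_inf, Subgroup.mem_iInf, Subtype.forall, mem_stab_iff]
  let B : Subalgebra ℂ (Module.End ℂ V) := Algebra.adjoin ℂ (Units.val '' (N : Set (Module.End ℂ V)ˣ))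
  have hNB : ∀ g ∈ N, (g : Module.End ℂ V) ∈ B := fun g hg => Algebra.subset_adjoin ⟨g, hg, rfl⟩
  have hBtop : B ≠ ⊤ := by
    intro hB
    have hle : B ≤ algStab W := by
      refine Algebra.adjoin_le ?_
      rintro _ ⟨g, hg, rfl⟩
      exact (mem_U.1 (mem_stab_iff.2 (((hN g).1 hg).2 W hW𝒲))).1
    rw [hB, top_le_iff] at hle
    obtain ⟨w, hw, hw0⟩ := W.ne_bot_iff.1 hW.1
    apply hW.ne_top hM
    rw [eq_top_iff]
    intro v _
    obtain ⟨x, hx⟩ := LinearMap.exists_extend ((LinearEquiv.toSpanNonzeroSingleton ℂ V w hw0).symm.toLinearMap.smulRight v)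
    have hxw : x w = v := by
      have := LinearMap.congr_fun hx ⟨w, Submodule.mem_span_singleton_self w⟩
      simp only [LinearMap.comp_apply, Submodule.subtype_apply, LinearMap.smulRight_apply] at this
      rw [this]
      have h1 : (⟨w, Submodule.mem_span_singleton_self w⟩ : Submodule.span ℂ {w}) =
          LinearEquiv.toSpanNonzeroSingleton ℂ V w hw0 1 := by
        ext; simp
      rw [h1, LinearEquiv.coe_coe, LinearEquiv.symm_apply_apply, one_smul]
    rw [← hxw]
    exact (mem_algStab.1 (hle ▸ Algebra.mem_top : x ∈ algStab W)) w hw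
  have hBnz : A ⊆ nz B := by
    have key : ∀ a ∈ A, B ≤ cj a B := by
      intro a ha
      refine Algebra.adjoin_le ?_
      rintro _ ⟨g, hg, rfl⟩
      have haΓ := Subgroup.subset_closure (k := A) ha
      obtain ⟨hg1, hg2⟩ := (hN g).1 hg
      have : a⁻¹ * g * a ∈ N := by
        refine (hN _).2 ⟨Subgroup.mul_mem _ (Subgroup.mul_mem _ (Subgroup.inv_mem _ haΓ) hg1) haΓ, ?_⟩
        intro W' hW'
        rw [gm_mul, gm_mul, hg2 _ (hinv a haΓ W' hW'), ← gm_mul, inv_mul_cancel, gm_one]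
      rw [SetLike.mem_coe, mem_cj]
      simpa using hNB _ this
    exact fun a ha => mem_nz.2 (cj_eq_of_le (key a ha))
  by_cases hBbot : B = ⊥
  · refine (hC2 V hV A hA ?_).mono (by omega)
    have hdetΓ : ∀ g ∈ Subgroup.closure A, LinearMap.det (g : Module.End ℂ V) = 1 := by
      intro g hg
      have : Subgroup.closure A ≤ (Units.map (LinearMap.det : Module.End ℂ V →* ℂ)).ker := by
        rw [Subgroup.closure_le]
        intro a ha
        rw [SetLike.mem_coe, MonoidHom.mem_ker]
        ext
        exact hdet a ha
      have h1 := MonoidHom.mem_ker.1 (this hg)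
      simpa using congrArg Units.val h1
    have hNfin : (N : Set (Module.End ℂ V)ˣ).Finite := by
      refine finite_scalars.subset fun g hg => ?_
      exact ⟨hBbot ▸ hNB g hg, hdetΓ g ((hN g).1 hg).1⟩
    have : Finite 𝒲 := h𝒲
    have hcov : ∃ c, Cov c (Subgroup.closure A : Set (Module.End ℂ V)ˣ) N := by
      refine ⟨_, Cov.of_finite_image (fun g (W' : 𝒲) => gm g (W' : Submodule ℂ V))
        (T := Set.pi Set.univ fun _ => 𝒲) (Set.Finite.pi fun _ => h𝒲) le_rfl ?_ ?_⟩
      · exact fun g hg W' _ => hinv g hg W' W'.2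
      · intro s hs t ht hst
        refine (hN _).2 ⟨Subgroup.mul_mem _ (Subgroup.inv_mem _ hs) ht, fun W' hW' => ?_⟩
        have := congrFun hst ⟨W', hW'⟩
        simp only at this
        rw [gm_mul, ← this, ← gm_mul, inv_mul_cancel, gm_one]
    obtain ⟨c, Y, -, hY⟩ := hcov
    refine (Y.finite_toSet.mul hNfin).subset fun g hg => ?_
    obtain ⟨y, hy, hy'⟩ := hY g hg
    exact ⟨y, hy, _, hy', by group⟩
  · exact (hC1 V hV A hA B hBbot hBtop hBnz).mono (by omega)

end Jordan

section Internal

variable {G : Type*} [Group G] {A : ℕ → Set G} {𝓤 : Ultrafilter ℕ} {K : ℕ}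
  {H L M : ℕ → Subgroup G}

/-- `H` is almost contained in `L`, along an ultrafilter and as seen by the sets `A i`. -/
def ILe (A : ℕ → Set G) (𝓤 : Ultrafilter ℕ) (H L : ℕ → Subgroup G) : Prop :=
  ∃ C : ℕ, ∀ᶠ i in (𝓤 : Filter ℕ), Cov C (A i ^ 2 ∩ H i) (L i)

lemma ILe.of_eventually_le (h : ∀ᶠ i in (𝓤 : Filter ℕ), H i ≤ L i) : ILe A 𝓤 H L :=
  ⟨1, h.mono fun _ hi => Cov.of_subset fun _ hx => hi hx.2⟩

lemma ILe.trans (hA : ∀ i, IsApx K (A i)) (h1 : ILe A 𝓤 H L) (h2 : ILe A 𝓤 L M) :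
    ILe A 𝓤 H M := by
  obtain ⟨C, h1⟩ := h1
  obtain ⟨D, h2⟩ := h2
  refine ⟨C * (K ^ 3 * D), ?_⟩
  filter_upwards [h1, h2] with i h1 h2
  exact (hA i).cov_trans h1 h2

lemma ILe.mono_right (h1 : ILe A 𝓤 H L) (h2 : ∀ᶠ i in (𝓤 : Filter ℕ), L i ≤ M i) :
    ILe A 𝓤 H M := by
  obtain ⟨C, h1⟩ := h1
  refine ⟨C, ?_⟩
  filter_upwards [h1, h2] with i h1 h2
  exact h1.mono le_rfl subset_rfl h2

lemma ILe.mono_left (h1 : ILe A 𝓤 L M) (h2 : ∀ᶠ i in (𝓤 : Filter ℕ), H i ≤ L i) :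
    ILe A 𝓤 H M := by
  obtain ⟨C, h1⟩ := h1
  refine ⟨C, ?_⟩
  filter_upwards [h1, h2] with i h1 h2
  exact h1.mono le_rfl (Set.inter_subset_inter_right _ h2) subset_rfl

lemma ILe.inf (h1 : ILe A 𝓤 H L) (h2 : ILe A 𝓤 H M) : ILe A 𝓤 H (L ⊓ M) := by
  obtain ⟨C, h1⟩ := h1
  obtain ⟨D, h2⟩ := h2
  refine ⟨C * D, ?_⟩
  filter_upwards [h1, h2] with i h1 h2
  exact h1.inter h2

lemma ILe.pow (hA : ∀ i, IsApx K (A i)) (h : ILe A 𝓤 H L) (m : ℕ) :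
    ∃ C : ℕ, ∀ᶠ i in (𝓤 : Filter ℕ), Cov C (A i ^ m ∩ H i) (L i) := by
  obtain ⟨C, h⟩ := h
  refine ⟨K ^ m * C, ?_⟩
  filter_upwards [h] with i h
  exact ((hA i).cov_pow_inter m h).mono le_rfl
    (Set.inter_subset_inter_left _ ((hA i).pow_mono m.le_succ)) subset_rfl

/-- Sequences of elements of bounded length. -/
def IGam (A : ℕ → Set G) (𝓤 : Ultrafilter ℕ) (g : ℕ → G) : Prop :=
  ∃ m : ℕ, ∀ᶠ i in (𝓤 : Filter ℕ), g i ∈ A i ^ m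

lemma IGam.mul {g h : ℕ → G} (hg : IGam A 𝓤 g) (hh : IGam A 𝓤 h) : IGam A 𝓤 (g * h) := by
  obtain ⟨m, hg⟩ := hg
  obtain ⟨k, hh⟩ := hh
  refine ⟨m + k, ?_⟩
  filter_upwards [hg, hh] with i h1 h2
  rw [pow_add]
  exact Set.mul_mem_mul h1 h2

lemma IGam.inv (hA : ∀ i, IsApx K (A i)) {g : ℕ → G} (hg : IGam A 𝓤 g) : IGam A 𝓤 g⁻¹ := by
  obtain ⟨m, hg⟩ := hg
  refine ⟨m, ?_⟩
  filter_upwards [hg] with i h1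
  exact (hA i).inv_pow h1

lemma exists_eventually_minimal {α : Type*} (P : α → Prop) (f : α → ℕ → ℕ) (N : ℕ) (a : α)
    (ha : P a) (hN : ∀ i, f a i ≤ N) :
    ∃ a, P a ∧ ∀ a', P a' → ¬ ∀ᶠ i in (𝓤 : Filter ℕ), f a' i < f a i := by
  classical
  have hex : ∃ d, ∃ a, P a ∧ ∀ᶠ i in (𝓤 : Filter ℕ), f a i ≤ d :=
    ⟨N, a, ha, Filter.Eventually.of_forall hN⟩
  obtain ⟨a, ha, had⟩ := Nat.find_spec hex
  refine ⟨a, ha, fun a' ha' hlt => ?_⟩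
  have h1 : ∀ᶠ i in (𝓤 : Filter ℕ), f a' i < Nat.find hex := by
    filter_upwards [hlt, had] with i h1 h2
    exact h1.trans_le h2
  obtain ⟨i, hi⟩ := h1.exists
  refine Nat.find_min hex (m := Nat.find hex - 1) (by omega) ⟨a', ha', ?_⟩
  filter_upwards [h1] with i hi
  omega

end Internal

section Alg

variable {V : Type} [AddCommGroup V] [Module ℂ V] {A : ℕ → Set (Module.End ℂ V)ˣ}
  {𝓤 : Ultrafilter ℕ} {K : ℕ}

/-- The unit groups of a sequence of algebras. -/
def iU (E : ℕ → Subalgebra ℂ (Module.End ℂ V)) : ℕ → Subgroup (Module.End ℂ V)ˣ := fun i => U (E i)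

/-- The normalisers of a sequence of algebras. -/
def iN (E : ℕ → Subalgebra ℂ (Module.End ℂ V)) : ℕ → Subgroup (Module.End ℂ V)ˣ := fun i => nz (E i)

/-- The groups of scalars. -/
def iZ (V : Type) [AddCommGroup V] [Module ℂ V] : ℕ → Subgroup (Module.End ℂ V)ˣ :=
  fun _ => U (⊥ : Subalgebra ℂ (Module.End ℂ V))

/-- Sequences of algebras which are connected, as seen by the sets `A i`. -/
def Conn (A : ℕ → Set (Module.End ℂ V)ˣ) (𝓤 : Ultrafilter ℕ)
    (M : ℕ → Subalgebra ℂ (Module.End ℂ V)) : Prop :=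
  ∀ F : ℕ → Subalgebra ℂ (Module.End ℂ V), ILe A 𝓤 (iU M) (iU F) →
    ∀ᶠ i in (𝓤 : Filter ℕ), M i ≤ F i

lemma iU_inf (E F : ℕ → Subalgebra ℂ (Module.End ℂ V)) : iU (E ⊓ F) = iU E ⊓ iU F := by
  funext i
  exact U_inf _ _

lemma Conn.not_iLe_iZ {M : ℕ → Subalgebra ℂ (Module.End ℂ V)} (h : Conn A 𝓤 M)
    (hM : ∀ᶠ i in (𝓤 : Filter ℕ), M i ≠ ⊥) : ¬ ILe A 𝓤 (iU M) (iZ V) := by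
  intro h1
  obtain ⟨i, hi, hi'⟩ := (hM.and (h (fun _ => ⊥) h1)).exists
  exact hi (le_bot_iff.1 hi')

lemma ILe.cj (hA : ∀ i, IsApx K (A i)) {E F : ℕ → Subalgebra ℂ (Module.End ℂ V)}
    (h : ILe A 𝓤 (iU E) (iU F)) {g : ℕ → (Module.End ℂ V)ˣ} (hg : IGam A 𝓤 g) :
    ILe A 𝓤 (iU fun i => cj (g i) (E i)) (iU fun i => cj (g i) (F i)) := by
  classical
  obtain ⟨m, hg⟩ := hg
  obtain ⟨C, h⟩ := h.pow hA (m + 2 + m)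
  refine ⟨C, ?_⟩
  filter_upwards [hg, h] with i hg h
  obtain ⟨Y, hY, h⟩ := h
  refine ⟨Y.image fun y => g i * y * (g i)⁻¹, Finset.card_image_le.trans hY, ?_⟩
  rintro s ⟨hs, hsE⟩
  obtain ⟨y, hy, hy'⟩ := h ((g i)⁻¹ * s * g i)
    ⟨(hA i).mul_pow ((hA i).mul_pow ((hA i).inv_pow hg) hs) hg, mem_U_cj.1 hsE⟩
  refine ⟨_, Finset.mem_image_of_mem _ hy, ?_⟩
  refine mem_U_cj.2 ?_
  have : (g i)⁻¹ * ((g i * y * (g i)⁻¹)⁻¹ * s) * g i = y⁻¹ * ((g i)⁻¹ * s * g i) := by group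
  rw [this]
  exact hy'

lemma Conn.cj (hA : ∀ i, IsApx K (A i)) {M : ℕ → Subalgebra ℂ (Module.End ℂ V)}
    (h : Conn A 𝓤 M) {g : ℕ → (Module.End ℂ V)ˣ} (hg : IGam A 𝓤 g) :
    Conn A 𝓤 fun i => cj (g i) (M i) := by
  intro F hF
  have h1 := hF.cj hA (hg.inv hA)
  simp only [Pi.inv_apply, cj_inv_cj] at h1
  filter_upwards [h _ h1] with i hi
  rwa [cj_le_iff]

variable [FiniteDimensional ℂ V]

lemma finrank_lt_of_not_le {E F : Subalgebra ℂ (Module.End ℂ V)} (h : E ≤ F) (h' : ¬ F ≤ E) :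
    finrank ℂ E < finrank ℂ F := by
  by_contra hlt
  exact h' (subalg_eq_of_finrank h (not_lt.1 hlt)).ge

/-- The connected component of a sequence of subgroups. -/
lemma exists_component (hA : ∀ i, IsApx K (A i)) (H : ℕ → Subgroup (Module.End ℂ V)ˣ) :
    ∃ E : ℕ → Subalgebra ℂ (Module.End ℂ V), ILe A 𝓤 H (iU E) ∧ Conn A 𝓤 E ∧
      ∀ F, ILe A 𝓤 H (iU F) → ∀ᶠ i in (𝓤 : Filter ℕ), E i ≤ F i := by
  obtain ⟨E, hE, hmin⟩ := exists_eventually_minimal (𝓤 := 𝓤)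
    (fun E : ℕ → Subalgebra ℂ (Module.End ℂ V) => ILe A 𝓤 H (iU E))
    (fun E i => finrank ℂ (E i)) (finrank ℂ (⊤ : Subalgebra ℂ (Module.End ℂ V)))
    (fun _ => ⊤) (ILe.of_eventually_le (Filter.Eventually.of_forall fun i => by
      simp only [iU, U_top]; exact le_top)) (fun i => le_rfl)
  have key : ∀ F, ILe A 𝓤 H (iU F) → ∀ᶠ i in (𝓤 : Filter ℕ), E i ≤ F i := by
    intro F hF
    by_contra hn
    rw [← Ultrafilter.eventually_not] at hn
    refine hmin (E ⊓ F) (by rw [iU_inf]; exact hE.inf hF) ?_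
    filter_upwards [hn] with i hi
    exact finrank_lt_of_not_le inf_le_left fun h => hi (h.trans inf_le_right)
  exact ⟨E, hE, fun F hF => key F (hE.trans hA hF), key⟩

/-- Maximal proper connected sequences of algebras. -/
structure IsMax (A : ℕ → Set (Module.End ℂ V)ˣ) (𝓤 : Ultrafilter ℕ)
    (M : ℕ → Subalgebra ℂ (Module.End ℂ V)) : Prop where
  conn : Conn A 𝓤 M
  ne_bot : ∀ᶠ i in (𝓤 : Filter ℕ), M i ≠ ⊥
  ne_top : ∀ᶠ i in (𝓤 : Filter ℕ), M i ≠ ⊤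
  max : ∀ F, Conn A 𝓤 F → (∀ᶠ i in (𝓤 : Filter ℕ), F i ≠ ⊤) →
    (∀ᶠ i in (𝓤 : Filter ℕ), M i ≤ F i) → ∀ᶠ i in (𝓤 : Filter ℕ), F i ≤ M i

lemma exists_isMax {I : ℕ → Subalgebra ℂ (Module.End ℂ V)} (hI : Conn A 𝓤 I)
    (h1 : ∀ᶠ i in (𝓤 : Filter ℕ), I i ≠ ⊥) (h2 : ∀ᶠ i in (𝓤 : Filter ℕ), I i ≠ ⊤) :
    ∃ M, IsMax A 𝓤 M ∧ ∀ᶠ i in (𝓤 : Filter ℕ), I i ≤ M i := by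
  obtain ⟨M, ⟨hM1, hM2, hM3⟩, hmin⟩ := exists_eventually_minimal (𝓤 := 𝓤)
    (fun M : ℕ → Subalgebra ℂ (Module.End ℂ V) => Conn A 𝓤 M ∧
      (∀ᶠ i in (𝓤 : Filter ℕ), M i ≠ ⊤) ∧ ∀ᶠ i in (𝓤 : Filter ℕ), I i ≤ M i)
    (fun M i => finrank ℂ (⊤ : Subalgebra ℂ (Module.End ℂ V)) - finrank ℂ (M i))
    (finrank ℂ (⊤ : Subalgebra ℂ (Module.End ℂ V))) I
    ⟨hI, h2, Filter.Eventually.of_forall fun _ => le_rfl⟩ (fun i => Nat.sub_le _ _)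
  refine ⟨M, ⟨hM1, ?_, hM2, fun F hF hF1 hF2 => ?_⟩, hM3⟩
  · filter_upwards [h1, hM3] with i h1 h2 h3
    exact h1 (le_bot_iff.1 (h3 ▸ h2))
  · by_contra hn
    rw [← Ultrafilter.eventually_not] at hn
    refine hmin F ⟨hF, hF1, ?_⟩ ?_
    · filter_upwards [hM3, hF2] with i h1 h2
      exact h1.trans h2
    · filter_upwards [hF2, hn] with i h1 h2
      have h3 := finrank_lt_of_not_le h1 h2
      have h4 : finrank ℂ (F i) ≤ finrank ℂ (⊤ : Subalgebra ℂ (Module.End ℂ V)) :=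
        finrank_subalg_mono le_top
      omega

lemma IsMax.cj (hA : ∀ i, IsApx K (A i)) {M : ℕ → Subalgebra ℂ (Module.End ℂ V)}
    (h : IsMax A 𝓤 M) {g : ℕ → (Module.End ℂ V)ˣ} (hg : IGam A 𝓤 g) :
    IsMax A 𝓤 fun i => cj (g i) (M i) where
  conn := h.conn.cj hA hg
  ne_bot := h.ne_bot.mono fun i hi h' => hi (by rw [cj_eq_iff, cj_bot] at h'; exact h')
  ne_top := h.ne_top.mono fun i hi h' => hi (by rw [cj_eq_iff, cj_top] at h'; exact h')
  max := by
    intro F hF h1 h2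
    have := h.max (fun i => ApproxLinear.cj (g i)⁻¹ (F i)) (hF.cj hA (hg.inv hA))
      (h1.mono fun i hi h' => hi (by rw [cj_eq_iff, inv_inv, cj_top] at h'; exact h'))
      (h2.mono fun i hi => by rwa [← cj_le_iff])
    filter_upwards [this] with i hi
    rwa [cj_le_iff, inv_inv] at hi

/-- The standing assumptions for the compactness argument. -/
structure Bad (n K : ℕ) (A : ℕ → Set (Module.End ℂ V)ˣ) (𝓤 : Ultrafilter ℕ) : Prop where
  below : TBelow n
  two_le : 2 ≤ n
  dim : finrank ℂ V = n
  apx : ∀ i, IsApx K (A i)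
  det : ∀ i, ∀ a ∈ A i, LinearMap.det (a : Module.End ℂ V) = 1
  bad : ∀ C, ∀ᶠ i in (𝓤 : Filter ℕ), ¬ TriCov C (A i)

namespace Bad

variable {n : ℕ}

lemma not_eventually_triCov (h : Bad n K A 𝓤)
    (C : ℕ) : ¬ ∀ᶠ i in (𝓤 : Filter ℕ), TriCov C (A i) := by
  intro h1
  obtain ⟨i, h1, h2⟩ := (h1.and (h.bad C)).exists
  exact h2 h1

lemma nontrivial (h : Bad n K A 𝓤) : Nontrivial V := Module.nontrivial_of_finrank_pos (R := ℂ)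
  (by have := h.two_le; have := h.dim; omega)

lemma tri_ne_top (h : Bad n K A 𝓤) (b : Module.Basis (Fin (finrank ℂ V)) ℂ V) : tri b ≠ ⊤ :=
  ApproxLinear.tri_ne_top (by rw [h.dim]; exact h.two_le)

lemma det_pow (h : Bad n K A 𝓤) {i m : ℕ} {a : (Module.End ℂ V)ˣ} (ha : a ∈ A i ^ m) :
    LinearMap.det (a : Module.End ℂ V) = 1 := by
  induction m generalizing a with
  | zero =>
    rw [pow_zero, Set.mem_one] at ha
    simp [ha]
  | succ m ih =>
    rw [pow_succ] at ha
    obtain ⟨x, hx, y, hy, rfl⟩ := ha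
    simp [ih hx, h.det i y hy]

/-- Powers of `A i` contain boundedly many scalars. -/
lemma exists_card_scalars (h : Bad n K A 𝓤) : ∃ s : ℕ, ∀ i m, ∀ S ⊆ A i ^ m,
    (∀ x ∈ S, (x : Module.End ℂ V) ∈ (⊥ : Subalgebra ℂ (Module.End ℂ V))) → S.ncard ≤ s := by
  have := h.nontrivial
  refine ⟨_, fun i m S hS hS' => Set.ncard_le_ncard (fun x hx => ?_) (finite_scalars (V := V))⟩
  exact ⟨hS' x hx, h.det_pow (hS hx)⟩

/-- Normalisers of connected proper algebras are uniformly almost triangular. -/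
lemma exists_normalizer_tri (h : Bad n K A 𝓤) : ∃ C : ℕ, ∀ I : ℕ → Subalgebra ℂ (Module.End ℂ V),
    (∀ᶠ i in (𝓤 : Filter ℕ), I i ≠ ⊥) → (∀ᶠ i in (𝓤 : Filter ℕ), I i ≠ ⊤) →
    ∃ b : ℕ → Module.Basis (Fin (finrank ℂ V)) ℂ V, ∀ᶠ i in (𝓤 : Filter ℕ),
      Cov C (A i ^ 2 ∩ nz (I i)) (U (tri (b i))) := by
  obtain ⟨C, hC⟩ := triCov_of_nz h.below (K ^ 3)
  refine ⟨C, fun I h1 h2 => ?_⟩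
  have : ∀ i, ∃ b : Module.Basis (Fin (finrank ℂ V)) ℂ V, I i ≠ ⊥ → I i ≠ ⊤ →
      Cov C (A i ^ 2 ∩ nz (I i)) (U (tri b)) := by
    intro i
    by_cases h3 : I i ≠ ⊥ ∧ I i ≠ ⊤
    · obtain ⟨b, hb⟩ := hC V h.dim _ ((h.apx i).inter (nz (I i))) (I i) h3.1 h3.2
        Set.inter_subset_right
      exact ⟨b, fun _ _ => hb⟩
    · exact ⟨Module.finBasis ℂ V, fun h4 h5 => (h3 ⟨h4, h5⟩).elim⟩
  choose b hb using this
  refine ⟨b, ?_⟩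
  filter_upwards [h1, h2] with i h1 h2
  exact hb i h1 h2

lemma exists_tri (h : Bad n K A 𝓤) {I : ℕ → Subalgebra ℂ (Module.End ℂ V)} (hI : Conn A 𝓤 I)
    (h1 : ∀ᶠ i in (𝓤 : Filter ℕ), I i ≠ ⊥) (h2 : ∀ᶠ i in (𝓤 : Filter ℕ), I i ≠ ⊤) :
    ∃ b : ℕ → Module.Basis (Fin (finrank ℂ V)) ℂ V, ILe A 𝓤 (iN I) (iU fun i => tri (b i)) ∧
      ∀ᶠ i in (𝓤 : Filter ℕ), I i ≤ tri (b i) := by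
  obtain ⟨C, hC⟩ := h.exists_normalizer_tri
  obtain ⟨b, hb⟩ := hC I h1 h2
  have hle : ILe A 𝓤 (iN I) (iU fun i => tri (b i)) := ⟨C, hb⟩
  exact ⟨b, hle, hI _ (hle.mono_left (Filter.Eventually.of_forall fun i => U_le_nz _))⟩

lemma not_centr_iLe (h : Bad n K A 𝓤) {z : ℕ → (Module.End ℂ V)ˣ} (hz : IGam A 𝓤 z) :
    ¬ ILe A 𝓤 (iU fun i => centr (z i : Module.End ℂ V)) (iZ V) := by
  rintro ⟨C, hC⟩
  obtain ⟨m, hm⟩ := hz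
  obtain ⟨s, hs⟩ := h.exists_card_scalars
  obtain ⟨C', hC'⟩ := triCov_of_centr h.below h.two_le K m (C * s)
  refine h.not_eventually_triCov C' ?_
  filter_upwards [hC, hm] with i hC hm
  refine hC' V h.dim (A i) (h.apx i) (z i) hm ?_
  refine (Cov.card_le (((h.apx i).fin_pow 2).subset Set.inter_subset_left) hC).trans
    (Nat.mul_le_mul_left _ (hs i 4 _ ?_ ?_))
  · rintro _ ⟨⟨x, hx, y, hy, rfl⟩, -⟩
    have := (h.apx i).mul_pow ((h.apx i).inv_pow (Set.mem_inv.1 hx).1) hy.1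
    simpa using this
  · exact fun x hx => (mem_U.1 hx.2).1

/-- The component of the normaliser of a proper connected algebra. -/
lemma exists_normalizer_component (h : Bad n K A 𝓤)
    {I : ℕ → Subalgebra ℂ (Module.End ℂ V)} (hI : Conn A 𝓤 I)
    (h1 : ∀ᶠ i in (𝓤 : Filter ℕ), I i ≠ ⊥) (h2 : ∀ᶠ i in (𝓤 : Filter ℕ), I i ≠ ⊤) :
    ∃ E, Conn A 𝓤 E ∧ ILe A 𝓤 (iN I) (iU E) ∧ (∀ᶠ i in (𝓤 : Filter ℕ), I i ≤ E i) ∧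
      ∀ᶠ i in (𝓤 : Filter ℕ), E i ≠ ⊤ := by
  obtain ⟨E, hE1, hE2, hE3⟩ := exists_component (𝓤 := 𝓤) h.apx (iN I)
  obtain ⟨b, hb, -⟩ := h.exists_tri hI h1 h2
  refine ⟨E, hE2, hE1, hI E (hE1.mono_left (Filter.Eventually.of_forall fun i => U_le_nz _)), ?_⟩
  filter_upwards [hE3 _ hb] with i hi ht
  rw [ht, top_le_iff] at hi
  exact h.tri_ne_top _ hi

lemma normalizer_iLe (h : Bad n K A 𝓤) {M : ℕ → Subalgebra ℂ (Module.End ℂ V)} (hM : IsMax A 𝓤 M) :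
    ILe A 𝓤 (iN M) (iU M) := by
  obtain ⟨E, h1, h2, h3, h4⟩ := h.exists_normalizer_component hM.conn hM.ne_bot hM.ne_top
  exact h2.mono_right ((hM.max E h1 h4 h3).mono fun i hi => U_mono hi)

/-- Normalisers grow inside a connected triangular algebra. -/
lemma exists_normalizer_growth (h : Bad n K A 𝓤)
    {M I : ℕ → Subalgebra ℂ (Module.End ℂ V)} (hM : Conn A 𝓤 M)
    {b : ℕ → Module.Basis (Fin (finrank ℂ V)) ℂ V} (hb : ∀ᶠ i in (𝓤 : Filter ℕ), M i ≤ tri (b i))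
    (hI : Conn A 𝓤 I) (hIM : ∀ᶠ i in (𝓤 : Filter ℕ), I i ≤ M i)
    (hne : ¬ ILe A 𝓤 (iU M) (iU I)) :
    ∃ H, ILe A 𝓤 H (iN I) ∧ (∀ i, H i ≤ U (M i)) ∧ ¬ ILe A 𝓤 H (iU I) := by
  classical
  let H : ℕ → ℕ → Subgroup (Module.End ℂ V)ˣ := fun d i => U (M i) ⊓ NN (b i) d
  have hex : ∃ d, ILe A 𝓤 (H d) (iU I) := by
    refine ⟨finrank ℂ V, ILe.of_eventually_le (Filter.Eventually.of_forall fun i g hg => ?_)⟩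
    rw [NN_top hg.2]
    exact Subgroup.one_mem _
  obtain ⟨d, hd⟩ : ∃ d, Nat.find hex = d + 1 := by
    refine Nat.exists_eq_succ_of_ne_zero fun h0 => hne ?_
    have := Nat.find_spec hex
    rw [h0] at this
    refine this.mono_left ?_
    filter_upwards [hb] with i hi
    refine le_inf le_rfl ?_
    rw [NN_zero]
    exact U_mono hi
  have hlast : ILe A 𝓤 (H (d + 1)) (iU I) := hd ▸ Nat.find_spec hex
  have hd' : ¬ ILe A 𝓤 (H d) (iU I) := Nat.find_min hex (by omega)
  refine ⟨H d, ?_, fun i => inf_le_left, hd'⟩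
  refine ⟨1, ?_⟩
  suffices ∀ᶠ i in (𝓤 : Filter ℕ), A i ^ 2 ∩ H d i ⊆ nz (I i) from
    this.mono fun i hi => Cov.of_subset hi
  by_contra hcon
  rw [← Ultrafilter.eventually_not] at hcon
  have hu : ∀ i, ∃ u : (Module.End ℂ V)ˣ, ¬ (A i ^ 2 ∩ H d i ⊆ (nz (I i) : Set _)) →
      u ∈ A i ^ 2 ∧ u ∈ H d i ∧ u ∉ nz (I i) := by
    intro i
    by_cases hi : A i ^ 2 ∩ H d i ⊆ (nz (I i) : Set _)
    · exact ⟨1, fun hi' => (hi' hi).elim⟩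
    · obtain ⟨u, hu, hu'⟩ := Set.not_subset.1 hi
      exact ⟨u, fun _ => ⟨hu.1, hu.2, hu'⟩⟩
  choose u hu using hu
  have hent : ∀ p q : Fin (finrank ℂ V), (q : ℕ) = p + d → ∀ᶠ i in (𝓤 : Filter ℕ),
      ent (b i) ((u i : Module.End ℂ V) - 1) p q = 0 ∨ M i ≤ triEq (b i) p q := by
    intro p q hpq
    rcases Nat.eq_zero_or_pos d with hd0 | hd0
    · have : p = q := Fin.ext (by omega)
      subst this
      filter_upwards [hb] with i hi
      exact Or.inr fun x hx => mem_triEq.2 ⟨hi hx, rfl⟩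
    by_cases h0 : ∀ᶠ i in (𝓤 : Filter ℕ), ent (b i) ((u i : Module.End ℂ V) - 1) p q = 0
    · exact h0.mono fun i hi => Or.inl hi
    rw [← Ultrafilter.eventually_not] at h0
    refine (hM (fun i => triEq (b i) p q) ⟨50 * K ^ (4 + 3), ?_⟩).mono fun i hi => Or.inr hi
    filter_upwards [h0, hb, hcon] with i h0 hb hcon
    obtain ⟨hu1, hu2, -⟩ := hu i hcon
    refine cov_triEq (h.apx i) (U_mono hb) hd0 le_rfl hpq
      ((h.apx i).pow_mono (by omega) hu1) hu2.1 hu2.2 ?_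
    rw [ent_sub, ent_one, if_neg (by rintro rfl; omega), sub_zero] at h0
    exact h0
  have hent' : ∀ᶠ i in (𝓤 : Filter ℕ), ∀ p q : Fin (finrank ℂ V), (q : ℕ) = p + d →
      ent (b i) ((u i : Module.End ℂ V) - 1) p q = 0 ∨ M i ≤ triEq (b i) p q := by
    rw [Filter.eventually_all]
    intro p
    rw [Filter.eventually_all]
    intro q
    by_cases hpq : (q : ℕ) = p + d
    · exact (hent p q hpq).mono fun i hi _ => hi
    · exact Filter.Eventually.of_forall fun i hi => (hpq hi).elim
  obtain ⟨C, hC⟩ := hlast.pow h.apx 8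
  have hle : ILe A 𝓤 (iU I) (iU fun i => cj (u i)⁻¹ (I i)) := by
    refine ⟨C, ?_⟩
    filter_upwards [hent', hC, hb, hcon, hIM] with i hent hC hb hcon hIM
    obtain ⟨hu1, hu2, -⟩ := hu i hcon
    obtain ⟨Y, hY, hYc⟩ := hC
    refine (Cov.of_color Y (fun x y => y⁻¹ * (u i * x * (u i)⁻¹ * x⁻¹) ∈ U (I i)) ?_ ?_).mono hY
      subset_rfl subset_rfl
    · rintro x ⟨hx, hxI⟩
      refine hYc _ ⟨?_, ?_, ?_⟩
      · exact (h.apx i).mul_pow ((h.apx i).mul_pow ((h.apx i).mul_pow hu1 hx)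
          ((h.apx i).inv_pow hu1)) ((h.apx i).inv_pow hx)
      · have hxM := U_mono hIM hxI
        exact Subgroup.mul_mem _ (Subgroup.mul_mem _ (Subgroup.mul_mem _ hu2.1 hxM)
          (Subgroup.inv_mem _ hu2.1)) (Subgroup.inv_mem _ hxM)
      · refine NN_comm (U_mono (hIM.trans hb) hxI) hu2.2 fun p q hpq => ?_
        refine (hent p q hpq).imp id fun hle => ?_
        exact (mem_triEq.1 (hle (hIM (mem_U.1 hxI).1))).2
    · rintro y s ⟨-, hs⟩ t ⟨-, ht⟩ h1 h2
      refine mem_U_cj.2 ?_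
      have h3 := (U (I i)).mul_mem h1 hs
      have h4 := (U (I i)).mul_mem h2 ht
      have h5 := (U (I i)).mul_mem ((U (I i)).inv_mem h3) h4
      convert h5 using 1
      group
  obtain ⟨i, h1, h2⟩ := ((hI _ hle).and hcon).exists
  obtain ⟨-, -, h3⟩ := hu i h2
  apply h3
  have := mem_nz.2 (cj_eq_of_le h1)
  simpa using Subgroup.inv_mem _ this

/-- Distinct maximal connected algebras have almost scalar intersection. -/
lemma isMax_eq (h : Bad n K A 𝓤) {M₁ M₂ : ℕ → Subalgebra ℂ (Module.End ℂ V)} (h₁ : IsMax A 𝓤 M₁)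
    (h₂ : IsMax A 𝓤 M₂) (hle : ¬ ILe A 𝓤 (iU M₁ ⊓ iU M₂) (iZ V)) :
    ∀ᶠ i in (𝓤 : Filter ℕ), M₁ i = M₂ i := by
  by_contra hne
  let S := ℕ → Subalgebra ℂ (Module.End ℂ V)
  let P : S × S × S → Prop := fun t => IsMax A 𝓤 t.1 ∧ IsMax A 𝓤 t.2.1 ∧
    (¬ ∀ᶠ i in (𝓤 : Filter ℕ), t.1 i = t.2.1 i) ∧ Conn A 𝓤 t.2.2 ∧
    (∀ᶠ i in (𝓤 : Filter ℕ), t.2.2 i ≠ ⊥) ∧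
    (∀ᶠ i in (𝓤 : Filter ℕ), t.2.2 i ≤ t.1 i) ∧ (∀ᶠ i in (𝓤 : Filter ℕ), t.2.2 i ≤ t.2.1 i) ∧
    ILe A 𝓤 (iU t.1 ⊓ iU t.2.1) (iU t.2.2)
  have build : ∀ M₁ M₂ : S, IsMax A 𝓤 M₁ → IsMax A 𝓤 M₂ →
      (¬ ∀ᶠ i in (𝓤 : Filter ℕ), M₁ i = M₂ i) → ¬ ILe A 𝓤 (iU M₁ ⊓ iU M₂) (iZ V) →
      ∃ I, P (M₁, M₂, I) := by
    intro M₁ M₂ h₁ h₂ hne hle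
    obtain ⟨I, hI1, hI2, hI3⟩ := exists_component (𝓤 := 𝓤) h.apx (iU M₁ ⊓ iU M₂)
    refine ⟨I, h₁, h₂, hne, hI2, ?_, hI3 M₁ ?_, hI3 M₂ ?_, hI1⟩
    · rw [← not_not (a := ∀ᶠ i in (𝓤 : Filter ℕ), I i ≠ ⊥), ← Ultrafilter.eventually_not]
      intro hb
      refine hle (hI1.mono_right ?_)
      filter_upwards [hb] with i hi
      rw [not_not] at hi
      exact U_mono hi.le
    · exact ILe.of_eventually_le (Filter.Eventually.of_forall fun i => inf_le_left)
    · exact ILe.of_eventually_le (Filter.Eventually.of_forall fun i => inf_le_right)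
  obtain ⟨I₀, hI₀⟩ := build M₁ M₂ h₁ h₂ hne hle
  obtain ⟨⟨M₁, M₂, I⟩, ⟨h₁, h₂, hne, hIc, hIb, hI1, hI2, hI⟩, hmin⟩ :=
    exists_eventually_minimal (𝓤 := 𝓤) P
    (fun t i => finrank ℂ (⊤ : Subalgebra ℂ (Module.End ℂ V)) - finrank ℂ (t.2.2 i))
    (finrank ℂ (⊤ : Subalgebra ℂ (Module.End ℂ V))) _ hI₀ (fun i => Nat.sub_le _ _)
  simp only at h₁ h₂ hne hIc hIb hI1 hI2 hI
  have hIt : ∀ᶠ i in (𝓤 : Filter ℕ), I i ≠ ⊤ := by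
    filter_upwards [hI1, h₁.ne_top] with i h1 h2 h3
    exact h2 (top_le_iff.1 (h3 ▸ h1))
  obtain ⟨E, hE1, hE2, hE3, hE4⟩ := h.exists_normalizer_component hIc hIb hIt
  have hEb : ∀ᶠ i in (𝓤 : Filter ℕ), E i ≠ ⊥ := by
    filter_upwards [hIb, hE3] with i h1 h2 h3
    exact h1 (le_bot_iff.1 (h3 ▸ h2))
  obtain ⟨M₃, h₃, hEM⟩ := exists_isMax hE1 hEb hE4
  have hIM : ∀ᶠ i in (𝓤 : Filter ℕ), I i ≤ M₃ i := by
    filter_upwards [hE3, hEM] with i h1 h2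
    exact h1.trans h2
  have key : ∀ N N' : S, IsMax A 𝓤 N → IsMax A 𝓤 N' → (¬ ∀ᶠ i in (𝓤 : Filter ℕ), N i = N' i) →
      (∀ᶠ i in (𝓤 : Filter ℕ), I i ≤ N i) → (∀ᶠ i in (𝓤 : Filter ℕ), I i ≤ N' i) →
      ∀ᶠ i in (𝓤 : Filter ℕ), N i = M₃ i := by
    intro N N' hN hN' hNN hIN hIN'
    by_contra hne
    have hnot : ¬ ILe A 𝓤 (iU N) (iU I) := by
      intro hle
      have hNI := hN.conn _ hle
      have hNN' : ∀ᶠ i in (𝓤 : Filter ℕ), N i ≤ N' i := by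
        filter_upwards [hNI, hIN'] with i h1 h2
        exact h1.trans h2
      apply hNN
      filter_upwards [hNN', hN.max N' hN'.conn hN'.ne_top hNN'] with i h1 h2
      exact le_antisymm h1 h2
    obtain ⟨b, -, hb⟩ := h.exists_tri hN.conn hN.ne_bot hN.ne_top
    obtain ⟨H, hH1, hH2, hH3⟩ := h.exists_normalizer_growth hN.conn hb hIc hIN hnot
    have hHM : ILe A 𝓤 H (iU N ⊓ iU M₃) := by
      refine (ILe.of_eventually_le (Filter.Eventually.of_forall hH2)).inf ?_
      exact (hH1.trans h.apx hE2).mono_right (hEM.mono fun i hi => U_mono hi)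
    have hIinf : ∀ᶠ i in (𝓤 : Filter ℕ), iU I i ≤ (iU N ⊓ iU M₃) i := by
      filter_upwards [hIN, hIM] with i h1 h2
      exact le_inf (U_mono h1) (U_mono h2)
    obtain ⟨J, hJ⟩ := build N M₃ hN h₃ hne fun hle =>
      hIc.not_iLe_iZ hIb (hle.mono_left hIinf)
    have hIJ := hIc J (hJ.2.2.2.2.2.2.2.mono_left hIinf)
    have hJI : ¬ ∀ᶠ i in (𝓤 : Filter ℕ), J i ≤ I i := by
      intro hJI
      exact hH3 ((hHM.trans h.apx hJ.2.2.2.2.2.2.2).mono_right (hJI.mono fun i hi => U_mono hi))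
    rw [← Ultrafilter.eventually_not] at hJI
    refine hmin _ hJ ?_
    filter_upwards [hIJ, hJI] with i h1 h2
    have h3 := finrank_lt_of_not_le h1 h2
    have h4 : finrank ℂ (J i) ≤ finrank ℂ (⊤ : Subalgebra ℂ (Module.End ℂ V)) :=
      finrank_subalg_mono le_top
    omega
  apply hne
  filter_upwards [key M₁ M₂ h₁ h₂ hne hI1 hI2,
    key M₂ M₁ h₂ h₁ (fun h' => hne (h'.mono fun i hi => hi.symm)) hI2 hI1] with i e1 e2
  rw [e1, e2]

end Bad

end Alg

section Group

variable {G : Type*} [Group G]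

lemma Cov.iInf {ι : Type*} {C : ℕ} {S : Set G} {H : ι → Subgroup G} (s : Finset ι)
    (h : ∀ i ∈ s, Cov C S (H i)) : Cov (C ^ s.card) S (⨅ i ∈ s, H i : Subgroup G) := by
  classical
  induction s using Finset.induction_on with
  | empty => simpa using Cov.of_subset (S := S) (Set.subset_univ S)
  | insert a s ha ih =>
    rw [Finset.iInf_insert, Finset.card_insert_of_notMem ha, pow_succ, mul_comm]
    exact (h a (Finset.mem_insert_self _ _)).inter
      (ih fun i hi => h i (Finset.mem_insert_of_mem hi))

lemma Cov.of_ncard_le {C : ℕ} {S : Set G} (hS : S.Finite) (h : S.ncard ≤ C) (H : Subgroup G) :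
    Cov C S H := by
  refine ⟨hS.toFinset, by rwa [← Set.ncard_eq_toFinset_card S hS], fun s hs => ?_⟩
  exact ⟨s, hS.mem_toFinset.2 hs, by simp⟩

end Group

section GenEq

variable {V : Type} [AddCommGroup V] [Module ℂ V] {n : ℕ}

/-- The elements of `T` whose diagonal entries agree at all positions visible in `A ^ 4 ∩ T`. -/
def genEq (A : Set (Module.End ℂ V)ˣ) (T : Subgroup (Module.End ℂ V)ˣ)
    (b : Module.Basis (Fin n) ℂ V) : Subgroup (Module.End ℂ V)ˣ :=
  T ⊓ ⨅ pq : Fin n × Fin n, ⨅ _ : ∃ e, 1 ≤ e ∧ (pq.2 : ℕ) = pq.1 + e ∧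
    ∃ y ∈ A ^ 4, y ∈ T ∧ y ∈ NN b e ∧ ent b (y : Module.End ℂ V) pq.1 pq.2 ≠ 0,
      U (triEq b pq.1 pq.2)

lemma genEq_le {A : Set (Module.End ℂ V)ˣ} {T : Subgroup (Module.End ℂ V)ˣ}
    {b : Module.Basis (Fin n) ℂ V} : genEq A T b ≤ T := inf_le_left

lemma genEq_apply {A : Set (Module.End ℂ V)ˣ} {T : Subgroup (Module.End ℂ V)ˣ}
    {b : Module.Basis (Fin n) ℂ V} {x y : (Module.End ℂ V)ˣ} (hx : x ∈ genEq A T b)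
    (hyA : y ∈ A ^ 4) (hyT : y ∈ T) {e : ℕ} (he : 1 ≤ e) (hy : y ∈ NN b e) {p q : Fin n}
    (hpq : (q : ℕ) = p + e) (h0 : ent b (y : Module.End ℂ V) p q ≠ 0) :
    ent b (x : Module.End ℂ V) p p = ent b (x : Module.End ℂ V) q q := by
  have h1 := (Subgroup.mem_inf.1 hx).2
  simp only [Subgroup.mem_iInf] at h1
  exact (mem_triEq.1 (mem_U.1 (h1 (p, q) ⟨e, he, hpq, y, hyA, hyT, hy, h0⟩)).1).2

lemma cov_genEq {K : ℕ} {A : Set (Module.End ℂ V)ˣ} (hA : IsApx K A)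
    {T : Subgroup (Module.End ℂ V)ˣ} {b : Module.Basis (Fin n) ℂ V} (hT : T ≤ U (tri b)) :
    Cov ((50 * K ^ 7) ^ (n * n)) (A ^ 2 ∩ T) (genEq A T b) := by
  classical
  have h1 : 1 ≤ 50 * K ^ 7 := Nat.mul_pos (by norm_num) (pow_pos hA.one_le 7)
  have key := Cov.iInf (S := A ^ 2 ∩ T) (C := 50 * K ^ 7) (Finset.univ : Finset (Fin n × Fin n))
    (H := fun pq => ⨅ _ : ∃ e, 1 ≤ e ∧ (pq.2 : ℕ) = pq.1 + e ∧
      ∃ y ∈ A ^ 4, y ∈ T ∧ y ∈ NN b e ∧ ent b (y : Module.End ℂ V) pq.1 pq.2 ≠ 0,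
      U (triEq b pq.1 pq.2)) ?_
  · have h2 := (Cov.of_subset (S := A ^ 2 ∩ T) (H := (T : Set (Module.End ℂ V)ˣ))
      Set.inter_subset_right).inter key
    rw [one_mul, Finset.card_univ, Fintype.card_prod, Fintype.card_fin] at h2
    simp only [Finset.mem_univ, iInf_pos] at h2
    exact h2
  · rintro ⟨p, q⟩ -
    by_cases h : ∃ e, 1 ≤ e ∧ (q : ℕ) = p + e ∧
      ∃ y ∈ A ^ 4, y ∈ T ∧ y ∈ NN b e ∧ ent b (y : Module.End ℂ V) p q ≠ 0
    · have h' := h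
      obtain ⟨e, he, hpq, y, hy1, hy2, hy3, hy4⟩ := h'
      simp only [h, iInf_pos]
      exact cov_triEq hA hT he le_rfl hpq hy1 hy2 hy3 hy4
    · simp only [h, not_false_eq_true, iInf_neg]
      exact (Cov.of_subset (Set.subset_univ _)).mono h1 subset_rfl subset_rfl

end GenEq

section Alg

variable {V : Type} [AddCommGroup V] [Module ℂ V] {A : ℕ → Set (Module.End ℂ V)ˣ}
  {𝓤 : Ultrafilter ℕ} {K : ℕ}

lemma not_centr_inf_iLe (hA : ∀ i, IsApx K (A i)) {n : ℕ} {b : ℕ → Module.Basis (Fin n) ℂ V}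
    {T : ℕ → Subgroup (Module.End ℂ V)ˣ} (hT : ∀ i, T i ≤ U (tri (b i)))
    (hTZ : ¬ ILe A 𝓤 T (iZ V)) {x : ℕ → (Module.End ℂ V)ˣ}
    (hx : ∀ᶠ i in (𝓤 : Filter ℕ), x i ∈ A i ^ 4 ∧ x i ∈ genEq (A i) (T i) (b i)) :
    ¬ ILe A 𝓤 (T ⊓ iU fun i => centr (x i : Module.End ℂ V)) (iZ V) := by
  classical
  intro hle
  have hex : ∃ d, ILe A 𝓤 (fun i => T i ⊓ NN (b i) d) (iZ V) := by
    refine ⟨n, ILe.of_eventually_le (Filter.Eventually.of_forall fun i g hg => ?_)⟩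
    rw [NN_top hg.2]
    exact Subgroup.one_mem _
  obtain ⟨d, hd⟩ : ∃ d, Nat.find hex = d + 1 := by
    refine Nat.exists_eq_succ_of_ne_zero fun h0 => hTZ ?_
    have := Nat.find_spec hex
    rw [h0] at this
    refine this.mono_left (Filter.Eventually.of_forall fun i => le_inf le_rfl ?_)
    rw [NN_zero]
    exact hT i
  have hlast : ILe A 𝓤 (fun i => T i ⊓ NN (b i) (d + 1)) (iZ V) := hd ▸ Nat.find_spec hex
  refine Nat.find_min hex (m := d) (by omega) (ILe.trans hA ?_ hle)
  obtain ⟨C, hC⟩ := hlast.pow hA 12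
  refine ⟨C, ?_⟩
  filter_upwards [hC, hx] with i hC hx
  obtain ⟨hx1, hx2⟩ := hx
  have hxT := genEq_le hx2
  obtain ⟨Y, hY, hYc⟩ := hC
  have hcomm : ∀ y ∈ A i ^ 2 ∩ (T i ⊓ NN (b i) d : Subgroup _),
      y * x i * y⁻¹ * (x i)⁻¹ ∈ NN (b i) (d + 1) := by
    rintro y ⟨hyA, hyT, hyN⟩
    refine NN_comm (hT i hxT) hyN fun p q hpq => ?_
    rcases Nat.eq_zero_or_pos d with h0 | h0
    · have : p = q := Fin.ext (by omega)
      exact Or.inr (by rw [this])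
    · rw [ent_sub, ent_one, if_neg (by rintro rfl; omega), sub_zero, or_iff_not_imp_left]
      exact genEq_apply hx2 ((hA i).pow_mono (by norm_num) hyA) hyT h0 hyN hpq
  refine (Cov.of_color Y (fun y c => c⁻¹ * (y * x i * y⁻¹ * (x i)⁻¹) ∈ iZ V i) ?_ ?_).mono hY
    subset_rfl subset_rfl
  · rintro y ⟨hyA, hyT, hyN⟩
    refine hYc _ ⟨?_, ?_, hcomm y ⟨hyA, hyT, hyN⟩⟩
    · exact (hA i).mul_pow ((hA i).mul_pow ((hA i).mul_pow hyA hx1)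
        ((hA i).inv_pow hyA)) ((hA i).inv_pow hx1)
    · exact Subgroup.mul_mem _ (Subgroup.mul_mem _ (Subgroup.mul_mem _ hyT hxT)
        (Subgroup.inv_mem _ hyT)) (Subgroup.inv_mem _ hxT)
  · rintro c y hy z hz h1 h2
    refine ⟨Subgroup.mul_mem _ (Subgroup.inv_mem _ hy.2.1) hz.2.1, ?_⟩
    have h3 : (y * x i * y⁻¹ * (x i)⁻¹)⁻¹ * (z * x i * z⁻¹ * (x i)⁻¹) ∈ iZ V i := by
      have := Subgroup.mul_mem _ (Subgroup.inv_mem _ h1) h2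
      convert this using 1
      group
    have h4 := NN_bot (by omega) (Subgroup.mul_mem _ (Subgroup.inv_mem _ (hcomm y hy))
      (hcomm z hz)) h3
    rw [inv_mul_eq_one, mul_left_inj] at h4
    refine mem_U_centr.2 ?_
    have h5 : y * x i = z * x i * z⁻¹ * y := by rw [← h4]; group
    calc x i * (y⁻¹ * z) = y⁻¹ * (y * x i) * y⁻¹ * z := by group
      _ = y⁻¹ * z * x i := by rw [h5]; group

variable [FiniteDimensional ℂ V]

namespace Bad

variable {n : ℕ}

/-- Large sets of elements whose centralisers are almost contained in a maximal algebra. -/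
lemma exists_centr_iLe (h : Bad n K A 𝓤) :
    ∃ C : ℕ, ∀ M, IsMax A 𝓤 M → ∃ X : ℕ → Set (Module.End ℂ V)ˣ,
    (∀ᶠ i in (𝓤 : Filter ℕ), X i ⊆ A i ^ 4 ∧ (A i ^ 2 ∩ nz (M i)).ncard ≤ C * (X i).ncard) ∧
    ∀ x : ℕ → (Module.End ℂ V)ˣ, (∀ᶠ i in (𝓤 : Filter ℕ), x i ∈ X i) →
      ILe A 𝓤 (iU fun i => centr (x i : Module.End ℂ V)) (iU M) := by
  obtain ⟨C₀, hC₀⟩ := h.exists_normalizer_tri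
  obtain ⟨s, hs⟩ := h.exists_card_scalars
  obtain ⟨C, hCdef⟩ : ∃ C, C = C₀ * 1 * (K ^ 3 *
    (50 * K ^ 7) ^ (finrank ℂ V * finrank ℂ V)) := ⟨_, rfl⟩
  refine ⟨C * (1 + s), fun M hM => ?_⟩
  obtain ⟨b, hb⟩ := hC₀ M hM.ne_bot hM.ne_top
  let T : ℕ → Subgroup (Module.End ℂ V)ˣ := fun i => nz (M i) ⊓ U (tri (b i))
  have hT : ∀ i, T i ≤ U (tri (b i)) := fun i => inf_le_right
  have hMT : ILe A 𝓤 (iU M) T :=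
    ⟨C₀ * 1, hb.mono fun i hi => ((hi.inter (Cov.of_subset Set.inter_subset_right)).mono le_rfl
      (Set.inter_subset_inter_right _ (U_le_nz _)) (by rw [inf_comm]))⟩
  have hTZ : ¬ ILe A 𝓤 T (iZ V) := fun hle =>
    hM.conn.not_iLe_iZ hM.ne_bot (hMT.trans h.apx hle)
  have hcov : ∀ᶠ i in (𝓤 : Filter ℕ), Cov C (A i ^ 2 ∩ nz (M i)) (genEq (A i) (T i) (b i)) := by
    filter_upwards [hb] with i hi
    rw [hCdef]
    refine (h.apx i).cov_trans ?_ (cov_genEq (h.apx i) (hT i))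
    have h1 := hi.inter (L := nz (M i)) (Cov.of_subset Set.inter_subset_right)
    rw [inf_comm] at h1
    exact h1
  let X : ℕ → Set (Module.End ℂ V)ˣ := fun i => {x | x ∈ A i ^ 4 ∧ x ∈ genEq (A i) (T i) (b i) ∧
    (x : Module.End ℂ V) ∉ (⊥ : Subalgebra ℂ (Module.End ℂ V))}
  have hXfin : ∀ i, (X i).Finite := fun i => ((h.apx i).fin_pow 4).subset fun x hx => hx.1
  have hcard : ∀ᶠ i in (𝓤 : Filter ℕ), (A i ^ 2 ∩ nz (M i)).ncard ≤ C * ((X i).ncard + s) := by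
    filter_upwards [hcov] with i hi
    refine (Cov.card_le (((h.apx i).fin_pow 2).subset Set.inter_subset_left) hi).trans
      (Nat.mul_le_mul_left _ ?_)
    let S : Set (Module.End ℂ V)ˣ := {x | x ∈ A i ^ 4 ∧
      (x : Module.End ℂ V) ∈ (⊥ : Subalgebra ℂ (Module.End ℂ V))}
    have hSfin : S.Finite := ((h.apx i).fin_pow 4).subset fun x hx => hx.1
    refine (Set.ncard_le_ncard (t := X i ∪ S) ?_ ((hXfin i).union hSfin)).trans
      ((Set.ncard_union_le _ _).trans (Nat.add_le_add_left (hs i 4 S (fun x hx => hx.1)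
        fun x hx => hx.2) _))
    rintro _ ⟨⟨x, hx, y, hy, rfl⟩, hxy⟩
    have hxy4 : x * y ∈ A i ^ 4 := by
      have := (h.apx i).mul_pow ((h.apx i).inv_pow (Set.mem_inv.1 hx).1) hy.1
      simpa using this
    by_cases hz : ((x * y : (Module.End ℂ V)ˣ) : Module.End ℂ V) ∈
        (⊥ : Subalgebra ℂ (Module.End ℂ V))
    · exact Or.inr ⟨hxy4, hz⟩
    · exact Or.inl ⟨hxy4, hxy, hz⟩
  have hne : ∀ᶠ i in (𝓤 : Filter ℕ), (X i).ncard ≠ 0 := by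
    by_contra hcon
    rw [← Ultrafilter.eventually_not] at hcon
    refine hM.conn.not_iLe_iZ hM.ne_bot ⟨C * s, ?_⟩
    filter_upwards [hcon, hcard] with i h1 h2
    rw [not_not] at h1
    rw [h1, zero_add] at h2
    exact (Cov.of_ncard_le (((h.apx i).fin_pow 2).subset Set.inter_subset_left) h2 _).mono le_rfl
      (Set.inter_subset_inter_right _ (U_le_nz _)) subset_rfl
  refine ⟨X, ?_, fun x hx => ?_⟩
  · filter_upwards [hcard, hne] with i h1 h2
    refine ⟨fun x hx => hx.1, h1.trans ?_⟩
    rw [mul_assoc]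
    refine Nat.mul_le_mul_left _ ?_
    have : s * 1 ≤ s * (X i).ncard := Nat.mul_le_mul_left _ (Nat.pos_of_ne_zero h2)
    rw [add_mul, one_mul]
    omega
  · have hxΓ : IGam A 𝓤 x := ⟨4, hx.mono fun i hi => hi.1⟩
    have hTC := not_centr_inf_iLe h.apx hT hTZ (x := x) (hx.mono fun i hi => ⟨hi.1, hi.2.1⟩)
    obtain ⟨D, hD1, hD2, hD3⟩ := exists_component (𝓤 := 𝓤) h.apx
      (iU fun i => centr (x i : Module.End ℂ V))
    have hDb : ∀ᶠ i in (𝓤 : Filter ℕ), D i ≠ ⊥ := by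
      by_contra hcon
      rw [← Ultrafilter.eventually_not] at hcon
      refine h.not_centr_iLe hxΓ (hD1.mono_right ?_)
      filter_upwards [hcon] with i hi
      rw [not_not] at hi
      exact U_mono hi.le
    have hDt : ∀ᶠ i in (𝓤 : Filter ℕ), D i ≠ ⊤ := by
      filter_upwards [hx, hD3 _ (ILe.of_eventually_le (Filter.Eventually.of_forall
        fun i => le_rfl))] with i h1 h2 h3
      rw [h3, top_le_iff] at h2
      exact h1.2.2 (centr_eq_top h2)
    obtain ⟨M', hM', hDM⟩ := exists_isMax hD2 hDb hDt
    have hCM' : ILe A 𝓤 (iU fun i => centr (x i : Module.End ℂ V)) (iU M') :=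
      hD1.mono_right (hDM.mono fun i hi => U_mono hi)
    have heq := h.isMax_eq hM hM' fun hle => hTC ?_
    · exact hCM'.mono_right (heq.mono fun i hi => U_mono hi.ge)
    · refine ILe.trans h.apx (ILe.inf ?_ ?_) hle
      · exact (h.normalizer_iLe hM).mono_left (Filter.Eventually.of_forall fun i =>
          inf_le_left.trans inf_le_left)
      · exact hCM'.mono_left (Filter.Eventually.of_forall fun i => inf_le_right)

end Bad

end Alg

section Count

variable {V : Type} [AddCommGroup V] [Module ℂ V]

lemma ncard_le_of_conj_separated {K C : ℕ} {A : Set (Module.End ℂ V)ˣ} (hA : IsApx K A)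
    {M : Subalgebra ℂ (Module.End ℂ V)} {X : Set (Module.End ℂ V)ˣ} (hX : X ⊆ A ^ 4)
    (hC : (A ^ 2 ∩ nz M : Set (Module.End ℂ V)ˣ).ncard ≤ C * X.ncard)
    (hTI : ∀ b ∈ A, ∀ b' ∈ A, ∀ z, b⁻¹ * z * b ∈ X → b'⁻¹ * z * b' ∈ X → cj b M = cj b' M) :
    A.ncard ≤ C * {z | z ∈ A ^ 6 ∧ ∃ b ∈ A, b⁻¹ * z * b ∈ X}.ncard := by
  classical
  have hXfin : X.Finite := (hA.fin_pow 4).subset hX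
  have hNfin : (A ^ 2 ∩ nz M : Set (Module.End ℂ V)ˣ).Finite :=
    (hA.fin_pow 2).subset Set.inter_subset_left
  obtain ⟨Y, hY⟩ : ∃ Y : Set (Module.End ℂ V)ˣ,
    Y = {z | z ∈ A ^ 6 ∧ ∃ b ∈ A, b⁻¹ * z * b ∈ X} := ⟨_, rfl⟩
  rw [← hY]
  have hYfin : Y.Finite := (hA.fin_pow 6).subset (by rw [hY]; exact fun z hz => hz.1)
  have hN : 0 < (A ^ 2 ∩ nz M : Set (Module.End ℂ V)ˣ).ncard :=
    (Set.ncard_pos hNfin).2 ⟨1, hA.subset_pow two_ne_zero hA.one, Subgroup.one_mem _⟩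
  have hXpos : 0 < X.ncard := by
    rcases Nat.eq_zero_or_pos X.ncard with h0 | h0
    · rw [h0, mul_zero] at hC
      omega
    · exact h0
  have key : (hA.fin.toFinset ×ˢ hXfin.toFinset).card ≤ hNfin.toFinset.card * hYfin.toFinset.card := by
    refine Finset.card_le_mul_card_image_of_maps_to (f := fun p => p.1 * p.2 * p.1⁻¹) ?_ _ ?_
    · rintro ⟨b, x⟩ hbx
      simp only [Finset.mem_product, Set.Finite.mem_toFinset] at hbx
      rw [Set.Finite.mem_toFinset, hY]
      refine ⟨?_, b, hbx.1, ?_⟩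
      · exact hA.mul_pow (hA.mul_pow (hA.subset_pow one_ne_zero hbx.1) (hX hbx.2))
          (hA.inv_pow (hA.subset_pow one_ne_zero hbx.1))
      · have : b⁻¹ * (b * x * b⁻¹) * b = x := by group
        rw [this]
        exact hbx.2
    · intro z _
      rcases Finset.eq_empty_or_nonempty
        {p ∈ hA.fin.toFinset ×ˢ hXfin.toFinset | p.1 * p.2 * p.1⁻¹ = z} with h0 | ⟨⟨b, x⟩, hbx⟩
      · rw [h0]
        exact Nat.zero_le _
      simp only [Finset.mem_filter, Finset.mem_product, Set.Finite.mem_toFinset] at hbx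
      obtain ⟨⟨hb, hx⟩, hz⟩ := hbx
      refine Finset.card_le_card_of_injOn (fun p => b⁻¹ * p.1) ?_ ?_
      · rintro ⟨b', x'⟩ h'
        simp only [Finset.coe_filter, Finset.mem_product, Set.Finite.mem_toFinset,
          Set.mem_ofPred_eq] at h'
        obtain ⟨⟨hb', hx'⟩, hz'⟩ := h'
        simp only [Set.Finite.coe_toFinset]
        refine ⟨hA.mul_pow (hA.inv_pow (hA.subset_pow one_ne_zero hb))
          (hA.subset_pow one_ne_zero hb'), mem_nz.2 ?_⟩
        have h1 := hTI b hb b' hb' z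
          (by rw [← hz, show b⁻¹ * (b * x * b⁻¹) * b = x by group]; exact hx)
          (by rw [← hz', show b'⁻¹ * (b' * x' * b'⁻¹) * b' = x' by group]; exact hx')
        rw [cj_mul, ← h1, cj_inv_cj]
      · rintro ⟨b', x'⟩ h' ⟨b'', x''⟩ h'' he
        simp only [Finset.coe_filter, Finset.mem_product, Set.Finite.mem_toFinset,
          Set.mem_ofPred_eq] at h' h''
        simp only [mul_right_inj] at he
        subst he
        have := h'.2.trans h''.2.symm
        simp only [mul_left_inj, mul_right_inj] at this
        rw [this]
  rw [Finset.card_product, ← Set.ncard_eq_toFinset_card A hA.fin, ← Set.ncard_eq_toFinset_card X hXfin,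
    ← Set.ncard_eq_toFinset_card _ hNfin, ← Set.ncard_eq_toFinset_card Y hYfin] at key
  refine Nat.le_of_mul_le_mul_right ?_ hXpos
  calc A.ncard * X.ncard ≤ _ := key
    _ ≤ C * X.ncard * Y.ncard := Nat.mul_le_mul_right _ hC
    _ = C * Y.ncard * X.ncard := by ring

lemma card_le_of_conj_separated {K C r : ℕ} {A : Set (Module.End ℂ V)ˣ} (hA : IsApx K A)
    {M : Fin r → Subalgebra ℂ (Module.End ℂ V)} {X : Fin r → Set (Module.End ℂ V)ˣ}
    (hX : ∀ a, X a ⊆ A ^ 4)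
    (hC : ∀ a, (A ^ 2 ∩ nz (M a) : Set (Module.End ℂ V)ˣ).ncard ≤ C * (X a).ncard)
    (hTI : ∀ a a', ∀ b ∈ A, ∀ b' ∈ A, ∀ z, b⁻¹ * z * b ∈ X a → b'⁻¹ * z * b' ∈ X a' →
      cj b (M a) = cj b' (M a'))
    (hne : ∀ a a', a < a' → ∀ b ∈ A, ∀ b' ∈ A, cj b (M a) ≠ cj b' (M a')) :
    r ≤ C * K ^ 5 := by
  classical
  let Y : Fin r → Set (Module.End ℂ V)ˣ := fun a => {z | z ∈ A ^ 6 ∧ ∃ b ∈ A, b⁻¹ * z * b ∈ X a}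
  have hYfin : ∀ a, (Y a).Finite := fun a => (hA.fin_pow 6).subset fun z hz => hz.1
  have h1 : ∀ a, A.ncard ≤ C * (Y a).ncard := fun a =>
    ncard_le_of_conj_separated hA (hX a) (hC a) (hTI a a)
  have hdisj : ∀ a a', a ≠ a' → Disjoint (hYfin a).toFinset (hYfin a').toFinset := by
    intro a a' haa
    rw [Finset.disjoint_left]
    intro z hz hz'
    rw [Set.Finite.mem_toFinset] at hz hz'
    obtain ⟨-, b, hb, hz⟩ := hz
    obtain ⟨-, b', hb', hz'⟩ := hz'
    have h2 := hTI a a' b hb b' hb' z hz hz'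
    rcases lt_or_gt_of_ne haa with h3 | h3
    · exact hne a a' h3 b hb b' hb' h2
    · exact hne a' a h3 b' hb' b hb h2.symm
  have h2 : ∑ a, (Y a).ncard ≤ (A ^ 6).ncard := by
    have h3 : (Finset.univ.biUnion fun a => (hYfin a).toFinset).card = ∑ a, (Y a).ncard := by
      rw [Finset.card_biUnion fun a _ a' _ haa => hdisj a a' haa]
      exact Finset.sum_congr rfl fun a _ => (Set.ncard_eq_toFinset_card _ _).symm
    rw [← h3, Set.ncard_eq_toFinset_card _ (hA.fin_pow 6)]
    refine Finset.card_le_card fun z hz => ?_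
    obtain ⟨a, -, ha⟩ := Finset.mem_biUnion.1 hz
    rw [Set.Finite.mem_toFinset] at ha ⊢
    exact ha.1
  refine Nat.le_of_mul_le_mul_right ?_ hA.ncard_pos
  calc r * A.ncard = ∑ _a : Fin r, A.ncard := by simp
    _ ≤ ∑ a, C * (Y a).ncard := Finset.sum_le_sum fun a _ => h1 a
    _ = C * ∑ a, (Y a).ncard := by rw [Finset.mul_sum]
    _ ≤ C * (K ^ 5 * A.ncard) := Nat.mul_le_mul_left _ (h2.trans (hA.ncard_pow 5))
    _ = C * K ^ 5 * A.ncard := by ring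

lemma finite_orbit_of_stationary {K : ℕ} {A : Set (Module.End ℂ V)ˣ} (hA : IsApx K A)
    {M : Subalgebra ℂ (Module.End ℂ V)} {k : ℕ}
    (h : ∀ g ∈ A ^ (k + 1), ∃ g' ∈ A ^ k, cj g M = cj g' M) :
    {E | ∃ g ∈ Subgroup.closure A, E = cj g M}.Finite := by
  refine ((hA.fin_pow k).image fun g => cj g M).subset ?_
  rintro _ ⟨g, hg, rfl⟩
  suffices ∃ g' ∈ A ^ k, cj g M = cj g' M by
    obtain ⟨g', h1, h2⟩ := this
    exact ⟨g', h1, h2.symm⟩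
  have step : ∀ a ∈ A, ∀ y, (∃ g' ∈ A ^ k, cj y M = cj g' M) →
      ∃ g' ∈ A ^ k, cj (a * y) M = cj g' M := by
    rintro a ha y ⟨x, hx, hyx⟩
    rw [cj_mul, hyx, ← cj_mul]
    refine h _ ?_
    rw [pow_succ']
    exact Set.mul_mem_mul ha hx
  induction hg using Subgroup.closure_induction_left with
  | one => exact ⟨1, hA.pow_mono (Nat.zero_le k) (by simp), rfl⟩
  | mul_left a ha y _ ih => exact step a ha y ih
  | inv_mul_cancel a ha y _ ih => exact step a⁻¹ (hA.inv a ha) y ih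

end Count

section Alg

variable {V : Type} [AddCommGroup V] [Module ℂ V] {A : ℕ → Set (Module.End ℂ V)ˣ}
  {𝓤 : Ultrafilter ℕ} {K : ℕ} [FiniteDimensional ℂ V]

namespace Bad

variable {n : ℕ}

lemma exists_max (h : Bad n K A 𝓤) : ∃ M, IsMax A 𝓤 M := by
  obtain ⟨z, hz⟩ : ∃ z : ℕ → (Module.End ℂ V)ˣ, ∀ᶠ i in (𝓤 : Filter ℕ), z i ∈ A i ∧
      (z i : Module.End ℂ V) ∉ (⊥ : Subalgebra ℂ (Module.End ℂ V)) := by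
    have : ∀ i, ∃ z : (Module.End ℂ V)ˣ, ¬ TriCov 1 (A i) → z ∈ A i ∧
        (z : Module.End ℂ V) ∉ (⊥ : Subalgebra ℂ (Module.End ℂ V)) := by
      intro i
      by_cases hi : ∃ z ∈ A i, (z : Module.End ℂ V) ∉ (⊥ : Subalgebra ℂ (Module.End ℂ V))
      · obtain ⟨z, h1, h2⟩ := hi
        exact ⟨z, fun _ => ⟨h1, h2⟩⟩
      · push Not at hi
        refine ⟨1, fun hT => (hT (TriCov.of_bot (Cov.of_subset fun x hx => mem_U.2 ⟨hi x hx, ?_⟩))).elim⟩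
        exact hi _ ((h.apx i).inv x hx)
    choose z hz using this
    exact ⟨z, (h.bad 1).mono fun i hi => hz i hi⟩
  have hzΓ : IGam A 𝓤 z := ⟨1, hz.mono fun i hi => by rw [pow_one]; exact hi.1⟩
  obtain ⟨D, hD1, hD2, hD3⟩ := exists_component (𝓤 := 𝓤) h.apx
    (iU fun i => centr (z i : Module.End ℂ V))
  have hDb : ∀ᶠ i in (𝓤 : Filter ℕ), D i ≠ ⊥ := by
    by_contra hcon
    rw [← Ultrafilter.eventually_not] at hcon
    refine h.not_centr_iLe hzΓ (hD1.mono_right ?_)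
    filter_upwards [hcon] with i hi
    rw [not_not] at hi
    exact U_mono hi.le
  have hDt : ∀ᶠ i in (𝓤 : Filter ℕ), D i ≠ ⊤ := by
    filter_upwards [hz, hD3 _ (ILe.of_eventually_le (Filter.Eventually.of_forall
      fun i => le_rfl))] with i h1 h2 h3
    rw [h3, top_le_iff] at h2
    exact h1.2 (centr_eq_top h2)
  obtain ⟨M, hM, -⟩ := exists_isMax hD2 hDb hDt
  exact ⟨M, hM⟩

lemma eventually_separated (h : Bad n K A 𝓤)
    {M M' : ℕ → Subalgebra ℂ (Module.End ℂ V)} (hM : IsMax A 𝓤 M)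
    (hM' : IsMax A 𝓤 M') {X X' : ℕ → Set (Module.End ℂ V)ˣ}
    (hXA : ∀ᶠ i in (𝓤 : Filter ℕ), X i ⊆ A i ^ 4)
    (hX : ∀ x : ℕ → (Module.End ℂ V)ˣ, (∀ᶠ i in (𝓤 : Filter ℕ), x i ∈ X i) →
      ILe A 𝓤 (iU fun i => centr (x i : Module.End ℂ V)) (iU M))
    (hX' : ∀ x : ℕ → (Module.End ℂ V)ˣ, (∀ᶠ i in (𝓤 : Filter ℕ), x i ∈ X' i) →
      ILe A 𝓤 (iU fun i => centr (x i : Module.End ℂ V)) (iU M')) :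
    ∀ᶠ i in (𝓤 : Filter ℕ), ∀ b ∈ A i, ∀ b' ∈ A i, ∀ z, b⁻¹ * z * b ∈ X i →
      b'⁻¹ * z * b' ∈ X' i → cj b (M i) = cj b' (M' i) := by
  by_contra hcon
  rw [← Ultrafilter.eventually_not] at hcon
  have : ∀ i, ∃ b b' z : (Module.End ℂ V)ˣ, (¬ ∀ b ∈ A i, ∀ b' ∈ A i, ∀ z, b⁻¹ * z * b ∈ X i →
      b'⁻¹ * z * b' ∈ X' i → cj b (M i) = cj b' (M' i)) → b ∈ A i ∧ b' ∈ A i ∧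
      b⁻¹ * z * b ∈ X i ∧ b'⁻¹ * z * b' ∈ X' i ∧ cj b (M i) ≠ cj b' (M' i) := by
    intro i
    by_cases hi : ∀ b ∈ A i, ∀ b' ∈ A i, ∀ z, b⁻¹ * z * b ∈ X i →
      b'⁻¹ * z * b' ∈ X' i → cj b (M i) = cj b' (M' i)
    · exact ⟨1, 1, 1, fun hn => (hn hi).elim⟩
    · push Not at hi
      obtain ⟨b, hb, b', hb', z, h1, h2, h3⟩ := hi
      exact ⟨b, b', z, fun _ => ⟨hb, hb', h1, h2, h3⟩⟩
  choose b b' z hz using this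
  replace hcon := hcon.mono fun i hi => hz i hi
  have hb : IGam A 𝓤 b := ⟨1, hcon.mono fun i hi => by rw [pow_one]; exact hi.1⟩
  have hb' : IGam A 𝓤 b' := ⟨1, hcon.mono fun i hi => by rw [pow_one]; exact hi.2.1⟩
  have hx : IGam A 𝓤 (b⁻¹ * z * b) := by
    refine ⟨4, ?_⟩
    filter_upwards [hcon, hXA] with i h1 h2
    exact h2 h1.2.2.1
  have hzΓ : IGam A 𝓤 z := by
    have := (hb.mul hx).mul (hb.inv h.apx)
    rwa [show b * (b⁻¹ * z * b) * b⁻¹ = z by group] at this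
  have hz1 : ILe A 𝓤 (iU fun i => centr (z i : Module.End ℂ V)) (iU fun i => cj (b i) (M i)) := by
    have h1 := (hX (b⁻¹ * z * b) (hcon.mono fun i hi => hi.2.2.1)).cj h.apx hb
    refine h1.mono_left (Filter.Eventually.of_forall fun i => U_mono (le_of_eq ?_))
    simp only [cj_centr, Pi.mul_apply, Pi.inv_apply]
    congr 2
    group
  have hz2 : ILe A 𝓤 (iU fun i => centr (z i : Module.End ℂ V))
      (iU fun i => cj (b' i) (M' i)) := by
    have h1 := (hX' (b'⁻¹ * z * b') (hcon.mono fun i hi => hi.2.2.2.1)).cj h.apx hb'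
    refine h1.mono_left (Filter.Eventually.of_forall fun i => U_mono (le_of_eq ?_))
    simp only [cj_centr, Pi.mul_apply, Pi.inv_apply]
    congr 2
    group
  have heq := h.isMax_eq (hM.cj h.apx hb) (hM'.cj h.apx hb') fun hle =>
    h.not_centr_iLe hzΓ ((hz1.inf hz2).trans h.apx hle)
  obtain ⟨i, h1, h2⟩ := (heq.and hcon).exists
  exact h2.2.2.2.2 h1

lemma eventually_not_stationary (h : Bad n K A 𝓤)
    {M : ℕ → Subalgebra ℂ (Module.End ℂ V)} (hM : IsMax A 𝓤 M) :
    ∀ᶠ i in (𝓤 : Filter ℕ), ∀ k, ∃ g ∈ A i ^ (k + 1), ∀ g' ∈ A i ^ k,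
      cj g (M i) ≠ cj g' (M i) := by
  have hn : 0 < n := by have := h.two_le; omega
  obtain ⟨C, hC⟩ := triCov_of_finite_orbit h.below hn K
  obtain ⟨b, -, hb⟩ := h.exists_tri hM.conn hM.ne_bot hM.ne_top
  filter_upwards [h.bad C, hb, hM.ne_bot] with i h1 h2 h3 k
  by_contra hcon
  push Not at hcon
  have hd : 0 < finrank ℂ V := by rw [h.dim]; exact hn
  obtain ⟨W, hW⟩ := exists_isWt (M := M i) (v := b i ⟨0, hd⟩) ((b i).ne_zero _)
    fun x hx => ⟨_, tri_basis_zero (h2 hx) hd⟩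
  exact h1 (hC V h.dim (A i) (h.apx i) (h.det i) (M i) W h3 hW
    (finite_orbit_of_stationary (h.apx i) hcon))

lemma absurd (h : Bad n K A 𝓤) : False := by
  obtain ⟨M, hM⟩ := h.exists_max
  obtain ⟨C, hC⟩ := h.exists_centr_iLe
  obtain ⟨r, hr⟩ : ∃ r, r = C * K ^ 5 + 1 := ⟨_, rfl⟩
  have hg : ∀ (a : Fin r) i, ∃ g : (Module.End ℂ V)ˣ, (∀ k, ∃ g ∈ A i ^ (k + 1), ∀ g' ∈ A i ^ k,
      cj g (M i) ≠ cj g' (M i)) → g ∈ A i ^ (3 * (a : ℕ) + 3) ∧ ∀ g' ∈ A i ^ (3 * (a : ℕ) + 2),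
      cj g (M i) ≠ cj g' (M i) := by
    intro a i
    by_cases hi : ∀ k, ∃ g ∈ A i ^ (k + 1), ∀ g' ∈ A i ^ k, cj g (M i) ≠ cj g' (M i)
    · obtain ⟨g, hg⟩ := hi (3 * (a : ℕ) + 2)
      exact ⟨g, fun _ => hg⟩
    · exact ⟨1, fun hi' => (hi hi').elim⟩
  choose g hg using hg
  replace hg : ∀ᶠ i in (𝓤 : Filter ℕ), ∀ a : Fin r, g a i ∈ A i ^ (3 * (a : ℕ) + 3) ∧
      ∀ g' ∈ A i ^ (3 * (a : ℕ) + 2), cj (g a i) (M i) ≠ cj g' (M i) :=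
    (h.eventually_not_stationary hM).mono fun i hi a => hg a i hi
  have hMa : ∀ a : Fin r, IsMax A 𝓤 fun i => cj (g a i) (M i) := fun a =>
    hM.cj h.apx ⟨3 * (a : ℕ) + 3, hg.mono fun i hi => (hi a).1⟩
  choose X hX1 hX2 using fun a => hC _ (hMa a)
  have hX1' := Filter.eventually_all.2 hX1
  have hsep := Filter.eventually_all.2 fun a => Filter.eventually_all.2 fun a' =>
    h.eventually_separated (hMa a) (hMa a') ((hX1 a).mono fun i hi => hi.1) (hX2 a) (hX2 a')
  obtain ⟨i, hi1, hi2, hi3⟩ := (hg.and (hX1'.and hsep)).exists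
  have := card_le_of_conj_separated (h.apx i) (M := fun a => cj (g a i) (M i))
    (X := fun a => X a i) (fun a => (hi2 a).1) (fun a => (hi2 a).2) hi3 ?_
  · omega
  · intro a a' haa b hb b' hb' he
    refine (hi1 a').2 (b'⁻¹ * b * g a i) ?_ ?_
    · have hA := h.apx i
      have h1 := hA.mul_pow (hA.mul_pow (hA.inv_pow (hA.subset_pow one_ne_zero hb'))
        (hA.subset_pow one_ne_zero hb)) (hi1 a).1
      have h2 : (a : ℕ) < a' := haa
      exact hA.pow_mono (by omega) h1
    · rw [cj_mul, cj_mul, he, cj_inv_cj]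

end Bad

end Alg

section Assembly

variable {V V' : Type} [AddCommGroup V] [Module ℂ V] [AddCommGroup V'] [Module ℂ V']

/-- Pairs of automorphisms which agree up to a scalar after identifying the two spaces, the second
one of determinant one. -/
def relScalar (f : V ≃ₗ[ℂ] V') : Subgroup ((Module.End ℂ V)ˣ × (Module.End ℂ V')ˣ) where
  carrier := {p | LinearMap.det (p.2 : Module.End ℂ V') = 1 ∧
    ∃ c : ℂˣ, ∀ v, f ((p.1 : Module.End ℂ V) v) = (c : ℂ) • (p.2 : Module.End ℂ V') (f v)}
  mul_mem' := by
    rintro p q ⟨hp, c, hc⟩ ⟨hq, d, hd⟩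
    refine ⟨by simp [hp, hq], c * d, fun v => ?_⟩
    simp only [Prod.fst_mul, Prod.snd_mul, Units.val_mul, Module.End.mul_apply, hc, hd, map_smul,
      smul_smul]
  one_mem' := ⟨by simp, 1, fun v => by simp⟩
  inv_mem' := by
    rintro p ⟨hp, c, hc⟩
    refine ⟨?_, c⁻¹, fun v => ?_⟩
    · have h1 : LinearMap.det (((p.2)⁻¹ : (Module.End ℂ V')ˣ) : Module.End ℂ V') *
          LinearMap.det (p.2 : Module.End ℂ V') = 1 := by
        rw [← map_mul, Units.inv_mul, map_one]
      rwa [hp, mul_one] at h1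
    · simp only [Prod.fst_inv, Prod.snd_inv]
      have h1 := hc (((p.1⁻¹ : (Module.End ℂ V)ˣ) : Module.End ℂ V) v)
      rw [units_apply_inv] at h1
      rw [h1, map_smul, units_inv_apply, smul_smul, Units.inv_mul, one_smul]

lemma exists_relScalar [FiniteDimensional ℂ V'] [Nontrivial V'] (f : V ≃ₗ[ℂ] V')
    (g : (Module.End ℂ V)ˣ) : ∃ s, (g, s) ∈ relScalar f := by
  obtain ⟨c, hc⟩ := exists_sc_det (Units.mapEquiv f.conjRingEquiv.toMulEquiv g)
  refine ⟨_, hc, c⁻¹, fun v => ?_⟩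
  simp only [Units.val_mul, sc_coe, Module.End.mul_apply]
  simp [smul_smul]

lemma finite_relScalar [FiniteDimensional ℂ V'] [Nontrivial V'] (f : V ≃ₗ[ℂ] V') :
    {s | ((1 : (Module.End ℂ V)ˣ), s) ∈ relScalar f}.Finite := by
  refine (finite_scalars (V := V')).subset ?_
  rintro s ⟨hs, c, hc⟩
  refine ⟨mem_bot.2 ⟨((c⁻¹ : ℂˣ) : ℂ), LinearMap.ext fun w => ?_⟩, hs⟩
  have h1 := hc (f.symm w)
  simp only [Units.val_one, Module.End.one_apply, LinearEquiv.apply_symm_apply] at h1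
  simp only [LinearMap.smul_apply, Module.End.one_apply]
  have h2 : ((c⁻¹ : ℂˣ) : ℂ) • w = ((c⁻¹ : ℂˣ) : ℂ) • (c : ℂ) • (s : Module.End ℂ V') w := by rw [← h1]
  rw [h2, smul_smul, Units.inv_mul, one_smul]

/-- The transported basis. -/
noncomputable def pullBasis (f : V ≃ₗ[ℂ] V') (b : Module.Basis (Fin (finrank ℂ V')) ℂ V') :
    Module.Basis (Fin (finrank ℂ V)) ℂ V :=
  (b.map f.symm).reindex (finCongr f.finrank_eq.symm)

lemma mem_relScalar {f : V ≃ₗ[ℂ] V'} {g : (Module.End ℂ V)ˣ} {s : (Module.End ℂ V')ˣ} :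
    (g, s) ∈ relScalar f ↔ LinearMap.det (s : Module.End ℂ V') = 1 ∧
      ∃ c : ℂˣ, ∀ v, f ((g : Module.End ℂ V) v) = (c : ℂ) • (s : Module.End ℂ V') (f v) :=
  Iff.rfl

lemma relScalar_tri {f : V ≃ₗ[ℂ] V'} {b : Module.Basis (Fin (finrank ℂ V')) ℂ V'}
    {g : (Module.End ℂ V)ˣ} {s : (Module.End ℂ V')ˣ} (hp : (g, s) ∈ relScalar f)
    (h : (s : Module.End ℂ V') ∈ tri b) : (g : Module.End ℂ V) ∈ tri (pullBasis f b) := by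
  obtain ⟨-, c, hc⟩ := mem_relScalar.1 hp
  rw [mem_tri, mem_Fil] at h ⊢
  intro i j hij
  have h1 := h (finCongr f.finrank_eq i) (finCongr f.finrank_eq j) (by simpa using hij)
  rw [ent_apply] at h1 ⊢
  simp only [pullBasis, Module.Basis.repr_reindex_apply, Module.Basis.reindex_apply,
    Module.Basis.map_apply, Module.Basis.map_repr, LinearEquiv.trans_apply,
    LinearEquiv.symm_symm, hc, LinearEquiv.apply_symm_apply, map_smul, Finsupp.smul_apply]
  rw [smul_eq_mul]
  exact mul_eq_zero_of_right _ h1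

lemma relScalar_U_tri {f : V ≃ₗ[ℂ] V'} {b : Module.Basis (Fin (finrank ℂ V')) ℂ V'}
    {g : (Module.End ℂ V)ˣ} {s : (Module.End ℂ V')ˣ} (hp : (g, s) ∈ relScalar f)
    (h : s ∈ U (tri b)) : g ∈ U (tri (pullBasis f b)) := by
  have hp' : (g⁻¹, s⁻¹) ∈ relScalar f := Subgroup.inv_mem _ hp
  rw [mem_U] at h ⊢
  exact ⟨relScalar_tri hp h.1, relScalar_tri hp' h.2⟩

lemma exists_triCov_of_det_eq_one {n : ℕ} (hT : TBelow n) (hn : 2 ≤ n) (K : ℕ) (V : Type)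
    [AddCommGroup V] [Module ℂ V] [FiniteDimensional ℂ V] (hV : finrank ℂ V = n) :
    ∃ C : ℕ, ∀ A : Set (Module.End ℂ V)ˣ, IsApx K A →
      (∀ a ∈ A, LinearMap.det (a : Module.End ℂ V) = 1) → TriCov C A := by
  by_contra hcon
  push Not at hcon
  choose A hA using hcon
  have hbad : Bad n K A (Filter.hyperfilter ℕ) :=
    { below := hT
      two_le := hn
      dim := hV
      apx := fun i => (hA i).1
      det := fun i => (hA i).2.1
      bad := fun C => by
        have h1 : ∀ᶠ i in (Filter.hyperfilter ℕ : Filter ℕ), C ≤ i := by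
          refine Filter.Eventually.filter_mono Nat.hyperfilter_le_atTop ?_
          exact Filter.eventually_ge_atTop C
        exact h1.mono fun i hi h2 => (hA i).2.2 (h2.mono hi) }
  exact hbad.absurd

lemma triCov_of_finrank_eq {n : ℕ} (hT : TBelow n) (hn : 2 ≤ n) (K : ℕ) : ∃ C : ℕ,
    ∀ (V : Type) [AddCommGroup V] [Module ℂ V] [FiniteDimensional ℂ V], finrank ℂ V = n →
    ∀ A : Set (Module.End ℂ V)ˣ, IsApx K A → TriCov C A := by
  have hfr : finrank ℂ (Fin n → ℂ) = n := by simp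
  obtain ⟨C, hC⟩ := exists_triCov_of_det_eq_one hT hn K (Fin n → ℂ) hfr
  have : Nontrivial (Fin n → ℂ) := Module.nontrivial_of_finrank_pos (R := ℂ) (by omega)
  refine ⟨C, fun V _ _ _ hV A hA => ?_⟩
  let f : V ≃ₗ[ℂ] (Fin n → ℂ) := LinearEquiv.ofFinrankEq _ _ (hV.trans hfr.symm)
  have hl : ∀ g ∈ A, ∃ s, (g, s) ∈ relScalar f := fun g _ => exists_relScalar f g
  obtain ⟨b, hb⟩ := hC (IsApx.relImage (relScalar f) A)
    (IsApx.relImage_isApx hA hl (finite_relScalar f)) (by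
      rintro s ⟨g, -, hs⟩
      exact (mem_relScalar.1 hs).1)
  refine ⟨pullBasis f b, (IsApx.relImage_cov hl hb).mono le_rfl subset_rfl ?_⟩
  rintro g ⟨s, hs, hgs⟩
  exact relScalar_U_tri hgs hs

lemma U_tri_eq_top {n : ℕ} (hn : n ≤ 1) (b : Module.Basis (Fin n) ℂ V) (g : (Module.End ℂ V)ˣ) :
    g ∈ U (tri b) := by
  have : ∀ x : Module.End ℂ V, x ∈ tri b := by
    intro x
    rw [mem_tri, mem_Fil]
    intro i j hij
    omega
  exact mem_U.2 ⟨this _, this _⟩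

lemma tBelow (n : ℕ) : TBelow n := by
  induction n with
  | zero => exact fun K => ⟨1, fun V _ _ _ hV => (Nat.not_lt_zero _ hV).elim⟩
  | succ n ih =>
    intro K
    obtain ⟨C, hC⟩ := ih K
    obtain ⟨D, hD⟩ : ∃ D : ℕ, ∀ (V : Type) [AddCommGroup V] [Module ℂ V]
        [FiniteDimensional ℂ V], finrank ℂ V = n →
        ∀ A : Set (Module.End ℂ V)ˣ, IsApx K A → TriCov D A := by
      rcases lt_or_ge n 2 with hn | hn
      · refine ⟨1, fun V _ _ _ hV A _ => ⟨Module.finBasis ℂ V, Cov.of_subset fun g _ => ?_⟩⟩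
        exact U_tri_eq_top (by omega) _ g
      · exact triCov_of_finrank_eq ih hn K
    refine ⟨max C D, fun V _ _ _ hV A hA => ?_⟩
    rcases Nat.lt_succ_iff_lt_or_eq.1 hV with h | h
    · exact (hC V h A hA).mono (le_max_left _ _)
    · exact (hD V h A hA).mono (le_max_right _ _)

end Assembly

section Group

variable {G : Type*} [Group G]

/-- A set of small doubling contains a large subset whose quotient set is an approximate group. -/
lemma exists_isApx_of_small_doubling [DecidableEq G] {K : ℕ} {A : Finset G} (hA : A.Nonempty)
    (h : (A * A).card ≤ K * A.card) :
    ∃ X ⊆ A, X.Nonempty ∧ A.card ≤ K * X.card ∧ IsApx (K ^ 18) ((X : Set G)⁻¹ * (X : Set G)) := by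
  have hne : (A.powerset.erase ∅).Nonempty :=
    ⟨A, Finset.mem_erase.2 ⟨hA.ne_empty, Finset.mem_powerset_self A⟩⟩
  obtain ⟨X, hX, hmin⟩ := Finset.exists_min_image (A.powerset.erase ∅)
    (fun X => ((X * A).card : ℝ) / X.card) hne
  rw [Finset.mem_erase, Finset.mem_powerset, ← Finset.nonempty_iff_ne_empty] at hX
  obtain ⟨hX0, hXA⟩ := hX
  have hmin' : ∀ B ⊆ A, (X * A).card * B.card ≤ (B * A).card * X.card := by
    intro B hB
    rcases B.eq_empty_or_nonempty with rfl | hB0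
    · simp
    have h1 := hmin B (Finset.mem_erase.2 ⟨hB0.ne_empty, Finset.mem_powerset.2 hB⟩)
    rw [div_le_div_iff₀ (by exact_mod_cast hX0.card_pos) (by exact_mod_cast hB0.card_pos)] at h1
    exact_mod_cast h1
  have h1 : (X * A).card ≤ K * X.card := by
    have h2 := hmin' A subset_rfl
    have h3 := hA.card_pos
    nlinarith [Nat.mul_le_mul_right X.card h]
  have h2 : (X * X * A).card ≤ K * (X * X).card := by
    have h2 := Finset.pluennecke_petridis_inequality_mul X
      (fun B hB => hmin' B (hB.trans hXA))
    have h3 := hX0.card_pos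
    nlinarith [Nat.mul_le_mul_right (X * X).card h1]
  have h3 : (X ^ 3).card ≤ K ^ 2 * X.card := by
    have h4 : X ^ 3 ⊆ X * X * A := by
      rw [pow_succ, sq]
      exact Finset.mul_subset_mul_left hXA
    calc _ ≤ _ := Finset.card_le_card h4
      _ ≤ K * (X * X).card := h2
      _ ≤ K * (X * A).card :=
        Nat.mul_le_mul_left _ (Finset.card_le_card (Finset.mul_subset_mul_left hXA))
      _ ≤ K * (K * X.card) := Nat.mul_le_mul_left _ h1
      _ = _ := by ring
  refine ⟨X, hXA, hX0, ?_, ?_, ?_, ?_, ?_⟩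
  · refine le_trans ?_ h1
    exact Finset.card_le_card_mul_left hX0
  · exact X.finite_toSet.inv.mul X.finite_toSet
  · obtain ⟨x, hx⟩ := hX0
    exact ⟨x⁻¹, Set.inv_mem_inv.2 hx, x, hx, inv_mul_cancel x⟩
  · rintro _ ⟨x, hx, y, hy, rfl⟩
    refine ⟨y⁻¹, Set.inv_mem_inv.2 hy, x⁻¹, hx, ?_⟩
    simp
  · have h4 : ((X ^ 3).card : ℝ) ≤ ((K ^ 2 : ℕ) : ℝ) * X.card := by exact_mod_cast h3
    have h5 := Finset.small_alternating_pow_of_small_tripling (m := 5) (by norm_num) h4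
      ![-1, 1, -1, 1, -1] (by intro i; fin_cases i <;> simp)
    have h6 : ((X⁻¹ * X * (X⁻¹ * X) * X⁻¹).card : ℝ) ≤ ((K ^ 18 : ℕ) : ℝ) * (X⁻¹).card := by
      rw [Finset.card_inv]
      convert h5 using 2
      · simp [List.finRange_succ, mul_assoc]
      · push_cast; ring
    obtain ⟨F, -, hF, hcov⟩ := Finset.ruzsa_covering_mul hX0.inv h6
    have hF' : F.card ≤ K ^ 18 := by exact_mod_cast hF
    refine ⟨F, hF', ?_⟩
    intro s hs
    have hs' : s ∈ X⁻¹ * X * (X⁻¹ * X) := by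
      rw [← Finset.mem_coe]; push_cast; exact hs
    obtain ⟨y, hy, t, ht, rfl⟩ := Finset.mem_mul.1 (hcov hs')
    refine ⟨y, hy, ?_⟩
    rw [div_inv_eq_mul, ← Finset.mem_coe] at ht
    push_cast at ht
    simpa using ht

lemma isSolvable_of_chain (H : Subgroup G) (N : ℕ → Subgroup G) (h0 : H ≤ N 0)
    (hN : ∀ k, ⁅N k, N k⁆ ≤ N (k + 1)) {m : ℕ} (hm : N m = ⊥) : Group.IsSolvable H := by
  have h1 : ∀ k, (derivedSeries H k).map H.subtype ≤ N k := by
    intro k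
    induction k with
    | zero =>
      rintro _ ⟨x, -, rfl⟩
      exact h0 x.2
    | succ k ih =>
      rw [derivedSeries_succ, Subgroup.map_commutator]
      exact (Subgroup.commutator_mono ih ih).trans (hN k)
  refine ⟨m, ?_⟩
  rw [← (derivedSeries H m).map_eq_bot_iff_of_injective H.subtype_injective, ← le_bot_iff, ← hm]
  exact h1 m

/-- Adjoining an element normalizing `N` gives a group whose commutators lie in `N`. -/
lemma exists_subgroup_of_normalizes {N : Subgroup G} {y : G} (hy : y ∈ Subgroup.normalizer N) :
    ∃ H : Subgroup G, (∀ n ∈ N, y * n ∈ H) ∧ ⁅H, H⁆ ≤ N := by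
  let M := Subgroup.normalizer (N : Set G)
  let q : M →* M ⧸ N.subgroupOf M := QuotientGroup.mk' _
  refine ⟨((Subgroup.zpowers (q ⟨y, hy⟩)).comap q).map M.subtype, fun n hn => ?_, ?_⟩
  · have hn' : n ∈ M := Subgroup.le_normalizer hn
    refine ⟨⟨y, hy⟩ * ⟨n, hn'⟩, ?_, rfl⟩
    have h1 : q ⟨n, hn'⟩ = 1 := (QuotientGroup.eq_one_iff _).2 (Subgroup.mem_subgroupOf.2 hn)
    refine Subgroup.mem_comap.2 ?_
    rw [map_mul, h1, mul_one]
    exact Subgroup.mem_zpowers _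
  · rw [Subgroup.commutator_le]
    rintro _ ⟨(a : M), ha, rfl⟩ _ ⟨(c : M), hc, rfl⟩
    obtain ⟨k, hk⟩ := Subgroup.mem_zpowers_iff.1 ha
    obtain ⟨l, hl⟩ := Subgroup.mem_zpowers_iff.1 hc
    have h1 : q (a * c * a⁻¹ * c⁻¹) = 1 := by
      rw [map_mul, map_mul, map_mul, map_inv, map_inv, ← hk, ← hl]
      group
    exact Subgroup.mem_subgroupOf.1 ((QuotientGroup.eq_one_iff _).1 h1)

/-- A popular product yields a large piece of a coset of `N` inside a right coset of the
intersection of `N` with a conjugate. -/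
lemma exists_popular_coset {K : ℕ} {S : Set G} (hS : S.Finite) (hK : (S * S).ncard ≤ K * S.ncard)
    {y : G} {N : Subgroup G} (hN : ∀ s ∈ S, y⁻¹ * s ∈ N) (hS0 : S.Nonempty) :
    ∃ s₀ ∈ S, ∃ T ⊆ S, S.ncard ≤ K * T.ncard ∧
      ∀ s ∈ T, s * s₀⁻¹ ∈ N ∧ y⁻¹ * (s * s₀⁻¹) * y ∈ N := by
  classical
  lift S to Finset G using hS
  rw [← Finset.coe_mul, Set.ncard_coe_finset, Set.ncard_coe_finset] at hK
  have hS0 : S.Nonempty := by simpa using hS0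
  let T : G → Finset G := fun p => S.filter fun s => p * s⁻¹ ∈ S
  obtain ⟨p, hp, hmax⟩ := Finset.exists_max_image (S * S) (fun p => (T p).card) (hS0.mul hS0)
  obtain ⟨a, ha, s₀, hs₀, rfl⟩ := Finset.mem_mul.1 hp
  refine ⟨s₀, hs₀, T (a * s₀), Finset.coe_subset.2 (Finset.filter_subset _ _), ?_, ?_⟩
  · have h1 : (S ×ˢ S).card ≤ (T (a * s₀)).card * (S * S).card := by
      refine Finset.card_le_mul_card_image_of_maps_to (f := fun x : G × G => x.1 * x.2) ?_ _ ?_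
      · intro x hx
        exact Finset.mul_mem_mul (Finset.mem_product.1 hx).1 (Finset.mem_product.1 hx).2
      · intro c hc
        refine le_trans ?_ (hmax c hc)
        refine Finset.card_le_card_of_injOn Prod.snd ?_ ?_
        · rintro ⟨x, z⟩ hx
          simp only [Finset.coe_filter, Finset.mem_product, Set.mem_ofPred_eq] at hx
          obtain ⟨⟨hx, hz⟩, rfl⟩ := hx
          simpa [T, hz] using hx
        · rintro ⟨x, z⟩ hx ⟨x', z'⟩ hx' (rfl : z = z')
          simp only [Finset.coe_filter, Set.mem_ofPred_eq] at hx hx'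
          rw [mul_right_cancel (hx.2.trans hx'.2.symm)]
    rw [Finset.card_product] at h1
    rw [Set.ncard_coe_finset, Set.ncard_coe_finset]
    have h2 := Nat.mul_le_mul_left (T (a * s₀)).card hK
    refine Nat.le_of_mul_le_mul_right (a := S.card) ?_ hS0.card_pos
    calc _ ≤ _ := h1.trans h2
      _ = _ := by ring
  · intro s hs
    obtain ⟨hs, hs'⟩ := Finset.mem_filter.1 (Finset.mem_coe.1 hs)
    constructor
    · have := N.inv_mem (N.mul_mem (N.inv_mem (hN a ha)) (hN _ hs'))
      convert this using 1
      group
    · have := N.mul_mem (hN s hs) (N.inv_mem (hN s₀ hs₀))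
      convert this using 1
      group

end Group

section Alg

variable {V : Type} [AddCommGroup V] [Module ℂ V]

lemma isSolvable_of_commutator_le_tri {n : ℕ} (b : Module.Basis (Fin n) ℂ V)
    {H : Subgroup (Module.End ℂ V)ˣ} (hH : ⁅H, H⁆ ≤ U (tri b)) : Group.IsSolvable H := by
  refine isSolvable_of_chain H (fun k => Nat.casesOn k H fun k => NN b k) le_rfl ?_
    (m := n + 1) ?_
  · rintro (_ | k)
    · exact hH.trans NN_zero.ge
    · refine Subgroup.commutator_le.2 fun x hx y hy => ?_
      refine NN_comm (NN_le_tri _ hy) hx fun i j hij => ?_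
      rcases Nat.eq_zero_or_pos k with rfl | hk
      · right
        rw [show i = j from Fin.ext hij.symm]
      · right
        have h1 : ∀ i, ent b (y : Module.End ℂ V) i i = 1 := fun i => by
          have h2 := mem_Fil.1 hy.2 i i (by omega)
          rwa [ent_sub, ent_one, if_pos rfl, sub_eq_zero] at h2
        rw [h1, h1]
  · exact (Subgroup.eq_bot_iff_forall _).2 fun g hg => NN_top hg

/-- A large subset of a coset of a triangular group meets a solvable group in a large set. -/
lemma exists_solvable_of_coset [FiniteDimensional ℂ V] (n K d : ℕ) :
    ∀ c : ℕ, ∃ C : ℕ, ∀ b : Module.Basis (Fin n) ℂ V, ∀ A : Set (Module.End ℂ V)ˣ, A.Finite → A.Nonempty →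
      (A * A).ncard ≤ K * A.ncard → ∀ E ≤ tri b, finrank ℂ E < d → ∀ S ⊆ A,
      A.ncard ≤ c * S.ncard → ∀ y, (∀ s ∈ S, y⁻¹ * s ∈ U E) →
      ∃ T ⊆ A, A.ncard ≤ C * T.ncard ∧ ∃ H : Subgroup (Module.End ℂ V)ˣ, Group.IsSolvable H ∧
        T ⊆ H := by
  have key : ∀ b : Module.Basis (Fin n) ℂ V, ∀ A S : Set (Module.End ℂ V)ˣ, S ⊆ A → ∀ E ≤ tri b, ∀ y : (Module.End ℂ V)ˣ,
      cj y E = E → (∀ s ∈ S, y⁻¹ * s ∈ U E) → ∃ H : Subgroup (Module.End ℂ V)ˣ,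
      Group.IsSolvable H ∧ S ⊆ H := by
    intro b A S hSA E hE y hy hS
    have hy' : y ∈ Subgroup.normalizer (U E : Set (Module.End ℂ V)ˣ) := by
      refine Subgroup.mem_normalizer_iff.2 fun g => ?_
      nth_rewrite 2 [← hy]
      rw [mem_U_cj]
      simp [mul_assoc]
    obtain ⟨H, hH1, hH2⟩ := exists_subgroup_of_normalizes hy'
    refine ⟨H, isSolvable_of_commutator_le_tri b (hH2.trans (U_mono hE)), fun s hs => ?_⟩
    simpa using hH1 _ (hS s hs)
  induction d with
  | zero => exact fun c => ⟨c, fun b A hA hA0 hK E hE hd => (Nat.not_lt_zero _ hd).elim⟩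
  | succ d ih =>
    intro c
    obtain ⟨C, hC⟩ := ih (c * (K * c))
    refine ⟨max c C, fun b A hA hA0 hK E hE hd S hSA hS y hy => ?_⟩
    by_cases hyE : cj y E = E
    · exact ⟨S, hSA, hS.trans (Nat.mul_le_mul_right _ (le_max_left _ _)),
        key b A S hSA E hE y hyE hy⟩
    have hSf := hA.subset hSA
    have hS0 : S.Nonempty := by
      rw [← Set.ncard_pos hSf]
      have := (Set.ncard_pos hA).2 hA0
      exact Nat.pos_of_mul_pos_left (this.trans_le hS)
    have hSS : (S * S).ncard ≤ K * c * S.ncard := by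
      calc _ ≤ (A * A).ncard := Set.ncard_le_ncard (Set.mul_subset_mul hSA hSA) (hA.mul hA)
        _ ≤ K * A.ncard := hK
        _ ≤ K * (c * S.ncard) := Nat.mul_le_mul_left _ hS
        _ = _ := by ring
    obtain ⟨s₀, hs₀, T, hTS, hTc, hT⟩ := exists_popular_coset hSf hSS hy hS0
    have hle : cj s₀⁻¹ (E ⊓ cj y E) ≤ E := by
      have h1 : cj (y⁻¹ * s₀)⁻¹ E = E := mem_nz.1 (U_le_nz E ((U E).inv_mem (hy s₀ hs₀)))
      calc _ ≤ cj s₀⁻¹ (cj y E) := cj_mono _ inf_le_right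
        _ = E := by rw [← cj_mul]; simpa using h1
    have hrec := hC b A hA hA0 hK (cj s₀⁻¹ (E ⊓ cj y E)) (hle.trans hE) ?_ T
      (hTS.trans hSA) ?_ s₀ ?_
    · obtain ⟨T', hT'⟩ := hrec
      exact ⟨T', hT'.1, hT'.2.1.trans (Nat.mul_le_mul_right _ (le_max_right _ _)), hT'.2.2⟩
    · have h1 : finrank ℂ (E ⊓ cj y E : Subalgebra ℂ (Module.End ℂ V)) < finrank ℂ E := by
        by_contra hcon
        have h2 := subalg_eq_of_finrank (inf_le_left : E ⊓ cj y E ≤ E) (not_lt.1 hcon)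
        exact hyE (cj_eq_of_le (inf_eq_left.1 h2))
      have := finrank_cj_le s₀⁻¹ (E ⊓ cj y E)
      omega
    · calc _ ≤ c * S.ncard := hS
        _ ≤ c * (K * c * T.ncard) := Nat.mul_le_mul_left _ hTc
        _ = _ := by ring
    · intro s hs
      rw [mem_U_cj, U_inf]
      have h1 : s₀⁻¹⁻¹ * (s₀⁻¹ * s) * s₀⁻¹ = s * s₀⁻¹ := by group
      rw [h1]
      exact ⟨(hT s hs).1, mem_U_cj.2 (hT s hs).2⟩

/-- Sets of small doubling in the linear group have a large solvable piece. -/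
lemma exists_large_solvable_subset [FiniteDimensional ℂ V] (K : ℕ) : ∃ C : ℕ,
    ∀ A : Set (Module.End ℂ V)ˣ, A.Finite → A.Nonempty → (A * A).ncard ≤ K * A.ncard →
      ∃ T ⊆ A, A.ncard ≤ C * T.ncard ∧ ∃ H : Subgroup (Module.End ℂ V)ˣ, Group.IsSolvable H ∧
        T ⊆ H := by
  classical
  obtain ⟨C, hC⟩ := tBelow (finrank ℂ V + 1) (K ^ 18)
  obtain ⟨D, hD⟩ := exists_solvable_of_coset (V := V) (finrank ℂ V) K
    (finrank ℂ (Module.End ℂ V) + 1) (K * C)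
  refine ⟨D, fun A hA hA0 hK => ?_⟩
  obtain ⟨X, hXA, ⟨x, hx⟩, hcard, hX⟩ := exists_isApx_of_small_doubling (K := K)
    (A := hA.toFinset) (by simpa using hA0) (by
      rw [← Set.ncard_eq_toFinset_card A hA, ← Set.ncard_coe_finset, Finset.coe_mul,
        Set.Finite.coe_toFinset]
      exact hK)
  rw [← Set.ncard_eq_toFinset_card A hA] at hcard
  obtain ⟨b, Y, hY, hb⟩ := hC V (Nat.lt_succ_self _) _ hX
  have hXcov : Cov C (X : Set (Module.End ℂ V)ˣ) (U (tri b)) := by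
    refine ⟨Y.image (x * ·), Finset.card_image_le.trans hY, fun z hz => ?_⟩
    obtain ⟨y, hy, h⟩ := hb (x⁻¹ * z) (Set.mul_mem_mul (Set.inv_mem_inv.2 hx) hz)
    refine ⟨x * y, Finset.mem_image_of_mem _ hy, ?_⟩
    rwa [mul_inv_rev, mul_assoc]
  obtain ⟨y, hy⟩ := hXcov.exists_heavy X.finite_toSet
  have hXA' : (X : Set (Module.End ℂ V)ˣ) ⊆ A := fun z hz => hA.mem_toFinset.1 (hXA hz)
  let S := (fun z => y * z) '' {z ∈ (U (tri b) : Set (Module.End ℂ V)ˣ) | y * z ∈ (X : Set _)}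
  refine hD b A hA hA0 hK (tri b) le_rfl (Nat.lt_succ_of_le ?_) S ?_ ?_ y ?_
  · exact Submodule.finrank_le (Subalgebra.toSubmodule (tri b))
  · rintro _ ⟨z, hz, rfl⟩
    exact hXA' hz.2
  · rw [Set.ncard_image_of_injective _ (mul_right_injective y), mul_assoc]
    rw [Set.ncard_coe_finset] at hy
    exact hcard.trans (Nat.mul_le_mul_left _ hy)
  · rintro _ ⟨z, hz, rfl⟩
    simpa using hz.1

end Alg

end ApproxLinear

/-- Hrushovski's theorem: a finite subset of `SL_n(ℂ)` with doubling at most `K` has a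
proportion `≥ 1/C` subset contained in a solvable subgroup. -/
theorem hrushovski_theorem (n : ℕ) (hn : 0 < n) (K : ℝ) (hK : 1 ≤ K) :
    ∃ C : ℝ, 1 ≤ C ∧
      ∀ A : Set (Matrix.SpecialLinearGroup (Fin n) ℂ), A.Finite → A.Nonempty →
        ((A * A).ncard : ℝ) ≤ K * A.ncard →
        ∃ A' ⊆ A, (A.ncard : ℝ) ≤ C * A'.ncard ∧
          ∃ H : Subgroup (Matrix.SpecialLinearGroup (Fin n) ℂ),
            IsSolvable H ∧ A' ⊆ (H : Set _) := by
  obtain ⟨C, hC⟩ := ApproxLinear.exists_large_solvable_subset (V := Fin n → ℂ) ⌈K⌉₊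
  refine ⟨max 1 C, le_max_left _ _, fun A hA hA0 hAA => ?_⟩
  let φ : Matrix.SpecialLinearGroup (Fin n) ℂ →* (Module.End ℂ (Fin n → ℂ))ˣ :=
    MonoidHom.toHomUnits
      { toFun := fun g => Matrix.toLin' (g : Matrix (Fin n) (Fin n) ℂ)
        map_one' := by simp [Module.End.one_eq_id]
        map_mul' := fun g h => by simp [Module.End.mul_eq_comp, Matrix.toLin'_mul] }
  have hφ : Function.Injective φ := fun g h hgh =>
    Subtype.ext (Matrix.toLin'.injective (congrArg Units.val hgh))
  obtain ⟨T, hTA, hT, H, hH, hTH⟩ := hC (φ '' A) (hA.image φ) (hA0.image φ) (by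
    rw [← Set.image_mul, Set.ncard_image_of_injective _ hφ, Set.ncard_image_of_injective _ hφ]
    have h1 : ((A * A).ncard : ℝ) ≤ ⌈K⌉₊ * A.ncard :=
      hAA.trans (mul_le_mul_of_nonneg_right (Nat.le_ceil K) (Nat.cast_nonneg _))
    exact_mod_cast h1)
  have hTeq : φ '' (φ ⁻¹' T) = T := Set.image_preimage_eq_of_subset (hTA.trans (Set.image_subset_range _ _))
  refine ⟨φ ⁻¹' T, ?_, ?_, H.comap φ, ?_, fun g hg => hTH hg⟩
  · intro g hg
    obtain ⟨a, ha, hag⟩ := hTA hg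
    rwa [← hφ hag]
  · rw [Set.ncard_image_of_injective _ hφ, ← hTeq, Set.ncard_image_of_injective _ hφ] at hT
    have h1 : (A.ncard : ℝ) ≤ C * (φ ⁻¹' T).ncard := by exact_mod_cast hT
    exact h1.trans (mul_le_mul_of_nonneg_right (le_max_right _ _) (Nat.cast_nonneg _))
  · exact Group.isSolvable_of_isSolvable_injective (f := (φ.subgroupComap H)) fun x y hxy =>
      Subtype.ext (hφ (congrArg Subtype.val hxy))
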